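/- arXiv:alg-geom/9712002 — 3 statements merged into one kernel-verified Lean document; each statement's English description precedes it below -/
import Mathlib

section
/- Let (λ_n)_{n∈ℕ} be a sequence of positive real numbers tending to infinity (so that N(B) := #{n : λ_n ≤ B} is finite for every real B), and suppose the Dirichlet series Z(s) = Σ_n λ_n^{−s} converges for Re(s) > a, where a > 0. Assume there exist ε > 0, a real number Θ > 0, an integer b ≥ 1, and a function f holomorphic on the half-plane {s ∈ ℂ : Re(s) > a − ε} such that Z(s) = Θ/(s−a)^b + f(s)/(s−a)^{b−1} for all s with Re(s) > a. Then N(B) = (Θ/(a·(b−1)!))·B^a·(log B)^{b−1}·(1+o(1)) as B → ∞. -/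
open Filter Topology Real

open MeasureTheory FourierTransform Convolution in
lemma dt_kernel_exists (m : ℕ) : ∃ (φ : ℝ → ℂ) (κ : ℝ → ℝ), Continuous φ ∧ HasCompactSupport φ ∧
    (∀ y, 𝓕 φ y = (κ y : ℂ)) ∧ (∀ y, 0 ≤ κ y) ∧ Continuous κ ∧
    Integrable (fun y => (1 + |y|) ^ m * κ y) ∧ ∫ y, κ y = 1 := by
  let ψ₀ : ContDiffBump (0 : ℝ) := ⟨1, 2, by norm_num, by norm_num⟩
  let ψ : ℝ → ℂ := fun x => (ψ₀ x : ℂ)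
  have hψs : HasCompactSupport ψ := ψ₀.hasCompactSupport.comp_left (g := fun x : ℝ => (x : ℂ)) (by simp)
  have hψd : ContDiff ℝ (⊤ : ℕ∞) ψ := Complex.ofRealCLM.contDiff.comp ψ₀.contDiff
  have hψc : Continuous ψ := hψd.continuous
  have hψi : Integrable ψ := hψc.integrable_of_hasCompactSupport hψs
  let S : SchwartzMap ℝ ℂ := hψs.toSchwartzMap hψd
  have hSψ : ∀ x, S x = ψ x := fun x => rfl
  let F : SchwartzMap ℝ ℂ := 𝓕 S
  have hF : ∀ w, F w = 𝓕 ψ w := fun w => by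
    change (𝓕 S) w = _
    rw [SchwartzMap.fourier_coe]; rfl
  -- realness
  have hreal : ∀ w, (starRingEnd ℂ) (F w) = F w := by
    intro w
    rw [hF, fourier_real_eq_integral_exp_smul, ← integral_conj, ← integral_neg_eq_self]
    congr 1
    ext v
    simp only [smul_eq_mul, map_mul, ← Complex.exp_conj, ψ, Complex.conj_ofReal, Complex.conj_I,
      ContDiffBump.neg]
    congr 2
    push_cast; ring
  have hsq : ∀ w, F w * F w = ((‖F w‖ ^ 2 : ℝ) : ℂ) := by
    intro w
    nth_rewrite 2 [← hreal w]
    rw [Complex.mul_conj, Complex.normSq_eq_norm_sq]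
  have hFsqint : Integrable (fun y => (1 + |y|) ^ m * ‖F y‖ ^ 2) := by
    have h1 := F.integrable_pow_mul volume 0
    have h2 := F.integrable_pow_mul volume m
    have h3 : Integrable (fun y => 2 ^ m * (‖y‖ ^ 0 * ‖F y‖ + ‖y‖ ^ m * ‖F y‖)) :=
      (h1.add h2).const_mul _
    have h4 : Integrable (fun y => (1 + |y|) ^ m * ‖F y‖) := by
      refine h3.mono' (by fun_prop) (Eventually.of_forall fun y => ?_)
      rw [Real.norm_of_nonneg (by positivity)]
      have : (1 + |y|) ^ m ≤ 2 ^ m * (1 + |y| ^ m) := by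
        rcases le_total 1 |y| with h | h
        · calc (1 + |y|) ^ m ≤ (2 * |y|) ^ m := by gcongr; linarith
            _ = 2 ^ m * |y| ^ m := mul_pow _ _ _
            _ ≤ _ := by gcongr; linarith
        · calc (1 + |y|) ^ m ≤ 2 ^ m := by gcongr; linarith
            _ ≤ _ := le_mul_of_one_le_right (by positivity) (by linarith [pow_nonneg (abs_nonneg y) m])
      calc _ ≤ 2 ^ m * (1 + |y| ^ m) * ‖F y‖ := by gcongr
        _ = _ := by simp [Real.norm_eq_abs]; ring
    obtain ⟨C, hC⟩ : ∃ C, ∀ y, ‖F y‖ ≤ C :=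
      ⟨_, fun y => F.toBoundedContinuousFunction.norm_coe_le_norm y⟩
    have : Integrable (fun y => ‖F y‖ * ((1 + |y|) ^ m * ‖F y‖)) :=
      h4.bdd_mul (c := C) (by fun_prop) (Eventually.of_forall fun y => by simpa using hC y)
    refine this.congr (Eventually.of_forall fun y => by simp only; ring)
  have hpos : 0 < ∫ y, ‖F y‖ ^ 2 := by
    have := SchwartzMap.integral_norm_sq_fourier S
    change ∫ y, ‖(𝓕 S) y‖ ^ 2 > 0
    rw [this]
    have hc : Continuous fun y => ‖S y‖ ^ 2 := by fun_prop
    refine hc.integral_pos_of_hasCompactSupport_nonneg_nonzero (x := 0) ?_ (fun y => by positivity) ?_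
    · exact hψs.comp_left (g := fun z : ℂ => ‖z‖ ^ 2) (by simp)
    · rw [hSψ]
      have : ψ₀ 0 = 1 := ψ₀.one_of_mem_closedBall (by simp [ψ₀])
      simp [ψ, this]
  set c := ∫ y, ‖F y‖ ^ 2 with hc
  refine ⟨(c⁻¹ : ℂ) • (ψ ⋆[ContinuousLinearMap.mul ℂ ℂ] ψ), fun y => c⁻¹ * ‖F y‖ ^ 2, ?_, ?_, ?_, ?_, ?_, ?_, ?_⟩
  · exact (hψs.continuous_convolution_right _ hψi.locallyIntegrable hψc).const_smul _
  · exact (hψs.convolution _ hψs).smul_left (f := fun _ => (c⁻¹ : ℂ))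
  · intro y
    have : 𝓕 ((c⁻¹ : ℂ) • (ψ ⋆[ContinuousLinearMap.mul ℂ ℂ] ψ)) y
        = (c⁻¹ : ℂ) • 𝓕 (ψ ⋆[ContinuousLinearMap.mul ℂ ℂ] ψ) y := by
      simp only [fourier_real_eq_integral_exp_smul, Pi.smul_apply]
      rw [← integral_smul]
      congr 1; ext v; simp; ring
    rw [this, Real.fourier_mul_convolution_eq hψi hψi, ← hF, hsq]
    push_cast; simp
  · intro y; positivity
  · fun_prop
  · refine (hFsqint.const_mul c⁻¹).congr (Eventually.of_forall fun y => by simp only; ring)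
  · rw [integral_const_mul, ← hc, inv_mul_cancel₀ hpos.ne']

open MeasureTheory FourierTransform in
lemma dt_kernel_scaled (m : ℕ) (δ η : ℝ) (hδ : 0 < δ) (hη : 0 < η) :
    ∃ (φ : ℝ → ℂ) (κ : ℝ → ℝ), Continuous φ ∧ HasCompactSupport φ ∧
    (∀ y, 𝓕 φ y = (κ y : ℂ)) ∧ (∀ y, 0 ≤ κ y) ∧ Continuous κ ∧
    Integrable (fun y => (1 + |y|) ^ m * κ y) ∧ ∫ y, κ y = 1 ∧
    ∫ y in {y | δ < |y|}, (1 + |y|) ^ m * κ y ≤ η := by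
  obtain ⟨φ, κ, h1, h2, h3, h4, h5, h6, h7⟩ := dt_kernel_exists m
  have hlim : Tendsto (fun r : ℝ => ∫ y, {y | r * δ < |y|}.indicator (fun y => (1 + |y|) ^ m * κ y) y)
      atTop (𝓝 (∫ y : ℝ, (0:ℝ))) := by
    refine tendsto_integral_filter_of_dominated_convergence (fun y => (1 + |y|) ^ m * κ y)
      (Eventually.of_forall fun r => ?_) (Eventually.of_forall fun r => Eventually.of_forall fun y => ?_)
      h6 (Eventually.of_forall fun y => ?_)
    · exact (h6.1).indicator (measurableSet_lt (by fun_prop) (by fun_prop))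
    · refine (norm_indicator_le_norm_self _ _).trans ?_
      rw [Real.norm_of_nonneg]
      have := h4 y
      positivity
    · refine tendsto_const_nhds.congr' ?_
      filter_upwards [eventually_ge_atTop (|y| / δ)] with r hr
      rw [Set.indicator_of_notMem]
      simp only [Set.mem_ofPred_eq, not_lt]
      rwa [div_le_iff₀ hδ] at hr
  rw [integral_zero] at hlim
  obtain ⟨r, hr1, hr⟩ := ((eventually_ge_atTop (1:ℝ)).and (hlim.eventually_lt_const hη)).exists
  have hr0 : 0 < r := by linarith
  have hle : ∀ y, (1 + |y|) ^ m * (r * κ (r * y)) ≤ r * ((1 + |r * y|) ^ m * κ (r * y)) := by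
    intro y
    have : |y| ≤ |r * y| := by
      rw [abs_mul, abs_of_pos hr0]; exact le_mul_of_one_le_left (abs_nonneg _) hr1
    calc _ = r * ((1 + |y|) ^ m * κ (r * y)) := by ring
      _ ≤ _ := by have := h4 (r * y); gcongr
  have hi1 : Integrable (fun y => r * ((1 + |r * y|) ^ m * κ (r * y))) :=
    (h6.comp_mul_left' hr0.ne').const_mul r
  have hi2 : Integrable (fun y => (1 + |y|) ^ m * (r * κ (r * y))) := by
    refine hi1.mono' (by fun_prop) (Eventually.of_forall fun y => ?_)
    rw [Real.norm_of_nonneg (by have := h4 (r * y); positivity)]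
    exact hle y
  refine ⟨fun x => φ (r⁻¹ * x), fun y => r * κ (r * y), by fun_prop, ?_, ?_, ?_, by fun_prop, hi2, ?_, ?_⟩
  · exact h2.comp_homeomorph (Homeomorph.mulLeft₀ r⁻¹ (inv_ne_zero hr0.ne'))
  · intro y
    push_cast
    rw [← h3, fourier_real_eq_integral_exp_smul, fourier_real_eq_integral_exp_smul]
    have := Measure.integral_comp_mul_left
      (fun v : ℝ => Complex.exp (↑(-2 * π * v * (r * y)) * Complex.I) • φ v) r⁻¹
    rw [inv_inv, abs_of_pos hr0] at this
    rw [← Complex.real_smul, ← this]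
    congr 1; ext v
    congr 4
    field_simp
  · intro y; have := h4 (r * y); positivity
  · rw [integral_const_mul, Measure.integral_comp_mul_left, h7, abs_of_pos (by positivity)]
    simp [hr0.ne']
  · calc _ ≤ ∫ y in {y | δ < |y|}, r * ((1 + |r * y|) ^ m * κ (r * y)) :=
          setIntegral_mono hi2.integrableOn hi1.integrableOn hle
      _ = ∫ y, r * {y | r * δ < |y|}.indicator (fun y => (1 + |y|) ^ m * κ y) (r * y) := by
          rw [← integral_indicator (measurableSet_lt (by fun_prop) (by fun_prop))]
          congr 1; ext y
          have : (r * y ∈ {y : ℝ | r * δ < |y|}) ↔ y ∈ {y : ℝ | δ < |y|} := by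
            simp only [Set.mem_ofPred_eq, abs_mul, abs_of_pos hr0]
            exact mul_lt_mul_iff_right₀ hr0
          by_cases hy : y ∈ {y : ℝ | δ < |y|}
          · rw [Set.indicator_of_mem hy, Set.indicator_of_mem (this.2 hy)]
          · rw [Set.indicator_of_notMem hy, Set.indicator_of_notMem (fun h => hy (this.1 h)), mul_zero]
      _ = ∫ y, {y | r * δ < |y|}.indicator (fun y => (1 + |y|) ^ m * κ y) y := by
          rw [integral_const_mul, Measure.integral_comp_mul_left, abs_of_pos (by positivity)]
          simp [hr0.ne']
      _ ≤ η := hr.le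

open MeasureTheory FourierTransform in
lemma dt_flip (B φ : ℝ → ℂ) (hB : Integrable B) (hφ : Continuous φ) (hφs : HasCompactSupport φ) (T : ℝ) :
    ∫ ξ, 𝓕 B ξ * (Complex.exp (↑(2 * π * T * ξ) * Complex.I) * φ ξ) = ∫ u, B u * 𝓕 φ (u - T) := by
  set q : ℝ → ℂ := fun ξ => Complex.exp (↑(2 * π * T * ξ) * Complex.I) * φ ξ with hq
  have hqc : Continuous q := by fun_prop
  have hqi : Integrable q := hqc.integrable_of_hasCompactSupport hφs.mul_left
  have h := VectorFourier.integral_fourierIntegral_smul_eq_flip (μ := volume) (ν := volume)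
    (L := innerₗ ℝ) Real.continuous_fourierChar (by fun_prop) hB hqi
  rw [flip_innerₗ] at h
  have h2 : ∀ u, 𝓕 q u = 𝓕 φ (u - T) := by
    intro u
    rw [fourier_real_eq_integral_exp_smul, fourier_real_eq_integral_exp_smul]
    congr 1; ext v
    simp only [hq, smul_eq_mul, ← mul_assoc, ← Complex.exp_add]
    congr 2; push_cast; ring
  simp only [← h2]
  exact h

open MeasureTheory in
lemma dt_laplace_pow (k : ℕ) (z : ℂ) (hz : 0 < z.re) :
    IntegrableOn (fun u : ℝ => (u : ℂ) ^ k * Complex.exp (-z * u)) (Set.Ioi 0) ∧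
    ∫ u in Set.Ioi (0 : ℝ), (u : ℂ) ^ k * Complex.exp (-z * u) = k.factorial / z ^ (k + 1) := by
  have hz0 : z ≠ 0 := by rintro rfl; simp at hz
  have hI : ∀ k : ℕ, IntegrableOn (fun u : ℝ => (u : ℂ) ^ k * Complex.exp (-z * u)) (Set.Ioi 0) := by
    intro k
    have := integrableOn_rpow_mul_exp_neg_mul_rpow (p := 1) (s := k) (b := z.re)
      (by have : (0:ℝ) ≤ k := by positivity
          linarith) one_pos hz
    refine Integrable.mono' this (by fun_prop) ?_
    refine (ae_restrict_iff' measurableSet_Ioi).2 (Eventually.of_forall fun u hu => ?_)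
    have hu : 0 < u := hu
    rw [norm_mul, norm_pow, Complex.norm_exp, Complex.norm_real, Real.norm_of_nonneg hu.le]
    simp
  refine ⟨hI k, ?_⟩
  induction k with
  | zero =>
    have := integral_exp_mul_complex_Ioi (a := -z) (by simpa using hz) 0
    simp only [pow_zero, one_mul]
    rw [this]; simp [neg_div_neg_eq]
  | succ k ih =>
    have hd : ∀ u ∈ Set.Ioi (0:ℝ), HasDerivAt (fun u : ℝ => -((u : ℂ) ^ (k + 1) * Complex.exp (-z * u)) / z)
        ((u : ℂ) ^ (k + 1) * Complex.exp (-z * u) - ((k + 1) / z) * ((u : ℂ) ^ k * Complex.exp (-z * u))) u := by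
      intro u _
      have h1 : HasDerivAt (fun u : ℂ => -(u ^ (k + 1) * Complex.exp (-z * u)) / z)
        ((u : ℂ) ^ (k + 1) * Complex.exp (-z * u) - ((k + 1) / z) * ((u : ℂ) ^ k * Complex.exp (-z * u))) u := by
        have ha : HasDerivAt (fun u : ℂ => u ^ (k + 1)) (((k + 1 : ℕ) : ℂ) * (u : ℂ) ^ k) u := by
          simpa using hasDerivAt_pow (k + 1) (u : ℂ)
        have hb : HasDerivAt (fun u : ℂ => Complex.exp (-z * u)) (Complex.exp (-z * u) * (-z * 1)) u :=
          ((hasDerivAt_id (u : ℂ)).const_mul (-z)).cexp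
        convert! ((ha.mul hb).neg.div_const z) using 1
        push_cast
        field_simp
        ring
      exact h1.comp_ofReal
    have hlim : Tendsto (fun u : ℝ => -((u : ℂ) ^ (k + 1) * Complex.exp (-z * u)) / z) atTop (𝓝 0) := by
      have h0 : Tendsto (fun u : ℝ => (u : ℂ) ^ (k + 1) * Complex.exp (-z * u)) atTop (𝓝 0) := by
        rw [tendsto_zero_iff_norm_tendsto_zero]
        have := tendsto_rpow_mul_exp_neg_mul_atTop_nhds_zero (k + 1 : ℕ) z.re hz
        refine this.congr' ?_
        filter_upwards [eventually_ge_atTop 0] with u hu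
        rw [norm_mul, norm_pow, Complex.norm_exp, Complex.norm_real, Real.norm_of_nonneg hu,
          Real.rpow_natCast]
        simp
      simpa using h0.neg.div_const z
    have hInteg := (hI (k + 1)).sub ((hI k).const_mul ((k + 1) / z))
    have := integral_Ioi_of_hasDerivAt_of_tendsto (a := 0) (m := 0)
      (f := fun u : ℝ => -((u : ℂ) ^ (k + 1) * Complex.exp (-z * u)) / z) (by fun_prop) hd hInteg hlim
    rw [integral_sub (hI (k + 1)) ((hI k).const_mul ((k + 1) / z)), integral_const_mul, ih] at this
    simp only [Complex.ofReal_zero, zero_pow (Nat.succ_ne_zero k), zero_mul, neg_zero, zero_div,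
      sub_zero] at this
    rw [sub_eq_zero.1 this, Nat.factorial_succ]
    push_cast
    field_simp
    ring

/-- Model densities. -/
noncomputable def dtD (k : ℕ) (u : ℝ) : ℝ := if 0 < u then u ^ k / k.factorial else 0

lemma dtD_nonneg (k : ℕ) (u : ℝ) : 0 ≤ dtD k u := by
  unfold dtD; split_ifs <;> positivity

lemma dtD_meas (k : ℕ) : Measurable (dtD k) := by
  unfold dtD
  exact Measurable.ite measurableSet_Ioi (by fun_prop) measurable_const

lemma dtD_le (k : ℕ) (u : ℝ) : dtD k u ≤ |u| ^ k := by
  unfold dtD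
  split_ifs with h
  · rw [abs_of_pos h]
    exact div_le_self (by positivity) (by exact_mod_cast Nat.one_le_iff_ne_zero.2 (Nat.factorial_ne_zero k))
  · positivity

open MeasureTheory FourierTransform in
lemma dtD_fourier (k : ℕ) (σ : ℝ) (hσ : 0 < σ) :
    Integrable (fun u : ℝ => ((dtD k u * Real.exp (-σ * u) : ℝ) : ℂ)) ∧
    ∀ ξ : ℝ, 𝓕 (fun u : ℝ => ((dtD k u * Real.exp (-σ * u) : ℝ) : ℂ)) ξ
      = 1 / ((σ : ℂ) + 2 * π * ξ * Complex.I) ^ (k + 1) := by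
  have key : ∀ z : ℂ, (fun u : ℝ => (dtD k u : ℂ) * Complex.exp (-z * u)) =
      (Set.Ioi (0:ℝ)).indicator (fun u => ((k.factorial : ℂ)⁻¹) * ((u : ℂ) ^ k * Complex.exp (-z * u))) := by
    intro z
    ext u
    by_cases hu : u ∈ Set.Ioi (0:ℝ)
    · rw [Set.indicator_of_mem hu]
      have : 0 < u := hu
      simp only [dtD, this, if_true]; push_cast; ring
    · rw [Set.indicator_of_notMem hu]
      have : ¬ 0 < u := hu
      simp [dtD, this]
  constructor
  · have := key σ
    have h2 : (fun u : ℝ => ((dtD k u * Real.exp (-σ * u) : ℝ) : ℂ)) =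
      fun u : ℝ => (dtD k u : ℂ) * Complex.exp (-σ * u) := by ext u; push_cast; rfl
    rw [h2, this, integrable_indicator_iff measurableSet_Ioi]
    exact (dt_laplace_pow k σ (by simpa using hσ)).1.const_mul _
  · intro ξ
    rw [fourier_real_eq_integral_exp_smul]
    set z := (σ : ℂ) + 2 * π * ξ * Complex.I
    have hz : 0 < z.re := by simpa [z] using hσ
    have h2 : (fun u : ℝ => Complex.exp (↑(-2 * π * u * ξ) * Complex.I) • ((dtD k u * Real.exp (-σ * u) : ℝ) : ℂ)) =
      fun u : ℝ => (dtD k u : ℂ) * Complex.exp (-z * u) := by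
      ext u
      push_cast
      rw [smul_eq_mul, mul_left_comm, ← Complex.exp_add]
      congr 2; simp only [z]; ring
    rw [h2, key z, integral_indicator measurableSet_Ioi, integral_const_mul, (dt_laplace_pow k z hz).2]
    have : (k.factorial : ℂ) ≠ 0 := by exact_mod_cast k.factorial_ne_zero
    field_simp

lemma dt_abs_add_le (T y : ℝ) : |T + y| ≤ (1 + |T|) * (1 + |y|) := by
  have := abs_add_le T y
  nlinarith [abs_nonneg T, abs_nonneg y, mul_nonneg (abs_nonneg T) (abs_nonneg y)]

open MeasureTheory in
lemma dtD_kernel_integrable (m : ℕ) (κ : ℝ → ℝ) (hκ0 : ∀ y, 0 ≤ κ y) (hκc : Continuous κ)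
    (hκi : Integrable (fun y => (1 + |y|) ^ m * κ y)) (k : ℕ) (hk : k ≤ m) (T : ℝ) :
    Integrable (fun u => dtD k u * κ (u - T)) := by
  have h : Integrable (fun u => (1 + |T|) ^ m * ((1 + |u - T|) ^ m * κ (u - T))) :=
    (hκi.comp_sub_right T).const_mul _
  have hm := dtD_meas k
  refine h.mono' (by fun_prop) (Eventually.of_forall fun u => ?_)
  rw [Real.norm_of_nonneg (mul_nonneg (dtD_nonneg k u) (hκ0 _)), ← mul_assoc]
  gcongr
  · exact hκ0 _
  calc dtD k u ≤ |u| ^ k := dtD_le k u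
    _ ≤ ((1 + |T|) * (1 + |u - T|)) ^ k := by
        gcongr
        have := dt_abs_add_le T (u - T)
        simpa using this
    _ ≤ ((1 + |T|) * (1 + |u - T|)) ^ m := by
        gcongr
        have h1 := abs_nonneg T
        have h2 := abs_nonneg (u - T)
        nlinarith
    _ = _ := mul_pow _ _ _

open MeasureTheory FourierTransform in
lemma dt_identity_sigma (M : ℝ → ℝ)
    (hInteg : ∀ σ : ℝ, 0 < σ → Integrable (fun u => ((M u * Real.exp (-σ * u) : ℝ) : ℂ)))
    (m : ℕ) (d : ℕ → ℂ) (g : ℂ → ℂ) (hg : ContinuousOn g {s | 0 ≤ s.re})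
    (hrep : ∀ s : ℂ, 0 < s.re → ∫ u : ℝ, (M u : ℂ) * Complex.exp (-s * u)
      = ∑ k ∈ Finset.range (m + 1), d k / s ^ (k + 1) + g s)
    (φ : ℝ → ℂ) (κ : ℝ → ℝ) (hφ : Continuous φ) (hφs : HasCompactSupport φ)
    (hφκ : ∀ y, 𝓕 φ y = (κ y : ℂ)) (T σ : ℝ) (hσ : 0 < σ) :
    ((∫ u, M u * Real.exp (-σ * u) * κ (u - T) : ℝ) : ℂ) =
      ∑ k ∈ Finset.range (m + 1), d k * ((∫ u, dtD k u * Real.exp (-σ * u) * κ (u - T) : ℝ) : ℂ)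
      + ∫ ξ : ℝ, g (σ + 2 * π * ξ * Complex.I) * (Complex.exp (↑(2 * π * T * ξ) * Complex.I) * φ ξ) := by
  have flip : ∀ W : ℝ → ℝ, Integrable (fun u => ((W u * Real.exp (-σ * u) : ℝ) : ℂ)) →
      ((∫ u, W u * Real.exp (-σ * u) * κ (u - T) : ℝ) : ℂ) =
      ∫ ξ, 𝓕 (fun u => ((W u * Real.exp (-σ * u) : ℝ) : ℂ)) ξ *
        (Complex.exp (↑(2 * π * T * ξ) * Complex.I) * φ ξ) := by
    intro W hW
    rw [dt_flip _ φ hW hφ hφs T, ← integral_complex_ofReal]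
    congr 1; ext u
    rw [hφκ]; push_cast; rfl
  have hMf : ∀ ξ : ℝ, 𝓕 (fun u => ((M u * Real.exp (-σ * u) : ℝ) : ℂ)) ξ
      = ∑ k ∈ Finset.range (m + 1), d k * (1 / ((σ : ℂ) + 2 * π * ξ * Complex.I) ^ (k + 1))
        + g (σ + 2 * π * ξ * Complex.I) := by
    intro ξ
    have := hrep (σ + 2 * π * ξ * Complex.I) (by simpa using hσ)
    simp only [mul_one_div]
    rw [← this, fourier_real_eq_integral_exp_smul]
    congr 1; ext u
    push_cast
    rw [smul_eq_mul, mul_left_comm, ← Complex.exp_add]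
    congr 2; ring
  have hne : ∀ ξ : ℝ, (σ : ℂ) + 2 * π * ξ * Complex.I ≠ 0 := by
    intro ξ h
    have := congrArg Complex.re h
    simp at this
    exact hσ.ne' this
  have hgc : Continuous fun ξ : ℝ => g (σ + 2 * π * ξ * Complex.I) := by
    refine hg.comp_continuous (by fun_prop) (fun ξ => ?_)
    simpa using hσ.le
  have hInteg1 : ∀ k, Integrable fun ξ : ℝ => d k * (1 / ((σ : ℂ) + 2 * π * ξ * Complex.I) ^ (k + 1)) *
      (Complex.exp (↑(2 * π * T * ξ) * Complex.I) * φ ξ) := by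
    intro k
    refine Continuous.integrable_of_hasCompactSupport ?_ hφs.mul_left.mul_left
    have : Continuous fun ξ : ℝ => 1 / ((σ : ℂ) + 2 * π * ξ * Complex.I) ^ (k + 1) :=
      Continuous.div (by fun_prop) (by fun_prop) (fun ξ => pow_ne_zero _ (hne ξ))
    fun_prop
  have hInteg2 : Integrable fun ξ : ℝ => g (σ + 2 * π * ξ * Complex.I) *
      (Complex.exp (↑(2 * π * T * ξ) * Complex.I) * φ ξ) := by
    exact Continuous.integrable_of_hasCompactSupport (hgc.mul (by fun_prop)) hφs.mul_left.mul_left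
  rw [flip M (hInteg σ hσ)]
  simp only [hMf, add_mul, Finset.sum_mul]
  rw [integral_add (integrable_finsetSum _ fun k _ => hInteg1 k) hInteg2,
    integral_finsetSum _ fun k _ => hInteg1 k]
  congr 1
  refine Finset.sum_congr rfl fun k _ => ?_
  rw [flip (dtD k) (dtD_fourier k σ hσ).1, ← integral_const_mul]
  congr 1; ext ξ
  rw [(dtD_fourier k σ hσ).2, mul_assoc]

open MeasureTheory FourierTransform in
lemma dt_identity (M : ℝ → ℝ) (hM0 : ∀ u, 0 ≤ M u)
    (u0 : ℝ) (hu0 : ∀ u < u0, M u = 0)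
    (hInteg : ∀ σ : ℝ, 0 < σ → Integrable (fun u => ((M u * Real.exp (-σ * u) : ℝ) : ℂ)))
    (m : ℕ) (d : ℕ → ℂ) (g : ℂ → ℂ) (hg : ContinuousOn g {s | 0 ≤ s.re})
    (hrep : ∀ s : ℂ, 0 < s.re → ∫ u : ℝ, (M u : ℂ) * Complex.exp (-s * u)
      = ∑ k ∈ Finset.range (m + 1), d k / s ^ (k + 1) + g s)
    (φ : ℝ → ℂ) (κ : ℝ → ℝ) (hφ : Continuous φ) (hφs : HasCompactSupport φ)
    (hφκ : ∀ y, 𝓕 φ y = (κ y : ℂ)) (hκ0 : ∀ y, 0 ≤ κ y) (hκc : Continuous κ)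
    (hκi : Integrable (fun y => (1 + |y|) ^ m * κ y)) (T : ℝ) :
    Integrable (fun u => M u * κ (u - T)) ∧
    ((∫ u, M u * κ (u - T) : ℝ) : ℂ) =
      ∑ k ∈ Finset.range (m + 1), d k * ((∫ u, dtD k u * κ (u - T) : ℝ) : ℂ)
      + ∫ ξ : ℝ, g (2 * π * ξ * Complex.I) * (Complex.exp (↑(2 * π * T * ξ) * Complex.I) * φ ξ) := by
  set σ : ℕ → ℝ := fun n => 1 / ((n : ℝ) + 1) with hσdef
  have hσ0 : ∀ n, 0 < σ n := fun n => by positivity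
  have hσ1 : ∀ n, σ n ≤ 1 := fun n => by
    rw [hσdef]; simp only
    rw [div_le_one (by positivity)]
    have : (0:ℝ) ≤ n := by positivity
    linarith
  have hσt : Tendsto σ atTop (𝓝 0) := tendsto_one_div_add_atTop_nhds_zero_nat
  have hexp : ∀ u : ℝ, Tendsto (fun n => Real.exp (-σ n * u)) atTop (𝓝 1) := by
    intro u
    have : Tendsto (fun n => Real.exp (-σ n * u)) atTop (𝓝 (Real.exp (-0 * u))) :=
      (Real.continuous_exp.tendsto _).comp ((hσt.neg).mul_const u)
    simpa using this
  -- the model terms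
  have hD : ∀ k ∈ Finset.range (m + 1), Tendsto
      (fun n => d k * ((∫ u, dtD k u * Real.exp (-σ n * u) * κ (u - T) : ℝ) : ℂ)) atTop
      (𝓝 (d k * ((∫ u, dtD k u * κ (u - T) : ℝ) : ℂ))) := by
    intro k hk
    have hk' : k ≤ m := Nat.lt_succ_iff.1 (Finset.mem_range.1 hk)
    refine Tendsto.const_mul _ ((Complex.continuous_ofReal.tendsto _).comp ?_)
    have hm := dtD_meas k
    refine tendsto_integral_of_dominated_convergence (fun u => dtD k u * κ (u - T))
      (fun n => by fun_prop) (dtD_kernel_integrable m κ hκ0 hκc hκi k hk' T)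
      (fun n => Eventually.of_forall fun u => ?_) (Eventually.of_forall fun u => ?_)
    · rw [Real.norm_of_nonneg (mul_nonneg (mul_nonneg (dtD_nonneg k u) (Real.exp_nonneg _)) (hκ0 _))]
      refine mul_le_mul_of_nonneg_right ?_ (hκ0 _)
      by_cases h : 0 < u
      · refine mul_le_of_le_one_right (dtD_nonneg k u) (Real.exp_le_one_iff.2 ?_)
        nlinarith [hσ0 n]
      · simp [dtD, h]
    · simpa using ((hexp u).const_mul (dtD k u)).mul_const (κ (u - T))
  -- the holomorphic term
  have hG : Tendsto (fun n => ∫ ξ : ℝ, g (σ n + 2 * π * ξ * Complex.I) *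
      (Complex.exp (↑(2 * π * T * ξ) * Complex.I) * φ ξ)) atTop
      (𝓝 (∫ ξ : ℝ, g (2 * π * ξ * Complex.I) * (Complex.exp (↑(2 * π * T * ξ) * Complex.I) * φ ξ))) := by
    have hgc : ContinuousOn (fun p : ℝ × ℝ => g (p.1 + 2 * π * p.2 * Complex.I))
        (Set.Icc (0:ℝ) 1 ×ˢ tsupport φ) := by
      refine hg.comp (by fun_prop) ?_
      rintro ⟨x, y⟩ ⟨hx, _⟩
      simpa using hx.1
    obtain ⟨C, hC⟩ := (isCompact_Icc.prod hφs).exists_bound_of_continuousOn hgc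
    have hφi : Integrable φ := hφ.integrable_of_hasCompactSupport hφs
    refine tendsto_integral_of_dominated_convergence (fun ξ => C * ‖φ ξ‖)
      (fun n => ?_) (hφi.norm.const_mul C)
      (fun n => Eventually.of_forall fun ξ => ?_) (Eventually.of_forall fun ξ => ?_)
    · have : Continuous fun ξ : ℝ => g (σ n + 2 * π * ξ * Complex.I) := by
        refine hg.comp_continuous (by fun_prop) (fun ξ => ?_)
        simpa using (hσ0 n).le
      exact Continuous.aestronglyMeasurable (this.mul (by fun_prop))
    · rw [norm_mul, norm_mul, Complex.norm_exp_ofReal_mul_I, one_mul]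
      by_cases h : φ ξ = 0
      · simp [h]
      · refine mul_le_mul_of_nonneg_right ?_ (norm_nonneg _)
        exact hC (σ n, ξ) ⟨⟨(hσ0 n).le, hσ1 n⟩, subset_tsupport _ h⟩
    · refine Tendsto.mul_const _ ?_
      have h1 : Tendsto (fun n => (σ n : ℂ) + 2 * π * ξ * Complex.I) atTop
          (𝓝[{s | 0 ≤ s.re}] (2 * π * ξ * Complex.I)) := by
        refine tendsto_nhdsWithin_iff.2 ⟨?_, Eventually.of_forall fun n => ?_⟩
        · have := ((Complex.continuous_ofReal.tendsto _).comp hσt).add_const (2 * π * ξ * Complex.I)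
          simpa using this
        · simpa using (hσ0 n).le
      exact (hg (2 * π * ξ * Complex.I) (by simp)).tendsto.comp h1
  have hlim := (tendsto_finsetSum _ hD).add hG
  have hid := fun n => dt_identity_sigma M hInteg m d g hg hrep φ κ hφ hφs hφκ T (σ n) (hσ0 n)
  simp only [← hid] at hlim
  have hFint : ∀ n, Integrable fun u => M u * Real.exp (-σ n * u) * κ (u - T) := by
    intro n
    have h1 := (hInteg (σ n) (hσ0 n)).re
    obtain ⟨C, hC⟩ : ∃ C, ∀ y, ‖κ y‖ ≤ C := by
      refine ⟨∫ v, ‖φ v‖, fun y => ?_⟩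
      have h2 : ‖(κ y : ℂ)‖ = ‖κ y‖ := Complex.norm_real _
      rw [← h2, ← hφκ, fourier_real_eq_integral_exp_smul]
      refine (norm_integral_le_integral_norm _).trans (le_of_eq ?_)
      congr 1; ext v
      rw [norm_smul, Complex.norm_exp_ofReal_mul_I, one_mul]
    exact Integrable.mul_bdd (c := C) (by simpa only [RCLike.re_to_complex, Complex.ofReal_re] using h1) (by fun_prop)
      (Eventually.of_forall fun u => hC _)
  have hFnn : ∀ n u, 0 ≤ M u * Real.exp (-σ n * u) * κ (u - T) := fun n u =>
    mul_nonneg (mul_nonneg (hM0 u) (Real.exp_nonneg _)) (hκ0 _)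
  have hpt : ∀ u, Tendsto (fun n => M u * Real.exp (-σ n * u) * κ (u - T)) atTop (𝓝 (M u * κ (u - T))) := by
    intro u
    simpa using ((hexp u).const_mul (M u)).mul_const (κ (u - T))
  have hMκ : Integrable (fun u => M u * κ (u - T)) := by
    refine integrable_of_tendsto (Eventually.of_forall hpt) (fun n => (hFint n).1) ?_
    obtain ⟨C, hC⟩ : ∃ C, ∀ n, ‖((∫ u, M u * Real.exp (-σ n * u) * κ (u - T) : ℝ) : ℂ)‖ ≤ C := by
      obtain ⟨C, hC⟩ := (Metric.isBounded_range_of_tendsto _ hlim).exists_norm_le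
      exact ⟨C, fun n => hC _ ⟨n, rfl⟩⟩
    have : ∀ n, ∫⁻ u, ‖M u * Real.exp (-σ n * u) * κ (u - T)‖ₑ ≤ ENNReal.ofReal C := by
      intro n
      rw [← ofReal_integral_norm_eq_lintegral_enorm (hFint n)]
      refine ENNReal.ofReal_le_ofReal (le_trans (le_of_eq ?_) (hC n))
      rw [Complex.norm_real, Real.norm_of_nonneg (integral_nonneg (hFnn n))]
      congr 1; ext u
      exact Real.norm_of_nonneg (hFnn n u)
    refine ne_top_of_le_ne_top ENNReal.ofReal_ne_top (b := ENNReal.ofReal C) ?_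
    exact liminf_le_of_le (by isBoundedDefault) (fun b hb => by
      obtain ⟨n, hn⟩ := hb.exists
      exact hn.trans (this n))
  refine ⟨hMκ, ?_⟩
  refine tendsto_nhds_unique ?_ hlim
  refine (Complex.continuous_ofReal.tendsto _).comp ?_
  refine tendsto_integral_of_dominated_convergence (fun u => Real.exp |u0| * (M u * κ (u - T)))
      (fun n => (hFint n).1) (hMκ.const_mul _)
      (fun n => Eventually.of_forall fun u => ?_) (Eventually.of_forall hpt)
  rw [Real.norm_of_nonneg (hFnn n u)]
  by_cases h : u < u0
  · simp [hu0 u h]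
  · have : Real.exp (-σ n * u) ≤ Real.exp |u0| := by
      refine Real.exp_le_exp.2 ?_
      push Not at h
      have h1 : -u0 ≤ |u0| := neg_le_abs u0
      have h2 := abs_nonneg u0
      have := hσ0 n
      have := hσ1 n
      nlinarith
    have h3 := mul_nonneg (hM0 u) (hκ0 (u - T))
    calc _ = Real.exp (-σ n * u) * (M u * κ (u - T)) := by ring
      _ ≤ _ := by gcongr

open MeasureTheory FourierTransform in
lemma dt_limit (M : ℝ → ℝ) (hM0 : ∀ u, 0 ≤ M u)
    (u0 : ℝ) (hu0 : ∀ u < u0, M u = 0)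
    (hInteg : ∀ σ : ℝ, 0 < σ → Integrable (fun u => ((M u * Real.exp (-σ * u) : ℝ) : ℂ)))
    (m : ℕ) (d : ℕ → ℂ) (c : ℝ) (hdc : d m = c) (g : ℂ → ℂ) (hg : ContinuousOn g {s | 0 ≤ s.re})
    (hrep : ∀ s : ℂ, 0 < s.re → ∫ u : ℝ, (M u : ℂ) * Complex.exp (-s * u)
      = ∑ k ∈ Finset.range (m + 1), d k / s ^ (k + 1) + g s)
    (φ : ℝ → ℂ) (κ : ℝ → ℝ) (hφ : Continuous φ) (hφs : HasCompactSupport φ)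
    (hφκ : ∀ y, 𝓕 φ y = (κ y : ℂ)) (hκ0 : ∀ y, 0 ≤ κ y) (hκc : Continuous κ)
    (hκi : Integrable (fun y => (1 + |y|) ^ m * κ y)) (hκ1 : ∫ y, κ y = 1) :
    (∀ T, Integrable (fun y => M (T + y) * κ y)) ∧
    Tendsto (fun T => (∫ y, M (T + y) * κ y) / T ^ m) atTop (𝓝 (c / m.factorial)) := by
  have hshift : ∀ (W : ℝ → ℝ) (T : ℝ), ∫ u, W u * κ (u - T) = ∫ y, W (T + y) * κ y := by
    intro W T
    rw [← integral_add_right_eq_self _ T]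
    congr 1; ext y; simp [add_comm]
  have hid := fun T => dt_identity M hM0 u0 hu0 hInteg m d g hg hrep φ κ hφ hφs hφκ hκ0 hκc hκi T
  refine ⟨fun T => ?_, ?_⟩
  · have := (hid T).1.comp_add_right T
    refine this.congr (Eventually.of_forall fun y => by simp [add_comm])
  have hR : Tendsto (fun T : ℝ => ∫ ξ : ℝ, g (2 * π * ξ * Complex.I) *
      (Complex.exp (↑(2 * π * T * ξ) * Complex.I) * φ ξ)) atTop (𝓝 0) := by
    have h := Real.tendsto_integral_exp_smul_cocompact (fun ξ : ℝ => g (2 * π * ξ * Complex.I) * φ ξ)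
    have h2 : Tendsto (fun T : ℝ => -T) atTop (cocompact ℝ) :=
      tendsto_neg_atTop_atBot.mono_right atBot_le_cocompact
    refine (h.comp h2).congr fun T => ?_
    simp only [Function.comp]
    congr 1; ext ξ
    rw [Circle.smul_def, Real.fourierChar_apply, smul_eq_mul]
    rw [show 2 * π * -(ξ * -T) = 2 * π * T * ξ by ring]
    ring
  have hinv : Tendsto (fun T : ℝ => 1 / T) atTop (𝓝 0) := by
    simpa using tendsto_inv_atTop_zero (𝕜 := ℝ)
  have hpt : ∀ k ≤ m, ∀ y : ℝ, Tendsto (fun T : ℝ => dtD k (T + y) / T ^ m) atTop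
      (𝓝 (if k = m then 1 / (m.factorial : ℝ) else 0)) := by
    intro k hk y
    have h1 : Tendsto (fun T : ℝ => (1 + y * (1 / T)) ^ k / k.factorial * (1 / T) ^ (m - k)) atTop
        (𝓝 ((1 + y * 0) ^ k / k.factorial * 0 ^ (m - k))) :=
      ((((hinv.const_mul y).const_add 1).pow k).div_const _).mul (hinv.pow _)
    have h2 : (1 + y * 0) ^ k / (k.factorial : ℝ) * 0 ^ (m - k) =
        (if k = m then 1 / (m.factorial : ℝ) else 0) := by
      split_ifs with h
      · subst h; simp
      · rw [zero_pow (by omega), mul_zero]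
    rw [h2] at h1
    refine h1.congr' ?_
    filter_upwards [eventually_gt_atTop 0, eventually_gt_atTop (-y)] with T hT hTy
    have : 0 < T + y := by linarith
    simp only [dtD, this, if_true]
    have e : T ^ m = T ^ k * T ^ (m - k) := by rw [← pow_add]; congr 1; omega
    rw [e]
    have e2 : 1 + y * (1 / T) = (T + y) / T := by field_simp
    rw [e2, div_pow, one_div, inv_pow]
    field_simp
  have hDlim : ∀ k ∈ Finset.range (m + 1), Tendsto
      (fun T : ℝ => d k * ((((∫ y, dtD k (T + y) * κ y) / T ^ m : ℝ)) : ℂ)) atTop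
      (𝓝 (d k * (((if k = m then 1 / (m.factorial : ℝ) else 0 : ℝ)) : ℂ))) := by
    intro k hk
    have hk' : k ≤ m := Nat.lt_succ_iff.1 (Finset.mem_range.1 hk)
    refine Tendsto.const_mul _ ((Complex.continuous_ofReal.tendsto _).comp ?_)
    have h := tendsto_integral_filter_of_dominated_convergence (l := atTop) (μ := volume)
      (F := fun (T y : ℝ) => dtD k (T + y) / T ^ m * κ y)
      (f := fun y => (if k = m then 1 / (m.factorial : ℝ) else 0) * κ y)
      (fun y => (1 + |y|) ^ m * κ y)
      (Eventually.of_forall fun T => 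
        ((((dtD_meas k).comp (measurable_const_add T)).div_const _).mul
          hκc.measurable).aestronglyMeasurable) ?_ hκi (Eventually.of_forall fun y => (hpt k hk' y).mul_const _)
    · rw [integral_const_mul, hκ1, mul_one] at h
      refine h.congr fun T => ?_
      rw [← integral_div]
      congr 1; ext y; ring
    · filter_upwards [eventually_ge_atTop 1] with T hT
      refine Eventually.of_forall fun y => ?_
      have hT0 : 0 < T := by linarith
      rw [Real.norm_of_nonneg (mul_nonneg (div_nonneg (dtD_nonneg _ _) (by positivity)) (hκ0 y))]
      refine mul_le_mul_of_nonneg_right ?_ (hκ0 y)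
      rw [div_le_iff₀ (by positivity)]
      calc dtD k (T + y) ≤ |T + y| ^ k := dtD_le _ _
        _ ≤ ((1 + |y|) * T) ^ k := by
            gcongr
            refine (abs_add_le T y).trans ?_
            rw [abs_of_pos hT0]
            nlinarith [abs_nonneg y]
        _ ≤ ((1 + |y|) * T) ^ m := by
            gcongr
            nlinarith [abs_nonneg y]
        _ = _ := mul_pow _ _ _
  have hsum := tendsto_finsetSum _ hDlim
  have hRm : Tendsto (fun T : ℝ => (∫ ξ : ℝ, g (2 * π * ξ * Complex.I) *
      (Complex.exp (↑(2 * π * T * ξ) * Complex.I) * φ ξ)) * (((1 / T) ^ m : ℝ) : ℂ)) atTop (𝓝 0) := by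
    have h := hR.mul ((Complex.continuous_ofReal.tendsto _).comp (hinv.pow m))
    simpa using h
  have htot := hsum.add hRm
  have hval : ∑ k ∈ Finset.range (m + 1), d k * (((if k = m then 1 / (m.factorial : ℝ) else 0 : ℝ)) : ℂ) + 0
      = ((c / m.factorial : ℝ) : ℂ) := by
    rw [Finset.sum_eq_single m]
    · simp [hdc, div_eq_mul_inv]
    · intro k _ hk; simp [hk]
    · intro h; simp at h
  rw [hval] at htot
  have hre := (Complex.continuous_re.tendsto _).comp htot
  rw [Complex.ofReal_re] at hre
  refine hre.congr fun T => ?_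
  simp only [Function.comp]
  have h := (hid T).2
  rw [hshift M T] at h
  simp only [hshift] at h
  have : ((∑ k ∈ Finset.range (m + 1), d k * ((((∫ y, dtD k (T + y) * κ y) / T ^ m : ℝ)) : ℂ)
      + (∫ ξ : ℝ, g (2 * π * ξ * Complex.I) *
      (Complex.exp (↑(2 * π * T * ξ) * Complex.I) * φ ξ)) * (((1 / T) ^ m : ℝ) : ℂ)))
      = (((∫ y, M (T + y) * κ y) / T ^ m : ℝ) : ℂ) := by
    have e : (((∫ y, M (T + y) * κ y) / T ^ m : ℝ) : ℂ)
        = ((∫ y, M (T + y) * κ y : ℝ) : ℂ) * (((1 / T) ^ m : ℝ) : ℂ) := by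
      rw [one_div, inv_pow, ← Complex.ofReal_mul, div_eq_mul_inv]
    rw [e, h, add_mul, Finset.sum_mul]
    congr 1
    refine Finset.sum_congr rfl fun k _ => ?_
    rw [mul_assoc, ← Complex.ofReal_mul, one_div, inv_pow, div_eq_mul_inv]
  rw [this, Complex.ofReal_re]

open MeasureTheory in
lemma dt_sandwich (M : ℝ → ℝ) (hM0 : ∀ u, 0 ≤ M u) (u0 : ℝ) (hu0 : ∀ u < u0, M u = 0)
    (a : ℝ) (ha : 0 < a) (hmono : ∀ u v, u ≤ v → Real.exp (a * u) * M u ≤ Real.exp (a * v) * M v)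
    (m : ℕ) (c : ℝ)
    (hker : ∀ δ η : ℝ, 0 < δ → 0 < η → ∃ κ : ℝ → ℝ, (∀ y, 0 ≤ κ y) ∧
      Integrable (fun y => (1 + |y|) ^ m * κ y) ∧ Integrable κ ∧ ∫ y, κ y = 1 ∧
      ∫ y in {y | δ < |y|}, (1 + |y|) ^ m * κ y ≤ η ∧
      (∀ T, Integrable (fun y => M (T + y) * κ y)) ∧
      Tendsto (fun T => (∫ y, M (T + y) * κ y) / T ^ m) atTop (𝓝 c)) :
    Tendsto (fun T => M T / T ^ m) atTop (𝓝 c) := by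
  have hmono' : ∀ u v, u ≤ v → M u ≤ Real.exp (a * (v - u)) * M v := by
    intro u v h
    have := hmono u v h
    have e : Real.exp (a * v) = Real.exp (a * u) * Real.exp (a * (v - u)) := by
      rw [← Real.exp_add]; congr 1; ring
    rw [e, mul_assoc] at this
    exact le_of_mul_le_mul_left this (Real.exp_pos _)
  have hms : ∀ δ : ℝ, MeasurableSet {y : ℝ | δ < |y|} := fun δ =>
    measurableSet_lt (by fun_prop) (by fun_prop)
  have hratio : ∀ δ : ℝ, Tendsto (fun T : ℝ => ((T + δ) / T) ^ m) atTop (𝓝 1) := by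
    intro δ
    have h : Tendsto (fun T : ℝ => (1 + δ * T⁻¹) ^ m) atTop (𝓝 ((1 + δ * 0) ^ m)) :=
      ((tendsto_inv_atTop_zero.const_mul δ).const_add 1).pow m
    simp only [mul_zero, add_zero, one_pow] at h
    refine h.congr' ?_
    filter_upwards [eventually_gt_atTop 0] with T hT
    congr 1; field_simp
  -- shifted limit
  have hshift : ∀ (J : ℝ → ℝ) (δ : ℝ), Tendsto (fun T => J T / T ^ m) atTop (𝓝 c) →
      Tendsto (fun T => J (T + δ) / T ^ m) atTop (𝓝 c) := by
    intro J δ hJ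
    have h1 := (hJ.comp (tendsto_atTop_add_const_right atTop δ tendsto_id)).mul (hratio δ)
    rw [mul_one] at h1
    refine h1.congr' ?_
    filter_upwards [eventually_gt_atTop 0, eventually_gt_atTop (-δ)] with T hT hT2
    have : 0 < T + δ := by linarith
    simp only [Function.comp, id]
    rw [div_pow]
    field_simp
  -- upper bound
  have hup : ∀ t : ℝ, 0 < t → t < 1 → ∀ c2, c * Real.exp (2 * a * t) / (1 - t) < c2 →
      ∀ᶠ T in atTop, M T / T ^ m < c2 := by
    intro t ht ht1 c2 hc2
    obtain ⟨κ, hκ0, hκm, hκi, hκ1, htail, hMi, hl⟩ := hker t t ht ht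
    have hl2 := ((hshift (fun T => ∫ y, M (T + y) * κ y) t hl).mul_const
      (Real.exp (2 * a * t))).div_const (1 - t)
    filter_upwards [hl2.eventually_lt_const hc2, eventually_gt_atTop 0] with T hT hT0
    refine lt_of_le_of_lt ?_ hT
    have hpt : ∀ y, Real.exp (-(2 * a * t)) * M T *
        (κ y - {y | t < |y|}.indicator (fun y => (1 + |y|) ^ m * κ y) y) ≤ M (T + t + y) * κ y := by
      intro y
      by_cases hy : t < |y|
      · rw [Set.indicator_of_mem (by exact hy)]
        have h1 : κ y ≤ (1 + |y|) ^ m * κ y :=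
          le_mul_of_one_le_left (hκ0 y) (one_le_pow₀ (by linarith [abs_nonneg y]))
        have h2 : 0 ≤ Real.exp (-(2 * a * t)) * M T := mul_nonneg (Real.exp_nonneg _) (hM0 T)
        have h3 := mul_nonneg (hM0 (T + t + y)) (hκ0 y)
        nlinarith
      · rw [Set.indicator_of_notMem (by exact hy), sub_zero]
        refine mul_le_mul_of_nonneg_right ?_ (hκ0 y)
        push Not at hy
        obtain ⟨h1, h2⟩ := abs_le.1 hy
        have h3 := hmono' T (T + t + y) (by linarith)
        calc Real.exp (-(2 * a * t)) * M T
            ≤ Real.exp (-(2 * a * t)) * (Real.exp (a * (T + t + y - T)) * M (T + t + y)) := by gcongr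
          _ = Real.exp (-(2 * a * t) + a * (T + t + y - T)) * M (T + t + y) := by
              rw [Real.exp_add]; ring
          _ ≤ 1 * M (T + t + y) := by
              refine mul_le_mul_of_nonneg_right (Real.exp_le_one_iff.2 ?_) (hM0 _)
              nlinarith
          _ = _ := one_mul _
    have hI := integral_mono ((hκi.sub (hκm.indicator (hms t))).const_mul
      (Real.exp (-(2 * a * t)) * M T)) (hMi (T + t)) hpt
    simp only [Pi.sub_apply] at hI
    rw [integral_const_mul, integral_sub hκi (hκm.indicator (hms t)), integral_indicator (hms t), hκ1] at hI
    have h4 : Real.exp (-(2 * a * t)) * M T * (1 - t) ≤ ∫ y, M (T + t + y) * κ y := by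
      refine le_trans ?_ hI
      have h2 : 0 ≤ Real.exp (-(2 * a * t)) * M T := mul_nonneg (Real.exp_nonneg _) (hM0 T)
      gcongr
    have h1t : 0 < 1 - t := by linarith
    rw [le_div_iff₀ h1t, div_mul_eq_mul_div, div_mul_eq_mul_div]
    refine div_le_div_of_nonneg_right ?_ (by positivity)
    calc M T * (1 - t) = Real.exp (-(2 * a * t)) * M T * (1 - t) * Real.exp (2 * a * t) := by
          rw [Real.exp_neg]; field_simp
      _ ≤ _ := by gcongr
  -- a global polynomial bound
  obtain ⟨C, hC0, hC⟩ : ∃ C, 0 ≤ C ∧ ∀ u, M u ≤ C * (1 + |u|) ^ m := by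
    have h := hup (1 / 2) (by norm_num) (by norm_num) _ (lt_add_one _)
    set c2 := c * Real.exp (2 * a * (1 / 2)) / (1 - 1 / 2) + 1
    obtain ⟨U, hU⟩ := eventually_atTop.1 h
    set V := max U 1
    have hV : 0 < V := lt_max_of_lt_right one_pos
    set C1 := Real.exp (a * (V - u0)) * M V with hC1
    have hC1n : 0 ≤ C1 := mul_nonneg (Real.exp_nonneg _) (hM0 _)
    refine ⟨max c2 C1, le_max_of_le_right hC1n, fun u => ?_⟩
    have h1 : 1 ≤ (1 + |u|) ^ m := one_le_pow₀ (by linarith [abs_nonneg u])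
    have hmx : 0 ≤ max c2 C1 := le_max_of_le_right hC1n
    rcases lt_or_ge u u0 with h | h
    · rw [hu0 u h]; positivity
    rcases le_total u V with h' | h'
    · calc M u ≤ Real.exp (a * (V - u)) * M V := hmono' u V h'
        _ ≤ C1 := by
            rw [hC1]
            have := hM0 V
            gcongr
        _ ≤ max c2 C1 := le_max_right _ _
        _ ≤ _ := le_mul_of_one_le_right hmx h1
    · have hu : 0 < u := by linarith
      have := hU u ((le_max_left _ _).trans h')
      rw [div_lt_iff₀ (by positivity)] at this
      calc M u ≤ c2 * u ^ m := this.le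
        _ ≤ max c2 C1 * u ^ m := by gcongr; exact le_max_left _ _
        _ ≤ _ := by
            gcongr
            rw [abs_of_pos hu]; linarith
  -- lower bound
  have hlow : ∀ t : ℝ, 0 < t → t < 1 → ∀ c1, c1 < Real.exp (-(2 * a * t)) * (c - C * 2 ^ m * t) →
      ∀ᶠ T in atTop, c1 < M T / T ^ m := by
    intro t ht ht1 c1 hc1
    obtain ⟨κ, hκ0, hκm, hκi, hκ1, htail, hMi, hl⟩ := hker t t ht ht
    have hl2 := ((hshift (fun T => ∫ y, M (T + y) * κ y) (-t) hl).sub_const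
      (C * 2 ^ m * t)).const_mul (Real.exp (-(2 * a * t)))
    filter_upwards [hl2.eventually_const_lt hc1, eventually_ge_atTop 1] with T hT hT1
    refine lt_of_lt_of_le hT ?_
    have hT0 : 0 < T := by linarith
    have hpt : ∀ y, M (T + -t + y) * κ y ≤ Real.exp (2 * a * t) * M T * κ y +
        (C * 2 ^ m * T ^ m) * {y | t < |y|}.indicator (fun y => (1 + |y|) ^ m * κ y) y := by
      intro y
      by_cases hy : t < |y|
      · rw [Set.indicator_of_mem (by exact hy)]
        have h3 : 0 ≤ Real.exp (2 * a * t) * M T * κ y :=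
          mul_nonneg (mul_nonneg (Real.exp_nonneg _) (hM0 T)) (hκ0 y)
        have h4 : M (T + -t + y) ≤ (C * 2 ^ m * T ^ m) * (1 + |y|) ^ m := by
          refine (hC _).trans ?_
          rw [mul_assoc C, ← mul_pow, mul_assoc C, ← mul_pow]
          gcongr
          have h5 : |T + -t + y| ≤ T + |y| := by
            refine (abs_add_le _ _).trans ?_
            rw [abs_of_nonneg (by linarith : 0 ≤ T + -t)]
            linarith
          nlinarith [abs_nonneg y]
        calc _ ≤ (C * 2 ^ m * T ^ m) * (1 + |y|) ^ m * κ y := mul_le_mul_of_nonneg_right h4 (hκ0 y)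
          _ ≤ _ := by rw [mul_assoc]; linarith
      · rw [Set.indicator_of_notMem (by exact hy), mul_zero, add_zero]
        refine mul_le_mul_of_nonneg_right ?_ (hκ0 y)
        push Not at hy
        obtain ⟨h1, h2⟩ := abs_le.1 hy
        refine (hmono' (T + -t + y) T (by linarith)).trans ?_
        exact mul_le_mul_of_nonneg_right (Real.exp_le_exp.2 (by nlinarith)) (hM0 T)
    have hI := integral_mono (hMi (T + -t)) ((hκi.const_mul (Real.exp (2 * a * t) * M T)).add
      ((hκm.indicator (hms t)).const_mul (C * 2 ^ m * T ^ m))) hpt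
    simp only [Pi.add_apply] at hI
    rw [integral_add (hκi.const_mul _) ((hκm.indicator (hms t)).const_mul _), integral_const_mul,
      integral_const_mul, integral_indicator (hms t), hκ1, mul_one] at hI
    have h4 : ∫ y, M (T + -t + y) * κ y ≤ Real.exp (2 * a * t) * M T + C * 2 ^ m * T ^ m * t := by
      refine hI.trans ?_
      gcongr
    rw [Real.exp_neg, inv_mul_le_iff₀ (Real.exp_pos _), sub_le_iff_le_add, div_le_iff₀ (by positivity)]
    refine h4.trans (le_of_eq ?_)
    field_simp
  rw [tendsto_order]
  constructor
  · intro c1 hc1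
    have hcont : Tendsto (fun t : ℝ => Real.exp (-(2 * a * t)) * (c - C * 2 ^ m * t)) (𝓝[>] 0) (𝓝 c) := by
      have : Continuous fun t : ℝ => Real.exp (-(2 * a * t)) * (c - C * 2 ^ m * t) := by fun_prop
      have h := this.tendsto 0
      simp only [mul_zero, neg_zero, Real.exp_zero, sub_zero, one_mul] at h
      exact h.mono_left nhdsWithin_le_nhds
    obtain ⟨t, h1, h2, h3⟩ := ((hcont.eventually_const_lt hc1).and
      ((eventually_mem_nhdsWithin).and (eventually_nhdsWithin_of_eventually_nhds
        (eventually_lt_nhds (zero_lt_one (α := ℝ)))))).exists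
    exact hlow t h2 h3 c1 h1
  · intro c2 hc2
    have hcont : Tendsto (fun t : ℝ => c * Real.exp (2 * a * t) / (1 - t)) (𝓝[>] 0) (𝓝 c) := by
      have : ContinuousAt (fun t : ℝ => c * Real.exp (2 * a * t) / (1 - t)) 0 :=
        ContinuousAt.div (by fun_prop) (by fun_prop) (by norm_num)
      have h := this.tendsto
      simp only [mul_zero, Real.exp_zero, sub_zero, mul_one, div_one] at h
      exact h.mono_left nhdsWithin_le_nhds
    obtain ⟨t, h1, h2, h3⟩ := ((hcont.eventually_lt_const hc2).and
      ((eventually_mem_nhdsWithin).and (eventually_nhdsWithin_of_eventually_nhds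
        (eventually_lt_nhds (zero_lt_one (α := ℝ)))))).exists
    exact hup t h2 h3 c2 h1

lemma dt_laurent (U : Set ℂ) (hU : IsOpen U) (a : ℂ) (haU : a ∈ U) (b : ℕ) :
    ∀ P : ℂ → ℂ, DifferentiableOn ℂ P U → ∃ (d : ℕ → ℂ) (g : ℂ → ℂ), DifferentiableOn ℂ g U ∧
      (∀ s ∈ U, s ≠ a → P s / (s - a) ^ b = ∑ k ∈ Finset.range b, d k / (s - a) ^ (k + 1) + g s) ∧
      ∀ k, b = k + 1 → d k = P a := by
  induction b with
  | zero => exact fun P hP => ⟨fun _ => 0, P, hP, by simp, by simp⟩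
  | succ b ih =>
    intro P hP
    obtain ⟨d, g, hg, hs, _⟩ := ih (dslope P a)
      ((Complex.differentiableOn_dslope (hU.mem_nhds haU)).2 hP)
    refine ⟨fun k => if k = b then P a else d k, g, hg, fun s hsU hsa => ?_, fun k hk => ?_⟩
    · rw [Finset.sum_range_succ, Finset.sum_congr rfl (g := fun k => d k / (s - a) ^ (k + 1))]
      · have h0 : s - a ≠ 0 := sub_ne_zero.2 hsa
        have h1 : P s = P a + (s - a) * dslope P a s := by
          have := sub_smul_dslope P a s
          rw [smul_eq_mul] at this
          rw [this]; ring
        rw [add_right_comm, ← hs s hsU hsa, h1]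
        simp only [if_true]
        rw [pow_succ]
        field_simp
        ring
      · intro k hk
        simp only [if_neg (Finset.mem_range.1 hk).ne]
    · have : k = b := by omega
      simp [this]

lemma dt_count_finite (lam : ℕ → ℝ) (hinf : Tendsto lam atTop atTop) (B : ℝ) :
    {n : ℕ | lam n ≤ B}.Finite := by
  have h := hinf.eventually_gt_atTop B
  rw [← Nat.cofinite_eq_atTop, Filter.eventually_cofinite] at h
  simpa using h

open MeasureTheory in
lemma dt_laplace_count (lam : ℕ → ℝ) (hpos : ∀ n, 0 < lam n) (hinf : Tendsto lam atTop atTop)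
    (s Zs : ℂ) (hs : 0 < s.re) (hZ : HasSum (fun n : ℕ => (lam n : ℂ) ^ (-s)) Zs) :
    ∫ u : ℝ, (({n : ℕ | lam n ≤ Real.exp u}.ncard : ℝ) : ℂ) * Complex.exp (-s * u) = Zs / s := by
  have hs0 : s ≠ 0 := by rintro rfl; simp at hs
  set F : ℕ → ℝ → ℂ := fun n => (Set.Ioi (Real.log (lam n))).indicator (fun u : ℝ => Complex.exp (-s * u))
    with hF
  have hFi : ∀ n, Integrable (F n) := fun n => by
    rw [hF, integrable_indicator_iff measurableSet_Ioi]
    exact integrableOn_exp_mul_complex_Ioi (by simpa using hs) _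
  have hFv : ∀ n, ∫ u, F n u = (lam n : ℂ) ^ (-s) / s := fun n => by
    rw [hF, integral_indicator measurableSet_Ioi, integral_exp_mul_complex_Ioi (by simpa using hs),
      Complex.cpow_def_of_ne_zero (by exact_mod_cast (hpos n).ne'), ← Complex.ofReal_log (hpos n).le,
      neg_div_neg_eq, mul_comm]
  have hFn : ∀ n, ∫ u, ‖F n u‖ = ‖(lam n : ℂ) ^ (-s)‖ / s.re := fun n => by
    have : (fun u => ‖F n u‖) = (Set.Ioi (Real.log (lam n))).indicator (fun u : ℝ => Real.exp (-s.re * u)) := by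
      ext u
      rw [hF, norm_indicator_eq_indicator_norm]
      congr 1; ext u
      rw [Complex.norm_exp]; simp
    rw [this, integral_indicator measurableSet_Ioi, integral_exp_mul_Ioi (by simpa using hs),
      Complex.norm_cpow_eq_rpow_re_of_pos (hpos n), Real.rpow_def_of_pos (hpos n), neg_div_neg_eq,
      mul_comm, Complex.neg_re]
  have hsum : Summable fun n => ∫ u, ‖F n u‖ := by
    simp only [hFn]
    exact hZ.summable.norm.div_const _
  have h1 := hasSum_integral_of_summable_integral_norm hFi hsum
  simp only [hFv] at h1
  have h2 := h1.unique (hZ.div_const s)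
  rw [← h2]
  have hnull : ∀ᵐ u : ℝ, ∀ n, u ≠ Real.log (lam n) := by
    rw [ae_all_iff]
    intro n
    exact Measure.ae_ne volume _
  refine integral_congr_ae ?_
  filter_upwards [hnull] with u hu
  have hfin := dt_count_finite lam hinf (Real.exp u)
  have hmem : ∀ n, u ∈ Set.Ioi (Real.log (lam n)) ↔ n ∈ hfin.toFinset := by
    intro n
    rw [Set.Finite.mem_toFinset, Set.mem_Ioi]
    change _ ↔ lam n ≤ Real.exp u
    rw [← Real.log_le_iff_le_exp (hpos n)]
    exact ⟨le_of_lt, fun h => lt_of_le_of_ne h (hu n).symm⟩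
  rw [tsum_eq_sum (s := hfin.toFinset) (fun n hn => Set.indicator_of_notMem (fun h => hn ((hmem n).1 h)) _),
    Finset.sum_congr rfl (fun n hn => Set.indicator_of_mem ((hmem n).2 hn) _), Finset.sum_const,
    Set.ncard_eq_toFinset_card _ hfin]
  simp

/-- **Delange's Tauberian theorem.**
Let `(λ n)` be a sequence of positive reals tending to infinity (so that
`N B = #{n : λ n ≤ B}` is finite for every real `B`), and suppose the Dirichlet series
`Z s = ∑' n, (λ n) ^ (-s)` converges for `Re s > a`, where `a > 0`.  Assume there are
`ε > 0`, `Θ > 0`, an integer `b ≥ 1` and a function `f` holomorphic on the half-plane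
`{s : Re s > a - ε}` such that `Z s = Θ/(s-a)^b + f s/(s-a)^(b-1)` for `Re s > a`.
Then `N B = (Θ/(a (b-1)!)) B^a (log B)^(b-1) (1 + o(1))` as `B → ∞`. -/
theorem delange_tauberian
    (lam : ℕ → ℝ) (hpos : ∀ n, 0 < lam n) (hinf : Tendsto lam atTop atTop)
    (a : ℝ) (ha : 0 < a)
    (Z : ℂ → ℂ)
    (hZ : ∀ s : ℂ, a < s.re → HasSum (fun n : ℕ => (lam n : ℂ) ^ (-s)) (Z s))
    (ε : ℝ) (hε : 0 < ε) (Θ : ℝ) (hΘ : 0 < Θ) (b : ℕ) (hb : 1 ≤ b)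
    (f : ℂ → ℂ) (hf : DifferentiableOn ℂ f {s : ℂ | a - ε < s.re})
    (hrep : ∀ s : ℂ, a < s.re →
      Z s = (Θ : ℂ) / (s - (a : ℂ)) ^ b + f s / (s - (a : ℂ)) ^ (b - 1)) :
    Tendsto
      (fun B : ℝ => ({n : ℕ | lam n ≤ B}.ncard : ℝ) / (B ^ a * (Real.log B) ^ (b - 1)))
      atTop (𝓝 (Θ / (a * (Nat.factorial (b - 1) : ℝ)))) := by
  obtain ⟨m, rfl⟩ : ∃ m, b = m + 1 := ⟨b - 1, by omega⟩
  simp only [Nat.add_sub_cancel] at hrep ⊢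
  set N : ℝ → ℝ := fun u => ({n : ℕ | lam n ≤ Real.exp u}.ncard : ℝ) with hN
  have hN0 : ∀ u, 0 ≤ N u := fun u => by simp [hN]
  have hNmono : Monotone N := by
    intro u v huv
    simp only [hN, Nat.cast_le]
    refine Set.ncard_le_ncard ?_ (dt_count_finite lam hinf _)
    intro n hn
    exact le_trans (b := Real.exp u) hn (Real.exp_le_exp.2 huv)
  set M : ℝ → ℝ := fun u => Real.exp (-a * u) * N u with hM
  have hM0 : ∀ u, 0 ≤ M u := fun u => mul_nonneg (Real.exp_nonneg _) (hN0 u)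
  -- vanishing near minus infinity
  obtain ⟨u0, hu0⟩ : ∃ u0, ∀ u < u0, M u = 0 := by
    obtain ⟨u0, hu0⟩ := Filter.bddBelow_range_of_tendsto_atTop_atTop (Real.tendsto_log_atTop.comp hinf)
    refine ⟨u0, fun u hu => ?_⟩
    have : {n : ℕ | lam n ≤ Real.exp u} = ∅ := by
      rw [Set.eq_empty_iff_forall_notMem]
      intro n hn
      have h1 : Real.log (lam n) ≤ u := (Real.log_le_iff_le_exp (hpos n)).2 hn
      have h2 : u0 ≤ Real.log (lam n) := hu0 ⟨n, rfl⟩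
      linarith
    simp [hM, hN, this]
  have hlap : ∀ s : ℂ, 0 < s.re →
      ∫ u : ℝ, (M u : ℂ) * Complex.exp (-s * u) = Z (s + a) / (s + a) := by
    intro s hs
    rw [← dt_laplace_count lam hpos hinf (s + a) (Z (s + a)) (by simp; linarith)
      (hZ (s + a) (by simpa using hs))]
    congr 1; ext u
    simp only [hM, hN]
    push_cast
    rw [mul_comm (Complex.exp _), mul_assoc, ← Complex.exp_add]
    congr 2; ring
  have hInteg : ∀ σ : ℝ, 0 < σ → MeasureTheory.Integrable (fun u => ((M u * Real.exp (-σ * u) : ℝ) : ℂ)) := by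
    intro σ hσ
    apply MeasureTheory.Integrable.of_integral_ne_zero
    have h1 := hlap σ (by simpa using hσ)
    have h2 : ∫ u : ℝ, ((M u * Real.exp (-σ * u) : ℝ) : ℂ) = Z (σ + a) / (σ + a) := by
      rw [← h1]
      congr 1; ext u; push_cast; rfl
    rw [h2]
    have hre := Complex.hasSum_re (hZ (σ + a) (by simpa using hσ))
    have hterm : ∀ n, ((lam n : ℂ) ^ (-((σ : ℂ) + a))).re = lam n ^ (-(σ + a)) := by
      intro n
      have : (-((σ : ℂ) + a)) = ((-(σ + a) : ℝ) : ℂ) := by push_cast; ring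
      rw [this, ← Complex.ofReal_cpow (hpos n).le, Complex.ofReal_re]
    simp only [hterm] at hre
    have hpos2 : 0 < (Z (σ + a)).re := by
      rw [← hre.tsum_eq]
      exact hre.summable.tsum_pos (fun n => (Real.rpow_pos_of_pos (hpos n) _).le) 0
        (Real.rpow_pos_of_pos (hpos 0) _)
    refine div_ne_zero (fun h => ?_) (fun h => ?_)
    · rw [h] at hpos2; simp at hpos2
    · have := congrArg Complex.re h
      simp at this; linarith
  -- Laurent expansion
  set U : Set ℂ := {s : ℂ | max (a - ε) 0 < s.re} with hU
  have hmemU : ∀ s : ℂ, s ∈ U ↔ max (a - ε) 0 < s.re := fun _ => Iff.rfl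
  have hUo : IsOpen U := isOpen_lt continuous_const Complex.continuous_re
  have haU : (a : ℂ) ∈ U := by
    rw [hmemU, Complex.ofReal_re]
    exact max_lt (by linarith) ha
  have hP : DifferentiableOn ℂ (fun s : ℂ => ((Θ : ℂ) + f s * (s - a)) / s) U := by
    have hfU : DifferentiableOn ℂ f U := hf.mono fun s hs => by
      change a - ε < s.re
      exact lt_of_le_of_lt (le_max_left _ _) ((hmemU s).1 hs)
    refine DifferentiableOn.div (by fun_prop) (by fun_prop) fun s hs h0 => ?_
    have : 0 < s.re := lt_of_le_of_lt (le_max_right _ _) ((hmemU s).1 hs)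
    rw [h0] at this; simp at this
  obtain ⟨d, g, hg, hgs, hd⟩ := dt_laurent U hUo a haU (m + 1) _ hP
  have hdm : d m = ((Θ / a : ℝ) : ℂ) := by
    rw [hd m rfl]; simp
  have hmain : ∀ s : ℂ, 0 < s.re → ∫ u : ℝ, (M u : ℂ) * Complex.exp (-s * u)
      = ∑ k ∈ Finset.range (m + 1), d k / s ^ (k + 1) + g (s + a) := by
    intro s hs
    have hs0 : s ≠ 0 := by rintro rfl; simp at hs
    have hsa : s + a ≠ 0 := by
      intro h
      have := congrArg Complex.re h
      simp at this; linarith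
    have hsU : s + a ∈ U := by
      rw [hmemU, Complex.add_re, Complex.ofReal_re]
      exact max_lt (by linarith) (by linarith)
    have h1 := hgs (s + a) hsU (by simpa using hs0)
    simp only [add_sub_cancel_right] at h1
    rw [hlap s hs, ← h1, hrep (s + a) (by simpa using hs), add_sub_cancel_right, pow_succ]
    field_simp
  have hgc : ContinuousOn (fun s : ℂ => g (s + a)) {s | 0 ≤ s.re} := by
    refine hg.continuousOn.comp (by fun_prop) fun s hs => ?_
    have hs : 0 ≤ s.re := hs
    rw [hmemU, Complex.add_re, Complex.ofReal_re]
    exact max_lt (by linarith) (by linarith)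
  have hT : Tendsto (fun T => M T / T ^ m) atTop (𝓝 (Θ / a / m.factorial)) := by
    refine dt_sandwich M hM0 u0 hu0 a ha ?_ m _ ?_
    · intro u v huv
      have e : ∀ w, Real.exp (a * w) * M w = N w := by
        intro w
        simp only [hM]
        rw [← mul_assoc, ← Real.exp_add]; simp
      rw [e, e]
      exact hNmono huv
    · intro δ η hδ hη
      obtain ⟨φ, κ, h1, h2, h3, h4, h5, h6, h7, h8⟩ := dt_kernel_scaled m δ η hδ hη
      obtain ⟨h9, h10⟩ := dt_limit M hM0 u0 hu0 hInteg m d (Θ / a) hdm _ hgc hmain φ κ h1 h2 h3 h4 h5 h6 h7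
      exact ⟨κ, h4, h6, MeasureTheory.Integrable.of_integral_ne_zero (by rw [h7]; exact one_ne_zero), h7, h8, h9, h10⟩
  rw [← div_div]
  refine (hT.comp Real.tendsto_log_atTop).congr' ?_
  filter_upwards [eventually_gt_atTop 0] with B hB
  simp only [Function.comp, hM, hN]
  rw [Real.exp_log hB, Real.rpow_def_of_pos hB, neg_mul, Real.exp_neg, mul_comm (Real.log B) a]
  field_simp
end

section
/- Assume Assumption (†). Let V be a weakly saturated subvariety of ℙ^m over F, and suppose that no dense Zariski open subset U ⊆ V is strongly saturated. Then V contains infinitely many targets, i.e. infinitely many pairwise distinct irreducible locally closed subvarieties W ⊂ V that are strongly saturated, satisfy dim W < dim V, and satisfy 0 < lim_{B→∞} N(W,B)/N(V,B) < 1. -/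
open Filter Topology

namespace ProjSat

/-- The set of `F`-rational points of projective `m`-space, modelled as the
projectivization of `F^(m+1)`. -/
abbrev Pt (F : Type) [Field F] (m : ℕ) := Projectivization F (Fin (m + 1) → F)

variable (F : Type) [Field F] (m : ℕ)

/-- A polynomial `p` vanishes at a point `x ∈ ℙ^m(F)` if it vanishes on every
vector representing `x`. -/
def Vanishes (p : MvPolynomial (Fin (m + 1)) F) (x : Pt F m) : Prop :=
  ∀ (v : Fin (m + 1) → F) (hv : v ≠ 0),
    Projectivization.mk F v hv = x → MvPolynomial.eval v p = 0

/-- The Zariski topology on `ℙ^m(F)`: it is generated by the complements of the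
zero loci of homogeneous polynomials. -/
instance zariskiTopology : TopologicalSpace (Pt F m) :=
  TopologicalSpace.generateFrom
    { U | ∃ (p : MvPolynomial (Fin (m + 1)) F) (d : ℕ),
        p.IsHomogeneous d ∧ U = { x | ¬ Vanishes F m p x } }

variable {F m}

/-- The dimension of a subvariety: the topological Krull dimension of the subspace. -/
noncomputable def dimv (V : Set (Pt F m)) : WithBot ℕ∞ :=
  topologicalKrullDim V

variable (H : Pt F m → ℝ)

/-- The height counting function `N(V, B) = #{x ∈ V(F) : H(x) ≤ B}`. -/
noncomputable def Ncount (V : Set (Pt F m)) (B : ℝ) : ℕ :=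
  {x ∈ V | H x ≤ B}.ncard

/-- The counting ratio `B ↦ N(V', B) / N(V, B)`. -/
noncomputable def ratio (V' V : Set (Pt F m)) : ℝ → ℝ :=
  fun B => (Ncount H V' B : ℝ) / (Ncount H V B : ℝ)

/-- Assumption (†): for all locally closed subvarieties `V' ⊆ V` of `ℙ^m` over `F`
with `V(F)` infinite, the limit `lim_{B→∞} N(V',B)/N(V,B)` exists. -/
def Dagger : Prop :=
  ∀ V' V : Set (Pt F m), IsLocallyClosed V' → IsLocallyClosed V → V' ⊆ V →
    V.Infinite → ∃ L : ℝ, Tendsto (ratio H V' V) atTop (𝓝 L)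

/-- `U` is a dense Zariski open subset of `V`. -/
def IsDenseOpenIn (U V : Set (Pt F m)) : Prop :=
  (∃ O : Set (Pt F m), IsOpen O ∧ U = V ∩ O) ∧ V ⊆ closure U

/-- `V` is weakly saturated: `V` is irreducible, `V(F)` is infinite, and for every
locally closed subvariety `W ⊆ V` with `dim W < dim V` one has
`lim_{B→∞} N(W,B)/N(V,B) < 1`. -/
def WeaklySaturated (V : Set (Pt F m)) : Prop :=
  IsIrreducible V ∧ V.Infinite ∧
    ∀ W : Set (Pt F m), IsLocallyClosed W → W ⊆ V → dimv W < dimv V →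
      ∃ L : ℝ, Tendsto (ratio H W V) atTop (𝓝 L) ∧ L < 1

/-- `V` is strongly saturated: `V` is irreducible, `V(F)` is infinite, and for every
dense Zariski open subset `U ⊆ V` one has `lim_{B→∞} N(U,B)/N(V,B) = 1`. -/
def StronglySaturated (V : Set (Pt F m)) : Prop :=
  IsIrreducible V ∧ V.Infinite ∧
    ∀ U : Set (Pt F m), IsDenseOpenIn U V →
      Tendsto (ratio H U V) atTop (𝓝 1)

end ProjSat

open ProjSat Filter Topology


namespace ProjSat

section Geometry

variable {F : Type} [Field F] {m : ℕ}

theorem homog_eval_smul {p : MvPolynomial (Fin (m + 1)) F} {d : ℕ} (hp : p.IsHomogeneous d)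
    (a : F) (v : Fin (m + 1) → F) :
    MvPolynomial.eval (a • v) p = a ^ d * MvPolynomial.eval v p := by
  rw [MvPolynomial.eval_eq', MvPolynomial.eval_eq', Finset.mul_sum]
  refine Finset.sum_congr rfl fun e he => ?_
  have h := hp (MvPolynomial.mem_support_iff.1 he)
  have h' : ∑ i, e i = d := by
    rw [← h, Finsupp.weight_apply, Finsupp.sum_fintype _ _ (by simp)]
    simp
  simp only [Pi.smul_apply, smul_eq_mul, mul_pow, Finset.prod_mul_distrib]
  rw [Finset.prod_pow_eq_pow_sum, h']
  ring

theorem vanishes_iff_rep {p : MvPolynomial (Fin (m + 1)) F} {d : ℕ} (hp : p.IsHomogeneous d)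
    (x : Pt F m) : Vanishes F m p x ↔ MvPolynomial.eval x.rep p = 0 := by
  constructor
  · intro h
    exact h x.rep x.rep_nonzero x.mk_rep
  · intro h v hv hx
    rw [← x.mk_rep] at hx
    obtain ⟨a, ha⟩ := (Projectivization.mk_eq_mk_iff' F v x.rep hv x.rep_nonzero).1 hx
    rw [← ha, homog_eval_smul hp, h, mul_zero]

/-- The ideal of a set of points. -/
noncomputable def vIdeal (Z : Set (Pt F m)) : Ideal (MvPolynomial (Fin (m + 1)) F) :=
  Ideal.span { p | (∃ d, p.IsHomogeneous d) ∧ ∀ x ∈ Z, Vanishes F m p x }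

theorem vanishes_of_mem {Z : Set (Pt F m)} {p : MvPolynomial (Fin (m + 1)) F}
    (hp : p ∈ vIdeal Z) {x : Pt F m} (hx : x ∈ Z) : Vanishes F m p x := by
  intro v hv hvx
  have : vIdeal Z ≤ RingHom.ker (MvPolynomial.eval v) := by
    refine Ideal.span_le.2 ?_
    rintro q ⟨-, hq⟩
    exact hq x hx v hv hvx
  exact this hp

theorem exists_poly {Z : Set (Pt F m)} (hZ : IsClosed Z) {x : Pt F m} (hx : x ∉ Z) :
    ∃ (p : MvPolynomial (Fin (m + 1)) F) (d : ℕ), p.IsHomogeneous d ∧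
      (∀ y ∈ Z, Vanishes F m p y) ∧ ¬ Vanishes F m p x := by
  have hb := TopologicalSpace.isTopologicalBasis_of_subbasis_of_inter
    (t := zariskiTopology F m) (r := { U | ∃ (p : MvPolynomial (Fin (m + 1)) F) (d : ℕ),
        p.IsHomogeneous d ∧ U = { x | ¬ Vanishes F m p x } }) rfl (by
      rintro s ⟨p, d, hp, rfl⟩ t ⟨q, e, hq, rfl⟩
      refine ⟨p * q, d + e, hp.mul hq, ?_⟩
      ext y
      simp only [Set.mem_inter_iff, Set.mem_ofPred_eq]
      rw [vanishes_iff_rep hp, vanishes_iff_rep hq, vanishes_iff_rep (hp.mul hq), map_mul,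
        mul_eq_zero, not_or])
  obtain ⟨t, ht, hxt, hts⟩ := hb.isOpen_iff.1 hZ.isOpen_compl x hx
  rcases ht with rfl | ⟨p, d, hp, rfl⟩
  · refine ⟨1, 0, MvPolynomial.isHomogeneous_one _ _, fun y hy => (hts (Set.mem_univ y) hy).elim, ?_⟩
    intro h
    simpa using h x.rep x.rep_nonzero x.mk_rep
  · refine ⟨p, d, hp, fun y hy => ?_, hxt⟩
    by_contra h
    exact hts h hy

theorem vIdeal_lt {Z Z' : Set (Pt F m)} (hZ : IsClosed Z) (h : Z < Z') :
    vIdeal Z' < vIdeal Z := by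
  refine lt_of_le_not_ge (Ideal.span_mono fun p hp => ⟨hp.1, fun x hx => hp.2 x (h.le hx)⟩) ?_
  intro hle
  obtain ⟨x, hx', hx⟩ := Set.exists_of_ssubset h
  obtain ⟨p, d, hp, hpZ, hpx⟩ := exists_poly hZ hx
  exact hpx (vanishes_of_mem (hle (Ideal.subset_span ⟨⟨d, hp⟩, hpZ⟩)) hx')

theorem wf_closeds : WellFounded (fun A B : TopologicalSpace.Closeds (Pt F m) => A < B) := by
  have hw : WellFounded (fun I J : Ideal (MvPolynomial (Fin (m + 1)) F) => I > J) :=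
    IsWellFounded.wf
  exact Subrelation.wf (r := InvImage (fun I J => I > J) fun A : TopologicalSpace.Closeds (Pt F m) =>
    vIdeal (A : Set (Pt F m))) (fun {A B} h => vIdeal_lt A.isClosed h) (InvImage.wf _ hw)

attribute [local instance] MvPolynomial.gradedAlgebra in
theorem vIdeal_prime {Z : Set (Pt F m)} (hZ : IsIrreducible Z) : (vIdeal Z).IsPrime := by
  have hh : (vIdeal Z).IsHomogeneous (MvPolynomial.homogeneousSubmodule (Fin (m + 1)) F) :=
    Ideal.homogeneous_span _ _ (by
      rintro p ⟨⟨d, hd⟩, -⟩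
      exact ⟨d, hd⟩)
  refine hh.isPrime_of_homogeneous_mem_or_mem ?_ ?_
  · intro h
    obtain ⟨x, hx⟩ := hZ.nonempty
    have h1 : (1 : MvPolynomial (Fin (m + 1)) F) ∈ vIdeal Z := h ▸ Submodule.mem_top
    simpa using vanishes_of_mem h1 hx x.rep x.rep_nonzero x.mk_rep
  · rintro p q ⟨d, hp⟩ ⟨e, hq⟩ hpq
    replace hp : p.IsHomogeneous d := hp
    replace hq : q.IsHomogeneous e := hq
    by_contra hcon
    rw [not_or] at hcon
    have key : ∀ (r : MvPolynomial (Fin (m + 1)) F) (k : ℕ), r.IsHomogeneous k → r ∉ vIdeal Z →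
        (Z ∩ { x | ¬ Vanishes F m r x }).Nonempty := by
      intro r k hr hrZ
      by_contra hne
      refine hrZ (Ideal.subset_span ⟨⟨k, hr⟩, fun x hx => ?_⟩)
      by_contra hxr
      exact hne ⟨x, hx, hxr⟩
    have hop : ∀ (r : MvPolynomial (Fin (m + 1)) F) (k : ℕ), r.IsHomogeneous k →
        IsOpen { x : Pt F m | ¬ Vanishes F m r x } := fun r k hr =>
      TopologicalSpace.isOpen_generateFrom_of_mem ⟨r, k, hr, rfl⟩
    obtain ⟨x, hxZ, hxp, hxq⟩ := hZ.2 _ _ (hop p d hp) (hop q e hq) (key p d hp hcon.1)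
      (key q e hq hcon.2)
    have := vanishes_of_mem hpq hxZ
    rw [vanishes_iff_rep (hp.mul hq), map_mul, mul_eq_zero] at this
    simp only [Set.mem_ofPred_eq] at hxp hxq
    rw [vanishes_iff_rep hp] at hxp
    rw [vanishes_iff_rep hq] at hxq
    exact this.elim hxp hxq

theorem dim_lt_top (W : Set (Pt F m)) : dimv W < ⊤ := by
  have h1 : topologicalKrullDim (Pt F m) ≤
      ringKrullDim (MvPolynomial (Fin (m + 1)) F) := by
    unfold topologicalKrullDim ringKrullDim
    rw [← Order.krullDim_orderDual (α := PrimeSpectrum (MvPolynomial (Fin (m + 1)) F))]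
    refine Order.krullDim_le_of_strictMono
      (fun Z => OrderDual.toDual ⟨vIdeal (Z : Set (Pt F m)), vIdeal_prime Z.isIrreducible⟩) ?_
    intro Z Z' h
    exact OrderDual.toDual_lt_toDual.2 (vIdeal_lt Z.isClosed h)
  refine lt_of_le_of_lt (topologicalKrullDim_subspace_le _ W) (lt_of_le_of_lt h1 ?_)
  rw [MvPolynomial.ringKrullDim_of_isNoetherianRing, ringKrullDim_eq_zero_of_field, zero_add]
  exact WithBot.coe_lt_coe.2 (ENat.coe_lt_top _)

theorem dim_lt {V W : Set (Pt F m)} (hV : IsIrreducible V) (hWV : W ⊆ V)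
    (hd : ¬ V ⊆ closure W) : dimv W < dimv V := by
  haveI : IrreducibleSpace V := Subtype.irreducibleSpace hV
  let T : TopologicalSpace.IrreducibleCloseds V :=
    ⟨Set.univ, IrreducibleSpace.isIrreducible_univ _, isClosed_univ⟩
  rcases isEmpty_or_nonempty (TopologicalSpace.IrreducibleCloseds W) with hE | hN
  · unfold dimv topologicalKrullDim
    rw [Order.krullDim_eq_bot]
    haveI : Nonempty (TopologicalSpace.IrreducibleCloseds V) := ⟨T⟩
    exact lt_of_lt_of_le (WithBot.bot_lt_coe 0) Order.krullDim_nonneg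
  · have hi : Topology.IsInducing (Set.inclusion hWV) := (Topology.IsEmbedding.inclusion hWV).1
    let f := TopologicalSpace.IrreducibleCloseds.map _ hi.continuous
    have hf : StrictMono f := TopologicalSpace.IrreducibleCloseds.map_strictMono_of_isInducing hi
    have hlt : ∀ Z, f Z < T := by
      intro Z
      refine lt_of_le_of_ne (fun x _ => Set.mem_univ x) ?_
      intro h
      apply hd
      intro x hx
      have hxm : (⟨x, hx⟩ : V) ∈ (f Z : Set V) := by
        rw [h]; exact Set.mem_univ _
      rw [TopologicalSpace.IrreducibleCloseds.coe_map] at hxm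
      rw [closure_subtype] at hxm
      refine closure_mono ?_ hxm
      rintro _ ⟨_, ⟨w, -, rfl⟩, rfl⟩
      exact w.2
    let g : WithTop (TopologicalSpace.IrreducibleCloseds W) →
        TopologicalSpace.IrreducibleCloseds V := fun z => WithTop.recTopCoe T f z
    have hg : StrictMono g := by
      intro a b hab
      induction a with
      | top => exact absurd hab not_top_lt
      | coe a =>
        induction b with
        | top => exact hlt a
        | coe b => exact hf (WithTop.coe_lt_coe.1 hab)
    have h := Order.krullDim_le_of_strictMono g hg
    rw [Order.krullDim_WithTop] at h
    have ht := dim_lt_top W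
    have h0 : (0 : WithBot ℕ∞) ≤ dimv W := Order.krullDim_nonneg
    refine lt_of_lt_of_le ?_ h
    change dimv W < dimv W + 1
    generalize dimv W = k at ht h0
    induction k with
    | bot => simp at h0
    | coe k =>
      induction k with
      | top => exact absurd ht (lt_irrefl _)
      | coe k => exact_mod_cast Nat.lt_succ_self k

end Geometry

section Counting

variable {F : Type} [Field F] {m : ℕ} {H : Pt F m → ℝ}

theorem Ncount_mono (hN : ∀ B : ℝ, {x : Pt F m | H x ≤ B}.Finite) {A C : Set (Pt F m)}
    (h : A ⊆ C) (B : ℝ) : Ncount H A B ≤ Ncount H C B :=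
  Set.ncard_le_ncard (fun _ hx => ⟨h hx.1, hx.2⟩) ((hN B).subset fun _ hx => hx.2)

theorem Ncount_union (A C : Set (Pt F m)) (B : ℝ) :
    Ncount H (A ∪ C) B ≤ Ncount H A B + Ncount H C B := by
  unfold Ncount
  refine le_trans (le_of_eq ?_) (Set.ncard_union_le _ _)
  congr 1
  ext x
  simp only [Set.mem_ofPred_eq, Set.mem_union]
  tauto

theorem Ncount_diff (hN : ∀ B : ℝ, {x : Pt F m | H x ≤ B}.Finite) {A C : Set (Pt F m)}
    (h : A ⊆ C) (B : ℝ) : Ncount H A B + Ncount H (C \ A) B = Ncount H C B := by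
  unfold Ncount
  rw [← Set.ncard_union_eq ?_ ((hN B).subset fun _ hx => hx.2) ((hN B).subset fun _ hx => hx.2)]
  · congr 1
    ext x
    simp only [Set.mem_ofPred_eq, Set.mem_union, Set.mem_sdiff]
    have := @h x
    tauto
  · rw [Set.disjoint_left]
    intro x hx hx'
    exact hx'.1.2 hx.1

theorem ratio_nonneg (A V : Set (Pt F m)) (B : ℝ) : 0 ≤ ratio H A V B := by
  unfold ratio; positivity

theorem null_of_subset_union (hN : ∀ B : ℝ, {x : Pt F m | H x ≤ B}.Finite)
    {A C D V : Set (Pt F m)} (h : A ⊆ C ∪ D) (hC : Tendsto (ratio H C V) atTop (𝓝 0))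
    (hD : Tendsto (ratio H D V) atTop (𝓝 0)) : Tendsto (ratio H A V) atTop (𝓝 0) := by
  have hs := hC.add hD
  rw [add_zero] at hs
  refine squeeze_zero (ratio_nonneg A V) (fun B => ?_) hs
  unfold ratio
  rw [← add_div]
  gcongr
  exact_mod_cast (Ncount_mono hN h B).trans (Ncount_union C D B)

theorem Ncount_tendsto (hN : ∀ B : ℝ, {x : Pt F m | H x ≤ B}.Finite)
    {V : Set (Pt F m)} (hV : V.Infinite) :
    Tendsto (fun B => (Ncount H V B : ℝ)) atTop atTop := by
  refine tendsto_natCast_atTop_atTop.comp (tendsto_atTop.2 fun n => ?_)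
  obtain ⟨s, hsV, hs⟩ := hV.exists_subset_card_eq n
  obtain ⟨M, hM⟩ := (s.finite_toSet.image H).bddAbove
  filter_upwards [eventually_ge_atTop M] with B hB
  rw [← hs, ← Set.ncard_coe_finset]
  refine Set.ncard_le_ncard (fun x hx => ⟨hsV hx, ?_⟩) ((hN B).subset fun _ hx => hx.2)
  exact (hM ⟨x, hx, rfl⟩).trans hB

theorem null_of_finite (hN : ∀ B : ℝ, {x : Pt F m | H x ≤ B}.Finite)
    {A V : Set (Pt F m)} (hV : V.Infinite) (hA : A.Finite) :
    Tendsto (ratio H A V) atTop (𝓝 0) := by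
  have h1 : Tendsto (fun B => (A.ncard : ℝ) / (Ncount H V B : ℝ)) atTop (𝓝 0) :=
    (Ncount_tendsto hN hV).const_div_atTop _
  refine squeeze_zero (ratio_nonneg A V) (fun B => ?_) h1
  unfold ratio
  gcongr
  exact Set.ncard_le_ncard (fun _ hx => hx.1) hA

theorem ratio_tendsto_one (hN : ∀ B : ℝ, {x : Pt F m | H x ≤ B}.Finite)
    {A A' V : Set (Pt F m)} (hA' : A' ⊆ A) (hAV : A ⊆ V) {a : ℝ} (ha : 0 < a)
    (hA : Tendsto (ratio H A V) atTop (𝓝 a))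
    (hD : Tendsto (ratio H (A \ A') V) atTop (𝓝 0)) :
    Tendsto (ratio H A' A) atTop (𝓝 1) := by
  have h := (hA.sub hD).div hA ha.ne'
  rw [sub_zero, div_self ha.ne'] at h
  refine h.congr fun B => ?_
  have h1 := Ncount_diff hN hA' B
  have h2 := Ncount_mono hN hAV B
  simp only [Pi.div_apply, ratio]
  rw [← h1]
  push_cast
  rcases Nat.eq_zero_or_pos (Ncount H V B) with h0 | h0
  · have : Ncount H A' B = 0 := by omega
    simp [h0, this]
  · rw [← sub_div, div_div_div_cancel_right₀ (by positivity)]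
    simp

theorem limit_pos (hd : Dagger H) {A V : Set (Pt F m)} (hA : IsLocallyClosed A)
    (hV : IsLocallyClosed V) (hAV : A ⊆ V) (hVi : V.Infinite)
    (hn : ¬ Tendsto (ratio H A V) atTop (𝓝 0)) :
    ∃ L : ℝ, Tendsto (ratio H A V) atTop (𝓝 L) ∧ 0 < L := by
  obtain ⟨L, hL⟩ := hd A V hA hV hAV hVi
  refine ⟨L, hL, lt_of_le_of_ne (ge_of_tendsto' hL (ratio_nonneg A V)) ?_⟩
  rintro rfl
  exact hn hL

end Counting

end ProjSat

/-- **Infinitely many targets.**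
Assume Assumption (†).  Let `V` be a weakly saturated subvariety of `ℙ^m` over a
number field `F`, and suppose that no dense Zariski open subset `U ⊆ V` is strongly
saturated.  Then `V` contains infinitely many targets: infinitely many pairwise
distinct irreducible locally closed subvarieties `W ⊂ V` which are strongly
saturated, satisfy `dim W < dim V`, and satisfy
`0 < lim_{B→∞} N(W,B)/N(V,B) < 1`. -/
theorem infinitely_many_targets
    (F : Type) [Field F] [NumberField F] (m : ℕ)
    (H : Pt F m → ℝ) (hHpos : ∀ x, 0 < H x)
    (hNorthcott : ∀ B : ℝ, {x : Pt F m | H x ≤ B}.Finite)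
    (hdagger : Dagger H)
    (V : Set (Pt F m)) (hV : IsLocallyClosed V)
    (hws : WeaklySaturated H V)
    (hnostrong : ∀ U : Set (Pt F m), IsDenseOpenIn U V → ¬ StronglySaturated H U) :
    { W : Set (Pt F m) | IsLocallyClosed W ∧ W ⊆ V ∧ IsIrreducible W ∧
        StronglySaturated H W ∧ dimv W < dimv V ∧
        ∃ L : ℝ, Tendsto (ratio H W V) atTop (𝓝 L) ∧ 0 < L ∧ L < 1 }.Infinite := by
  obtain ⟨hVirr, hVinf, hVw⟩ := hws
  intro hfin
  set S := { W : Set (Pt F m) | IsLocallyClosed W ∧ W ⊆ V ∧ IsIrreducible W ∧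
        StronglySaturated H W ∧ dimv W < dimv V ∧
        ∃ L : ℝ, Tendsto (ratio H W V) atTop (𝓝 L) ∧ 0 < L ∧ L < 1 } with hS
  -- targets are not dense
  have hnd : ∀ W ∈ S, ¬ V ⊆ closure W := by
    rintro W ⟨hW, hWV, -, hWs, -⟩ hVW
    refine hnostrong W ⟨?_, hVW⟩ hWs
    obtain ⟨O, Z, hO, hZ, rfl⟩ := hW
    refine ⟨O, hO, Set.Subset.antisymm (fun x hx => ⟨hWV hx, hx.1⟩) fun x hx => ⟨hx.2, ?_⟩⟩
    exact closure_minimal Set.inter_subset_right hZ (hVW hx.1)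
  set C : Set (Pt F m) := ⋃ W ∈ S, closure W with hC
  have hCcl : IsClosed C := hfin.isClosed_biUnion fun _ _ => isClosed_closure
  have hVC : ¬ V ⊆ C := by
    intro h
    classical
    obtain ⟨z, hz, hVz⟩ := isIrreducible_iff_sUnion_isClosed.1 hVirr
      (hfin.toFinset.image closure) (by
        intro z hz
        obtain ⟨W, -, rfl⟩ := Finset.mem_image.1 hz
        exact isClosed_closure) (by
        intro x hx
        obtain ⟨W, hW, hxW⟩ := Set.mem_iUnion₂.1 (h hx)
        exact ⟨closure W, by simpa using ⟨W, hW, rfl⟩, hxW⟩)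
    obtain ⟨W, hW, rfl⟩ := Finset.mem_image.1 hz
    exact hnd W (hfin.mem_toFinset.1 hW) hVz
  set U : Set (Pt F m) := V ∩ Cᶜ with hU
  have hUne : U.Nonempty := by
    obtain ⟨x, hx, hxC⟩ := Set.not_subset.1 hVC
    exact ⟨x, hx, hxC⟩
  have hUV : U ⊆ V := Set.inter_subset_left
  have hUlc : IsLocallyClosed U := hV.inter hCcl.isOpen_compl.isLocallyClosed
  have hUdense : IsDenseOpenIn U V := ⟨⟨Cᶜ, hCcl.isOpen_compl, rfl⟩,
    subset_closure_inter_of_isPreirreducible_of_isOpen hVirr.2 hCcl.isOpen_compl hUne⟩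
  have hUirr : IsIrreducible U := by
    rw [← isIrreducible_iff_closure, Set.Subset.antisymm (closure_mono hUV)
      (closure_minimal hUdense.2 isClosed_closure), isIrreducible_iff_closure]
    exact hVirr
  -- `U` has positive density
  have hUnn : ¬ Tendsto (ratio H U V) atTop (𝓝 0) := by
    intro h0
    obtain ⟨L, hL, hL1⟩ := hVw (V ∩ C) (hV.inter hCcl.isLocallyClosed) Set.inter_subset_left
      (dim_lt hVirr Set.inter_subset_left fun h =>
        hVC (h.trans (closure_minimal Set.inter_subset_right hCcl)))
    have hs := h0.add hL
    have h1 : Tendsto (fun B => ratio H U V B + ratio H (V ∩ C) V B) atTop (𝓝 1) := by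
      refine tendsto_const_nhds.congr' ?_
      filter_upwards [(Ncount_tendsto hNorthcott hVinf).eventually_gt_atTop 0] with B hB
      have hd := Ncount_diff hNorthcott hUV B
      have he : V \ U = V ∩ C := by
        ext x
        simp only [hU, Set.mem_sdiff, Set.mem_inter_iff, Set.mem_compl_iff]
        tauto
      rw [he] at hd
      unfold ratio
      rw [← add_div, ← Nat.cast_add, hd, div_self hB.ne']
    have := tendsto_nhds_unique hs h1
    linarith
  obtain ⟨u, hu, hupos⟩ := limit_pos hdagger hUlc hV hUV hVinf hUnn
  have hUinf : U.Infinite := fun h => hUnn (null_of_finite hNorthcott hVinf h)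
  -- a non-null proper closed subset of `U`
  obtain ⟨T₀, hT₀cl, hT₀V, hT₀⟩ : ∃ T : Set (Pt F m), IsClosed T ∧ ¬ U ⊆ T ∧
      ¬ Tendsto (ratio H (T ∩ U) V) atTop (𝓝 0) := by
    by_contra hcon
    push Not at hcon
    refine hnostrong U hUdense ⟨hUirr, hUinf, ?_⟩
    rintro U' ⟨⟨O, hO, rfl⟩, hd⟩
    refine ratio_tendsto_one hNorthcott Set.inter_subset_left hUV hupos hu ?_
    have he : U \ (U ∩ O) = Oᶜ ∩ U := by
      ext x
      simp only [Set.mem_sdiff, Set.mem_inter_iff, Set.mem_compl_iff]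
      tauto
    rw [he]
    refine hcon _ hO.isClosed_compl fun h => ?_
    obtain ⟨x, hx⟩ := hUne
    obtain ⟨y, hy⟩ := closure_nonempty_iff.1 ⟨x, hd hx⟩
    exact h hy.1 hy.2
  -- a minimal one
  obtain ⟨T, hT, hTmin⟩ := wf_closeds.has_min
    { T : TopologicalSpace.Closeds (Pt F m) | ¬ U ⊆ (T : Set (Pt F m)) ∧
      ¬ Tendsto (ratio H ((T : Set (Pt F m)) ∩ U) V) atTop (𝓝 0) }
    ⟨⟨T₀, hT₀cl⟩, hT₀V, hT₀⟩
  obtain ⟨hTV, hTn⟩ := hT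
  have hmin : ∀ Z : Set (Pt F m), IsClosed Z → ¬ (T : Set (Pt F m)) ⊆ Z →
      Tendsto (ratio H ((T : Set (Pt F m)) ∩ Z ∩ U) V) atTop (𝓝 0) := by
    intro Z hZ hTZ
    by_contra hcon
    refine hTmin ⟨(T : Set (Pt F m)) ∩ Z, T.isClosed.inter hZ⟩
      ⟨fun h => hTV (h.trans Set.inter_subset_left), hcon⟩ ?_
    refine lt_of_le_not_ge (fun x hx => hx.1) fun h => hTZ fun x hx => (h hx).2
  set W : Set (Pt F m) := (T : Set (Pt F m)) ∩ U with hW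
  have hWU : W ⊆ U := Set.inter_subset_right
  have hWV : W ⊆ V := hWU.trans hUV
  have hWlc : IsLocallyClosed W := T.isClosed.isLocallyClosed.inter hUlc
  have hWinf : W.Infinite := fun h => hTn (null_of_finite hNorthcott hVinf h)
  have hWirr : IsIrreducible W := by
    refine ⟨hWinf.nonempty, isPreirreducible_iff_isClosed_union_isClosed.2 ?_⟩
    intro Z₁ Z₂ hZ₁ hZ₂ hsub
    by_contra hcon
    rw [not_or] at hcon
    refine hTn (null_of_subset_union hNorthcott (C := (T : Set (Pt F m)) ∩ Z₁ ∩ U)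
      (D := (T : Set (Pt F m)) ∩ Z₂ ∩ U) ?_ (hmin Z₁ hZ₁ ?_) (hmin Z₂ hZ₂ ?_))
    · intro x hx
      rcases hsub hx with h | h
      · exact Or.inl ⟨⟨hx.1, h⟩, hx.2⟩
      · exact Or.inr ⟨⟨hx.1, h⟩, hx.2⟩
    · exact fun h => hcon.1 fun x hx => h hx.1
    · exact fun h => hcon.2 fun x hx => h hx.1
  obtain ⟨w, hw, hwpos⟩ := limit_pos hdagger hWlc hV hWV hVinf hTn
  have hWss : StronglySaturated H W := by
    refine ⟨hWirr, hWinf, ?_⟩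
    rintro U' ⟨⟨O, hO, rfl⟩, hd⟩
    refine ratio_tendsto_one hNorthcott Set.inter_subset_left hWV hwpos hw ?_
    have he : W \ (W ∩ O) = (T : Set (Pt F m)) ∩ Oᶜ ∩ U := by
      ext x
      simp only [hW, Set.mem_sdiff, Set.mem_inter_iff, Set.mem_compl_iff]
      tauto
    rw [he]
    refine hmin _ hO.isClosed_compl fun h => ?_
    obtain ⟨x, hx⟩ := hWinf.nonempty
    obtain ⟨y, hy⟩ := closure_nonempty_iff.1 ⟨x, hd hx⟩
    exact h hy.1.1 hy.2
  have hWdim : dimv W < dimv V := dim_lt hVirr hWV fun h =>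
    hTV (hUV.trans (h.trans (closure_minimal Set.inter_subset_left T.isClosed)))
  have hWS : W ∈ S := by
    refine ⟨hWlc, hWV, hWirr, hWss, hWdim, w, hw, hwpos, ?_⟩
    obtain ⟨L, hL, hL1⟩ := hVw W hWlc hWV hWdim
    rwa [tendsto_nhds_unique hw hL]
  obtain ⟨x, hx⟩ := hWinf.nonempty
  exact (hWU hx).2 (Set.mem_iUnion₂.2 ⟨W, hWS, subset_closure hx⟩)
end

section
/- For (x,y) ∈ ℚ^× × ℚ^× define H(x,y) := ∏_v max(|x|_v, |y|_v, |xy|_v^{−1}), where v ranges over the archimedean place and all prime numbers p, |·|_p denoting the p-adic absolute value normalized by |p|_p = 1/p (all but finitely many factors equal 1). Set N(B) := #{(x,y) ∈ ℚ^× × ℚ^× : H(x,y) ≤ B}, which is finite for every B. Then as B → ∞, N(B) = c·B·(log B)^6·(1 + o(1)), where c = (1/720)·∏_p (1 + 7/p + 1/p²)·(1 − 1/p)^7, the product running over all primes p and converging to a positive real number. -/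
open Filter Topology

/-- The anticanonical height `H(x,y) = ∏_v max(|x|_v, |y|_v, |xy|_v⁻¹)` on the torus
`xyz = 1` inside the cubic surface `xyz = u³`, the product running over the
archimedean place of `ℚ` and all primes `p`. -/
noncomputable def cubicTorusHeight (x y : ℚ) : ℝ :=
  max |(x : ℝ)| (max |(y : ℝ)| |((x * y : ℚ) : ℝ)|⁻¹) *
    ∏' p : Nat.Primes,
      ((max (padicNorm p x) (max (padicNorm p y) (padicNorm p (x * y))⁻¹) : ℚ) : ℝ)

/-- The number of rational points `(x,y) ∈ ℚ^× × ℚ^×` of height at most `B`. -/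
noncomputable def cubicTorusCount (B : ℝ) : ℕ :=
  {q : ℚˣ × ℚˣ | cubicTorusHeight (q.1 : ℚ) (q.2 : ℚ) ≤ B}.ncard

/-- The Euler factor `(1 + 7/p + 1/p²)(1 - 1/p)⁷` at the prime `p`. -/
noncomputable def cubicTorusEulerFactor (p : Nat.Primes) : ℝ :=
  (1 + 7 / ((p : ℕ) : ℝ) + 1 / ((p : ℕ) : ℝ) ^ 2) * (1 - 1 / ((p : ℕ) : ℝ)) ^ 7

namespace CT

/-- The six small exponent vectors. -/
def csv : Fin 6 → Fin 3 → ℕ :=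
  ![![2,1,0], ![2,0,1], ![1,2,0], ![1,0,2], ![0,2,1], ![0,1,2]]
/-- The seven correction exponent vectors. -/
def cbv : Fin 7 → Fin 3 → ℕ :=
  ![![2,1,3], ![2,3,1], ![1,2,3], ![1,3,2], ![3,2,1], ![3,1,2], ![3,3,3]]

abbrev Col := Fin 6 ⊕ Fin 7

def cvec : Col → Fin 3 → ℕ := Sum.elim csv cbv
def cdeg : Col → ℕ := Sum.elim (fun _ => 1) ![2,2,2,2,2,2,3]
noncomputable def ceps (ε : ℝ) : Col → ℝ := Sum.elim (fun _ => 1) (fun _ => ε)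

/-- Configurations: a finite set of primes with a colour for each. -/
abbrev Conf := Σ s : Finset Nat.Primes, (s → Col)

lemma cvec_sum (c : Col) : ∑ i, cvec c i = 3 * cdeg c := by
  revert c; decide

lemma conf_fiber (g : Nat.Primes → Col → ℝ) (s : Finset Nat.Primes) :
    ∑ f : s → Col, ∏ p : s, g p (f p) = ∏ p ∈ s, ∑ c, g p c := by
  rw [← Finset.prod_coe_sort s (fun p => ∑ c, g p c), Finset.prod_univ_sum]
  simp

lemma conf_summable (g : Nat.Primes → Col → ℝ) (hg : Summable fun p => ∑ c, |g p c|) :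
    Summable (fun ω : Conf => |∏ p : ω.1, g p (ω.2 p)|) := by
  rw [summable_sigma_of_nonneg (fun _ => abs_nonneg _)]
  refine ⟨fun s => (hasSum_fintype _).summable, ?_⟩
  have : ∀ s : Finset Nat.Primes, ∑' f : s → Col, |∏ p : s, g p (f p)| =
      ∏ p ∈ s, ∑ c, |g p c| := by
    intro s
    rw [tsum_fintype, ← conf_fiber (fun p c => |g p c|)]
    simp only [Finset.abs_prod]
  simp only [this]
  exact summable_finsetProd_of_summable_nonneg
    (fun p => Finset.sum_nonneg fun _ _ => abs_nonneg _) hg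

lemma conf_hasSum (g : Nat.Primes → Col → ℝ) (hg : Summable fun p => ∑ c, |g p c|) :
    HasSum (fun ω : Conf => ∏ p : ω.1, g p (ω.2 p)) (∏' p, (1 + ∑ c, g p c)) := by
  have h1 := (conf_summable g hg).of_abs
  have h2 : Summable fun p => ‖∑ c, g p c‖ :=
    hg.of_nonneg_of_le (fun _ => norm_nonneg _) (fun p => Finset.abs_sum_le_sum_abs _ _)
  rw [tprod_one_add (summable_finsetProd_of_summable_norm h2)]
  have := h1.hasSum
  rw [h1.tsum_sigma' (fun s => (hasSum_fintype _).summable)] at this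
  have e : ∀ s : Finset Nat.Primes, ∑' f : s → Col, ∏ p : s, g p (f p) =
      ∏ p ∈ s, ∑ c, g p c := fun s => by rw [tsum_fintype, conf_fiber]
  simp only [e] at this
  exact this

lemma one_sub_sum_le {ι : Type*} (s : Finset ι) (z : ι → ℝ) (h0 : ∀ i, 0 ≤ z i)
    (h1 : ∀ i, z i ≤ 1) : 1 - ∑ i ∈ s, z i ≤ ∏ i ∈ s, (1 - z i) := by
  classical
  induction s using Finset.induction_on with
  | empty => simp
  | insert a s ha ih =>
    rw [Finset.sum_insert ha, Finset.prod_insert ha]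
    have hS : 0 ≤ ∑ i ∈ s, z i := Finset.sum_nonneg fun i _ => h0 i
    nlinarith [mul_le_mul_of_nonneg_left ih (sub_nonneg.2 (h1 a)), h0 a, mul_nonneg (h0 a) hS]

lemma loc_bound (z : Fin 6 → ℝ) (t r : ℝ) (h0 : ∀ i, 0 ≤ z i) (h1 : ∀ i, z i ≤ t)
    (ht : t ≤ 1) (hr : |r| ≤ 7 * t ^ 2) :
    |(1 + ∑ i, z i + r) * ∏ i, (1 - z i) - 1| ≤ 43 * t ^ 2 := by
  have hS0 : 0 ≤ ∑ i, z i := Finset.sum_nonneg fun i _ => h0 i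
  have hS1 : ∑ i, z i ≤ 6 * t := by
    calc ∑ i, z i ≤ ∑ i : Fin 6, t := Finset.sum_le_sum fun i _ => h1 i
      _ = 6 * t := by simp
  have hP0 : 0 ≤ ∏ i, (1 - z i) := Finset.prod_nonneg fun i _ => by linarith [h1 i]
  have hP1 : 1 - ∑ i, z i ≤ ∏ i, (1 - z i) := one_sub_sum_le _ _ h0 (fun i => (h1 i).trans ht)
  have hP2 : ∏ i, (1 - z i) ≤ 1 :=
    Finset.prod_le_one (fun i _ => by linarith [h1 i]) (fun i _ => by linarith [h0 i])
  have hP3 : (1 + ∑ i, z i) * ∏ i, (1 - z i) ≤ 1 := by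
    have : ∏ i, (1 - z i) ≤ Real.exp (-∑ i, z i) := by
      rw [← Finset.sum_neg_distrib, Real.exp_sum]
      refine Finset.prod_le_prod (fun i _ => by linarith [h1 i]) fun i _ => ?_
      linarith [Real.add_one_le_exp (-z i)]
    calc _ ≤ Real.exp (∑ i, z i) * Real.exp (-∑ i, z i) := by
          apply mul_le_mul _ this hP0 (Real.exp_pos _).le
          linarith [Real.add_one_le_exp (∑ i, z i)]
      _ = 1 := by rw [← Real.exp_add]; simp
  set S := ∑ i, z i
  set P := ∏ i, (1 - z i)
  have h4 : 1 - S ^ 2 ≤ (1 + S) * P := by nlinarith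
  have hS2 : S ^ 2 ≤ 36 * t ^ 2 := by nlinarith
  have h5 : |r * P| ≤ 7 * t ^ 2 := by
    rw [abs_mul, abs_of_nonneg hP0]
    calc |r| * P ≤ |r| * 1 := by gcongr
      _ ≤ _ := by linarith
  rw [abs_le] at h5 ⊢
  constructor <;> nlinarith

end CT

namespace CT

lemma prime_inv_nonneg (p : Nat.Primes) : 0 ≤ ((p : ℕ) : ℝ)⁻¹ := by positivity

lemma prime_one_lt (p : Nat.Primes) : (1 : ℝ) < ((p : ℕ) : ℝ) := by
  exact_mod_cast p.2.one_lt

lemma prime_inv_le (p : Nat.Primes) : ((p : ℕ) : ℝ)⁻¹ ≤ 1 / 2 := by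
  rw [inv_eq_one_div]
  apply one_div_le_one_div_of_le (by norm_num)
  exact_mod_cast p.2.two_le

lemma summable_prime_sq : Summable fun p : Nat.Primes => (((p : ℕ) : ℝ)⁻¹) ^ 2 := by
  have : Summable fun n : ℕ => ((n : ℝ)⁻¹) ^ 2 := by
    simp
  exact this.comp_injective Nat.Primes.coe_nat_injective

/-- Exponent of `p` attached to a colour. -/
noncomputable def cexpo (κ : Fin 3 → ℝ) (c : Col) : ℝ := cdeg c + ∑ i, (cvec c i : ℝ) * κ i

noncomputable def gterm (ε : ℝ) (κ : Fin 3 → ℝ) (p : Nat.Primes) (c : Col) : ℝ :=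
  ceps ε c * ((p : ℕ) : ℝ) ^ (-(cexpo κ c))

noncomputable def sdot (c : Fin 6) (κ : Fin 3 → ℝ) : ℝ := ∑ i, (csv c i : ℝ) * κ i

lemma sdot_pos (c : Fin 6) (κ : Fin 3 → ℝ) (hκ : ∀ i, 0 < κ i) : 0 < sdot c κ := by
  have h0 := hκ 0
  have h1 := hκ 1
  have h2 := hκ 2
  fin_cases c <;> simp [sdot, csv, Fin.sum_univ_three] <;> positivity

lemma cexpo_nonneg_part (κ : Fin 3 → ℝ) (hκ : ∀ i, 0 ≤ κ i) (c : Col) : (cdeg c : ℝ) ≤ cexpo κ c := by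
  unfold cexpo
  have : 0 ≤ ∑ i, (cvec c i : ℝ) * κ i :=
    Finset.sum_nonneg fun i _ => mul_nonneg (Nat.cast_nonneg _) (hκ i)
  linarith

lemma cdeg_inr (j : Fin 7) : 2 ≤ cdeg (Sum.inr j) := by revert j; decide

lemma pow_le_sq (p : Nat.Primes) (κ : Fin 3 → ℝ) (hκ : ∀ i, 0 ≤ κ i) (j : Fin 7) :
    ((p : ℕ) : ℝ) ^ (-(cexpo κ (Sum.inr j))) ≤ (((p : ℕ) : ℝ)⁻¹) ^ 2 := by
  have h1 := cexpo_nonneg_part κ hκ (Sum.inr j)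
  have h2 : (2 : ℝ) ≤ cdeg (Sum.inr j) := by exact_mod_cast cdeg_inr j
  calc ((p : ℕ) : ℝ) ^ (-(cexpo κ (Sum.inr j))) ≤ ((p : ℕ) : ℝ) ^ (-(2 : ℝ)) :=
        Real.rpow_le_rpow_of_exponent_le (prime_one_lt p).le (by linarith)
    _ = _ := by rw [Real.rpow_neg (by positivity)]; norm_num

lemma pow_le_inv (p : Nat.Primes) (κ : Fin 3 → ℝ) (hκ : ∀ i, 0 ≤ κ i) (j : Fin 6) :
    ((p : ℕ) : ℝ) ^ (-(1 + sdot j κ)) ≤ ((p : ℕ) : ℝ)⁻¹ := by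
  have : 0 ≤ sdot j κ := Finset.sum_nonneg fun i _ => mul_nonneg (Nat.cast_nonneg _) (hκ i)
  calc ((p : ℕ) : ℝ) ^ (-(1 + sdot j κ)) ≤ ((p : ℕ) : ℝ) ^ (-(1 : ℝ)) :=
        Real.rpow_le_rpow_of_exponent_le (prime_one_lt p).le (by linarith)
    _ = _ := by rw [Real.rpow_neg (by positivity)]; norm_num

lemma gterm_inl (ε : ℝ) (κ : Fin 3 → ℝ) (p : Nat.Primes) (j : Fin 6) :
    gterm ε κ p (Sum.inl j) = ((p : ℕ) : ℝ) ^ (-(1 + sdot j κ)) := by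
  simp [gterm, ceps, cexpo, cdeg, cvec, sdot]

lemma summable_prime_rpow {x : ℝ} (hx : 0 < x) :
    Summable fun p : Nat.Primes => ((p : ℕ) : ℝ) ^ (-(1 + x)) := by
  have : Summable fun n : ℕ => (n : ℝ) ^ (-(1 + x)) := Real.summable_nat_rpow.2 (by linarith)
  exact this.comp_injective Nat.Primes.coe_nat_injective

lemma gterm_summable (ε : ℝ) (hε : |ε| ≤ 1) (κ : Fin 3 → ℝ) (hκ : ∀ i, 0 < κ i) :
    Summable fun p => ∑ c, |gterm ε κ p c| := by
  simp only [Fintype.sum_sum_type]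
  apply Summable.add
  · refine summable_sum fun j _ => ?_
    simp only [gterm_inl]
    exact (summable_prime_rpow (sdot_pos j κ hκ)).abs
  · refine summable_sum fun j _ => ?_
    refine summable_prime_sq.of_nonneg_of_le (fun _ => abs_nonneg _) fun p => ?_
    have h0 : 0 ≤ ((p : ℕ) : ℝ) ^ (-(cexpo κ (Sum.inr j))) := by positivity
    rw [gterm, abs_mul, abs_of_nonneg h0]
    calc _ ≤ 1 * ((p : ℕ) : ℝ) ^ (-(cexpo κ (Sum.inr j))) := by
          gcongr; simpa [ceps] using hε
      _ ≤ _ := by rw [one_mul]; exact pow_le_sq p κ (fun i => (hκ i).le) j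

/-- The regularised local factor. -/
noncomputable def loc (ε : ℝ) (κ : Fin 3 → ℝ) (p : Nat.Primes) : ℝ :=
  (1 + ∑ c, gterm ε κ p c) * ∏ j : Fin 6, (1 - ((p : ℕ) : ℝ) ^ (-(1 + sdot j κ)))

lemma loc_sub_bound (ε : ℝ) (hε : |ε| ≤ 1) (κ : Fin 3 → ℝ) (hκ : ∀ i, 0 ≤ κ i) (p : Nat.Primes) :
    ‖loc ε κ p - 1‖ ≤ 43 * (((p : ℕ) : ℝ)⁻¹) ^ 2 := by
  unfold loc
  rw [Fintype.sum_sum_type, ← add_assoc]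
  simp only [gterm_inl]
  refine loc_bound _ _ _ (fun i => by positivity) (fun j => pow_le_inv p κ hκ j)
    (by linarith [prime_inv_le p]) ?_
  calc _ ≤ ∑ j : Fin 7, |gterm ε κ p (Sum.inr j)| := Finset.abs_sum_le_sum_abs _ _
    _ ≤ ∑ j : Fin 7, (((p : ℕ) : ℝ)⁻¹) ^ 2 := by
        refine Finset.sum_le_sum fun j _ => ?_
        have h0 : 0 ≤ ((p : ℕ) : ℝ) ^ (-(cexpo κ (Sum.inr j))) := by positivity
        rw [gterm, abs_mul, abs_of_nonneg h0]
        calc _ ≤ 1 * ((p : ℕ) : ℝ) ^ (-(cexpo κ (Sum.inr j))) := by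
              gcongr; simpa [ceps] using hε
          _ ≤ _ := by rw [one_mul]; exact pow_le_sq p κ hκ j
    _ = _ := by simp

lemma loc_multipliable (ε : ℝ) (hε : |ε| ≤ 1) (κ : Fin 3 → ℝ) (hκ : ∀ i, 0 ≤ κ i) :
    Multipliable (loc ε κ) := by
  have h : Summable fun p => ‖loc ε κ p - 1‖ :=
    (summable_prime_sq.mul_left 43).of_nonneg_of_le (fun _ => norm_nonneg _)
      (loc_sub_bound ε hε κ hκ)
  have := multipliable_one_add_of_summable h
  simpa using this

noncomputable def Zt (x : ℝ) : ℝ := ∑' n : ℕ, 1 / (n : ℝ) ^ (1 + x)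

lemma Zt_hasProd {x : ℝ} (hx : 0 < x) :
    HasProd (fun p : Nat.Primes => (1 - ((p : ℕ) : ℝ) ^ (-(1 + x)))⁻¹) (Zt x) := by
  let f : ℕ →*₀ ℝ :=
    { toFun := fun n => (n : ℝ) ^ (-(1 + x))
      map_zero' := by
        rw [Nat.cast_zero]; exact Real.zero_rpow (by linarith)
      map_one' := by simp
      map_mul' := fun m n => by
        push_cast; rw [Real.mul_rpow (by positivity) (by positivity)] }
  have hs : Summable (‖f ·‖) := by
    have : Summable fun n : ℕ => (n : ℝ) ^ (-(1 + x)) := Real.summable_nat_rpow.2 (by linarith)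
    exact this.norm
  have := EulerProduct.eulerProduct_completely_multiplicative_hasProd hs
  have e : Zt x = ∑' n, f n := by
    unfold Zt
    refine tsum_congr fun n => ?_
    change _ = (n : ℝ) ^ (-(1 + x))
    rw [Real.rpow_neg (by positivity), one_div]
  rw [e]; exact this

lemma Zt_tendsto {x : ℝ} (hx : 0 < x) :
    Tendsto (fun L : ℝ => L⁻¹ * Zt (x / L)) atTop (𝓝 x⁻¹) := by
  have h := tendsto_sub_mul_tsum_nat_rpow
  have h2 : Tendsto (fun L : ℝ => 1 + x / L) atTop (𝓝[>] 1) := by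
    rw [tendsto_nhdsWithin_iff]
    constructor
    · simpa using tendsto_const_nhds.add (tendsto_const_nhds.div_atTop (tendsto_id (α := ℝ)))
    · filter_upwards [eventually_gt_atTop 0] with L hL
      have : 0 < x / L := by positivity
      simp [this]
  have h3 := (h.comp h2).const_mul x⁻¹
  rw [mul_one] at h3
  refine h3.congr' ?_
  filter_upwards [eventually_gt_atTop 0] with L hL
  simp only [Function.comp, Zt]
  field_simp
  ring_nf

lemma tprod_eq (ε : ℝ) (hε : |ε| ≤ 1) (κ : Fin 3 → ℝ) (hκ : ∀ i, 0 < κ i) :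
    ∏' p, (1 + ∑ c, gterm ε κ p c) = (∏' p, loc ε κ p) * ∏ j, Zt (sdot j κ) := by
  have h1 := (loc_multipliable ε hε κ (fun i => (hκ i).le)).hasProd
  have h2 : HasProd (fun p : Nat.Primes => ∏ j : Fin 6, (1 - ((p : ℕ) : ℝ) ^ (-(1 + sdot j κ)))⁻¹)
      (∏ j, Zt (sdot j κ)) := hasProd_prod fun j _ => Zt_hasProd (sdot_pos j κ hκ)
  rw [← (h1.mul h2).tprod_eq]
  refine tprod_congr fun p => ?_
  unfold loc
  rw [mul_assoc, ← Finset.prod_mul_distrib, Finset.prod_eq_one, mul_one]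
  intro j _
  apply mul_inv_cancel₀
  have := pow_le_inv p κ (fun i => (hκ i).le) j
  linarith [prime_inv_le p]

/-- The value of the regularised Euler product at the origin. -/
noncomputable def Eul (ε : ℝ) : ℝ := ∏' p, loc ε 0 p

noncomputable def Rk (k : Fin 3 → ℝ) : ℝ := ∏ j : Fin 6, (sdot j k)⁻¹

lemma sdot_div (j : Fin 6) (k : Fin 3 → ℝ) (L : ℝ) : sdot j (fun i => k i / L) = sdot j k / L := by
  simp [sdot, Finset.sum_div, mul_div_assoc]

lemma loc_tendsto (ε : ℝ) (hε : |ε| ≤ 1) (k : Fin 3 → ℝ) (hk : ∀ i, 0 < k i) :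
    Tendsto (fun L : ℝ => ∏' p, loc ε (fun i => k i / L) p) atTop (𝓝 (Eul ε)) := by
  have key := tendsto_tprod_one_add_of_dominated_convergence (𝓕 := (atTop : Filter ℝ))
    (f := fun L p => loc ε (fun i => k i / L) p - 1) (g := fun p => loc ε 0 p - 1)
    (summable_prime_sq.mul_left 43) ?_ ?_
  · simpa [Eul] using key
  · intro p
    apply Tendsto.sub_const
    have hk0 : ∀ i, Tendsto (fun L : ℝ => k i / L) atTop (𝓝 0) := fun i =>
      tendsto_const_nhds.div_atTop tendsto_id
    have hv : Tendsto (fun L : ℝ => (fun i => k i / L)) atTop (𝓝 (0 : Fin 3 → ℝ)) :=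
      tendsto_pi_nhds.2 hk0
    have hc : Continuous fun κ => loc ε κ p := by
      have hp : ((p : ℕ) : ℝ) ≠ 0 := by linarith [prime_one_lt p]
      unfold loc gterm cexpo sdot
      have : ∀ f : (Fin 3 → ℝ) → ℝ, Continuous f → Continuous fun κ => ((p : ℕ) : ℝ) ^ (f κ) :=
        fun f hf => Continuous.rpow continuous_const hf (fun _ => Or.inl hp)
      refine Continuous.mul (continuous_const.add (continuous_finsetSum _ fun c _ => ?_))
        (continuous_finsetProd _ fun j _ => ?_)
      · exact continuous_const.mul (this _ (by fun_prop))
      · exact continuous_const.sub (this _ (by fun_prop))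
    exact (hc.tendsto 0).comp hv
  · filter_upwards [eventually_gt_atTop 0] with L hL p
    exact loc_sub_bound ε hε _ (fun i => (div_pos (hk i) hL).le) p

theorem tprod_tendsto (ε : ℝ) (hε : |ε| ≤ 1) (k : Fin 3 → ℝ) (hk : ∀ i, 0 < k i) :
    Tendsto (fun L : ℝ => (L⁻¹) ^ 6 * ∏' p, (1 + ∑ c, gterm ε (fun i => k i / L) p c)) atTop
      (𝓝 (Eul ε * Rk k)) := by
  have h1 := loc_tendsto ε hε k hk
  have h2 : Tendsto (fun L : ℝ => ∏ j : Fin 6, (L⁻¹ * Zt (sdot j k / L))) atTop (𝓝 (Rk k)) :=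
    tendsto_finsetProd _ fun j _ => Zt_tendsto (sdot_pos j k hk)
  refine (h1.mul h2).congr' ?_
  filter_upwards [eventually_gt_atTop 0] with L hL
  rw [tprod_eq ε hε _ (fun i => div_pos (hk i) hL), Finset.prod_mul_distrib]
  simp only [sdot_div, Finset.prod_const, Finset.card_univ, Fintype.card_fin]
  ring

/-- numbers attached to a configuration -/
def anum (ω : Conf) (i : Fin 3) : ℕ := ∏ p : ω.1, ((p : Nat.Primes) : ℕ) ^ cvec (ω.2 p) i

noncomputable def wt (ω : Conf) : ℝ := ∏ p : ω.1, ((((p : Nat.Primes) : ℕ) : ℝ)⁻¹) ^ cdeg (ω.2 p)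

noncomputable def sg (ε : ℝ) (ω : Conf) : ℝ := ∏ p : ω.1, ceps ε (ω.2 p)

noncomputable def ell (ω : Conf) (i : Fin 3) : ℝ := Real.log (anum ω i)

lemma anum_pos (ω : Conf) (i : Fin 3) : 0 < anum ω i :=
  Finset.prod_pos fun p _ => pow_pos p.1.2.pos _

lemma ell_nonneg (ω : Conf) (i : Fin 3) : 0 ≤ ell ω i :=
  Real.log_nonneg (by exact_mod_cast anum_pos ω i)

lemma wt_pos (ω : Conf) : 0 < wt ω :=
  Finset.prod_pos fun p _ => pow_pos (inv_pos.2 (by exact_mod_cast p.1.2.pos)) _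

lemma term_eq (ε : ℝ) (κ : Fin 3 → ℝ) (ω : Conf) :
    sg ε ω * wt ω * Real.exp (-∑ i, κ i * ell ω i) = ∏ p : ω.1, gterm ε κ p (ω.2 p) := by
  have h : Real.exp (-∑ i, κ i * ell ω i) =
      ∏ p : ω.1, ((((p : Nat.Primes) : ℕ) : ℝ)) ^ (-∑ i, (cvec (ω.2 p) i : ℝ) * κ i) := by
    have e : ∀ i, ell ω i =
        ∑ p : ω.1, (cvec (ω.2 p) i : ℝ) * Real.log (((p : Nat.Primes) : ℕ) : ℝ) := by
      intro i
      unfold ell anum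
      push_cast
      rw [Real.log_prod (fun p _ => by
        have := prime_one_lt p.1
        positivity)]
      simp
    simp only [e, Finset.mul_sum]
    rw [Finset.sum_comm, ← Finset.sum_neg_distrib, Real.exp_sum]
    refine Finset.prod_congr rfl fun p _ => ?_
    rw [Real.rpow_def_of_pos (by linarith [prime_one_lt p.1]), mul_neg, Finset.mul_sum]
    congr 2
    exact Finset.sum_congr rfl fun i _ => by ring
  rw [h, sg, wt, ← Finset.prod_mul_distrib, ← Finset.prod_mul_distrib]
  refine Finset.prod_congr rfl fun p _ => ?_
  rw [gterm, cexpo, neg_add, Real.rpow_add (by linarith [prime_one_lt p.1]), mul_assoc,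
    Real.rpow_neg (by positivity) (cdeg (ω.2 p) : ℝ), Real.rpow_natCast, inv_pow]

lemma lap_summable (ε : ℝ) (hε : |ε| ≤ 1) (k : Fin 3 → ℝ) (hk : ∀ i, 0 < k i) {L : ℝ} (hL : 0 < L) :
    Summable fun ω : Conf => |sg ε ω * wt ω * Real.exp (-(∑ i, k i * ell ω i) / L)| := by
  have := conf_summable _ (gterm_summable ε hε (fun i => k i / L) (fun i => div_pos (hk i) hL))
  refine this.congr fun ω => ?_
  rw [← term_eq]
  congr 3
  rw [neg_div, Finset.sum_div]
  congr 1
  exact Finset.sum_congr rfl fun i _ => by ring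

theorem lap_tendsto (ε : ℝ) (hε : |ε| ≤ 1) (k : Fin 3 → ℝ) (hk : ∀ i, 0 < k i) :
    Tendsto (fun L : ℝ => (L⁻¹) ^ 6 *
      ∑' ω : Conf, sg ε ω * wt ω * Real.exp (-(∑ i, k i * ell ω i) / L)) atTop
      (𝓝 (Eul ε * Rk k)) := by
  refine (tprod_tendsto ε hε k hk).congr' ?_
  filter_upwards [eventually_gt_atTop 0] with L hL
  congr 1
  rw [← (conf_hasSum _ (gterm_summable ε hε (fun i => k i / L)
    (fun i => div_pos (hk i) hL))).tsum_eq]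
  refine tsum_congr fun ω => ?_
  rw [← term_eq]
  congr 2
  rw [neg_div, Finset.sum_div]
  congr 1
  exact Finset.sum_congr rfl fun i _ => by ring

end CT

namespace CT

abbrev Cube := Fin 3 → Set.Icc (0 : ℝ) 1

/-- the point `exp(-x)` of the cube -/
noncomputable def ye (x : Fin 3 → ℝ) : Cube := fun i => Set.projIcc 0 1 zero_le_one (Real.exp (-x i))

lemma ye_coe (x : Fin 3 → ℝ) (hx : ∀ i, 0 ≤ x i) (i : Fin 3) : (ye x i : ℝ) = Real.exp (-x i) := by
  have h : Real.exp (-x i) ∈ Set.Icc (0 : ℝ) 1 :=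
    ⟨(Real.exp_pos _).le, Real.exp_le_one_iff.2 (by linarith [hx i])⟩
  simp [ye, Set.projIcc_of_mem zero_le_one h]

lemma ye_continuous : Continuous ye := by
  unfold ye
  refine continuous_pi fun i => continuous_projIcc.comp ?_
  fun_prop

noncomputable def Tf (ψ : C(Cube, ℝ)) (x : Fin 3 → ℝ) : ℝ := Real.exp (-∑ i, x i) * ψ (ye x)

lemma Tf_continuous (ψ : C(Cube, ℝ)) : Continuous (Tf ψ) := by
  unfold Tf
  refine Continuous.mul (by fun_prop) (ψ.continuous.comp ye_continuous)

lemma Tf_bound (ψ : C(Cube, ℝ)) (x : Fin 3 → ℝ) : |Tf ψ x| ≤ Real.exp (-∑ i, x i) * ‖ψ‖ := by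
  unfold Tf
  rw [abs_mul, abs_of_pos (Real.exp_pos _)]
  gcongr
  exact ψ.norm_coe_le_norm _

/-- coordinate function -/
def cY (i : Fin 3) : C(Cube, ℝ) := ⟨fun y => (y i : ℝ), by fun_prop⟩

/-- monomials -/
noncomputable def mono (n : Fin 3 → ℕ) : C(Cube, ℝ) := ∏ i, cY i ^ n i

lemma Tf_mono (n : Fin 3 → ℕ) (x : Fin 3 → ℝ) (hx : ∀ i, 0 ≤ x i) :
    Tf (mono n) x = Real.exp (-∑ i, ((n i : ℝ) + 1) * x i) := by
  have : mono n (ye x) = ∏ i, Real.exp (-x i) ^ n i := by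
    simp [mono, cY, ye_coe x hx, ContinuousMap.coe_prod]
  rw [Tf, this]
  simp only [← Real.exp_nat_mul, ← Real.exp_sum, ← Real.exp_add]
  congr 1
  rw [← Finset.sum_neg_distrib, ← Finset.sum_add_distrib, ← Finset.sum_neg_distrib]
  exact Finset.sum_congr rfl fun i _ => by ring

/-- Density criterion: convergence on monomials implies convergence everywhere. -/
theorem density (Λ : ℝ → C(Cube, ℝ) → ℝ) (D : C(Cube, ℝ) → ℝ) (K : ℝ)
    (hΛadd : ∀ᶠ L in atTop, ∀ f g, Λ L (f + g) = Λ L f + Λ L g)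
    (hΛsmul : ∀ᶠ L in atTop, ∀ (a : ℝ) f, Λ L (a • f) = a * Λ L f)
    (hΛb : ∀ᶠ L in atTop, ∀ f, |Λ L f| ≤ K * ‖f‖)
    (hDadd : ∀ f g, D (f + g) = D f + D g) (hDsmul : ∀ (a : ℝ) f, D (a • f) = a * D f)
    (hDb : ∀ f, |D f| ≤ K * ‖f‖)
    (hmono : ∀ n, Tendsto (fun L => Λ L (mono n)) atTop (𝓝 (D (mono n)))) (ψ : C(Cube, ℝ)) :
    Tendsto (fun L => Λ L ψ) atTop (𝓝 (D ψ)) := by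
  let A : Subalgebra ℝ C(Cube, ℝ) := Algebra.adjoin ℝ (Set.range cY)
  have hsep : A.SeparatesPoints := by
    intro x y hxy
    obtain ⟨i, hi⟩ := Function.ne_iff.1 hxy
    refine ⟨cY i, ⟨cY i, Algebra.subset_adjoin ⟨i, rfl⟩, rfl⟩, ?_⟩
    simpa [cY, Subtype.ext_iff] using hi
  have hcl : ∀ m ∈ Submonoid.closure (Set.range cY), ∃ n, m = mono n := by
    intro m hm
    induction hm using Submonoid.closure_induction with
    | mem x hx =>
      obtain ⟨i, rfl⟩ := hx
      refine ⟨Pi.single i 1, ?_⟩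
      simp only [mono]
      rw [Finset.prod_eq_single i]
      · simp
      · intro j _ hj; simp [Pi.single_eq_of_ne hj]
      · simp
    | one => exact ⟨0, by simp [mono]⟩
    | mul x y _ _ hx hy =>
      obtain ⟨n, rfl⟩ := hx
      obtain ⟨n', rfl⟩ := hy
      exact ⟨n + n', by simp [mono, pow_add, Finset.prod_mul_distrib]⟩
  have hA : ∀ f ∈ A, Tendsto (fun L => Λ L f) atTop (𝓝 (D f)) := by
    intro f hf
    have hf' : f ∈ Submodule.span ℝ (Submonoid.closure (Set.range cY) : Set C(Cube, ℝ)) := by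
      rw [← Algebra.adjoin_eq_span]; exact hf
    induction hf' using Submodule.span_induction with
    | mem x hx =>
      obtain ⟨n, rfl⟩ := hcl x hx
      exact hmono n
    | zero =>
      have h0 : D 0 = 0 := by simpa using hDsmul 0 0
      rw [h0]
      refine tendsto_const_nhds.congr' ?_
      filter_upwards [hΛsmul] with L hL
      simpa using (hL 0 0).symm
    | add x y _ _ hx hy =>
      rw [hDadd]
      have hmem := fun z (hz : z ∈ Submodule.span ℝ
        (Submonoid.closure (Set.range cY) : Set C(Cube, ℝ))) =>
        (show z ∈ A by rw [← Algebra.adjoin_eq_span] at hz; exact hz)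
      refine ((hx (hmem _ ‹_›)).add (hy (hmem _ ‹_›))).congr' ?_
      filter_upwards [hΛadd] with L hL
      exact (hL x y).symm
    | smul a x _ hx =>
      rw [hDsmul]
      have hmem := fun z (hz : z ∈ Submodule.span ℝ
        (Submonoid.closure (Set.range cY) : Set C(Cube, ℝ))) =>
        (show z ∈ A by rw [← Algebra.adjoin_eq_span] at hz; exact hz)
      refine ((hx (hmem _ ‹_›)).const_mul a).congr' ?_
      filter_upwards [hΛsmul] with L hL
      exact (hL a x).symm
  have hK : 0 ≤ K := by
    have := (abs_nonneg _).trans (hDb 1)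
    simpa using this
  have hsub : ∀ f g, D (f - g) = D f - D g := by
    intro f g
    rw [sub_eq_add_neg, hDadd, ← neg_one_smul ℝ g, hDsmul]; ring
  rw [Metric.tendsto_nhds]
  intro δ hδ
  obtain ⟨⟨g, hgA⟩, hg⟩ := ContinuousMap.exists_mem_subalgebra_near_continuousMap_of_separatesPoints
    A hsep ψ (δ / (3 * (K + 1))) (by positivity)
  have hg : ‖g - ψ‖ < δ / (3 * (K + 1)) := hg
  have hKg : K * ‖ψ - g‖ < δ / 3 := by
    rw [norm_sub_rev]
    calc K * ‖g - ψ‖ ≤ (K + 1) * ‖g - ψ‖ := by gcongr; linarith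
      _ < (K + 1) * (δ / (3 * (K + 1))) := by gcongr
      _ = δ / 3 := by field_simp
  filter_upwards [hΛadd, hΛsmul, hΛb, Metric.tendsto_nhds.1 (hA g hgA) (δ / 3) (by positivity)]
    with L h1 h2 h3 h4
  have e1 : Λ L ψ = Λ L (ψ - g) + Λ L g := by rw [← h1]; simp
  have e2 : D ψ = D (ψ - g) + D g := by rw [← hDadd]; simp
  rw [Real.dist_eq] at h4 ⊢
  have a1 := h3 (ψ - g)
  have a2 := hDb (ψ - g)
  rw [abs_le] at a1 a2
  rw [abs_lt] at h4 ⊢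
  constructor <;> linarith [h4.1, h4.2, a1.1, a1.2, a2.1, a2.2]

/-- normalised linear functional -/
noncomputable def Lam (ε L : ℝ) (ψ : C(Cube, ℝ)) : ℝ :=
  (L⁻¹) ^ 6 * ∑' ω : Conf, sg ε ω * wt ω * Tf ψ (fun i => ell ω i / L)

lemma sg_abs {ε : ℝ} (hε : |ε| = 1) (ω : Conf) : |sg ε ω| = 1 := by
  rw [sg, Finset.abs_prod]
  refine Finset.prod_eq_one fun p _ => ?_
  rcases ω.2 p with c | c <;> simp [ceps, hε]

lemma sg_one (ω : Conf) : sg 1 ω = 1 := by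
  rw [sg]
  refine Finset.prod_eq_one fun p _ => ?_
  rcases ω.2 p with c | c <;> simp [ceps]

lemma exp_ell_summable {L : ℝ} (hL : 0 < L) :
    Summable fun ω : Conf => wt ω * Real.exp (-∑ i, ell ω i / L) := by
  have := lap_summable 1 (by simp) (fun _ => 1) (fun _ => one_pos) hL
  refine this.congr fun ω => ?_
  rw [sg_one, abs_of_nonneg (by have := wt_pos ω; positivity)]
  simp [← Finset.sum_div, neg_div]

lemma Lam_summable {ε : ℝ} (hε : |ε| = 1) {L : ℝ} (hL : 0 < L) (ψ : C(Cube, ℝ)) :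
    Summable fun ω : Conf => sg ε ω * wt ω * Tf ψ (fun i => ell ω i / L) := by
  refine ((exp_ell_summable hL).mul_right ‖ψ‖).of_norm_bounded fun ω => ?_
  rw [norm_mul, norm_mul, Real.norm_eq_abs, Real.norm_eq_abs, Real.norm_eq_abs, sg_abs hε,
    abs_of_pos (wt_pos ω), one_mul, mul_assoc]
  have := Tf_bound ψ (fun i => ell ω i / L)
  have := wt_pos ω
  gcongr

lemma Lam_add {ε : ℝ} (hε : |ε| = 1) {L : ℝ} (hL : 0 < L) (f g : C(Cube, ℝ)) :
    Lam ε L (f + g) = Lam ε L f + Lam ε L g := by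
  unfold Lam
  rw [← mul_add, ← (Lam_summable hε hL f).tsum_add (Lam_summable hε hL g)]
  congr 1
  refine tsum_congr fun ω => ?_
  simp [Tf]; ring

lemma Lam_smul (ε L : ℝ) (a : ℝ) (f : C(Cube, ℝ)) : Lam ε L (a • f) = a * Lam ε L f := by
  unfold Lam
  rw [mul_left_comm a, ← tsum_mul_left (a := a)]
  refine congrArg _ (tsum_congr (fun ω : Conf => ?_))
  simp [Tf]; ring

lemma Lam_bound {ε : ℝ} (hε : |ε| = 1) {L : ℝ} (hL : 0 < L) (f : C(Cube, ℝ)) :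
    |Lam ε L f| ≤ Lam 1 L (mono 0) * ‖f‖ := by
  unfold Lam
  rw [abs_mul, abs_of_nonneg (by positivity), mul_assoc, ← tsum_mul_right]
  gcongr
  have h1 := Lam_summable hε hL f
  have h2 := (Lam_summable (ε := 1) (by simp) hL (mono 0)).mul_right ‖f‖
  refine (norm_tsum_le_tsum_norm h1.norm).trans (Summable.tsum_le_tsum (fun ω => ?_) h1.norm h2)
  rw [norm_mul, norm_mul, Real.norm_eq_abs, Real.norm_eq_abs, Real.norm_eq_abs, sg_abs hε,
    abs_of_pos (wt_pos ω), sg_one, mul_assoc, mul_assoc, mul_assoc]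
  have := Tf_bound f (fun i => ell ω i / L)
  have h3 := wt_pos ω
  have : Tf (mono 0) (fun i => ell ω i / L) = Real.exp (-∑ i, ell ω i / L) := by
    rw [Tf_mono _ _ (fun i => div_nonneg (ell_nonneg ω i) hL.le)]; simp
  rw [this]
  gcongr

lemma Lam_mono_tendsto {ε : ℝ} (hε : |ε| = 1) (n : Fin 3 → ℕ) :
    Tendsto (fun L => Lam ε L (mono n)) atTop (𝓝 (Eul ε * Rk (fun i => n i + 1))) := by
  refine (lap_tendsto ε hε.le (fun i => (n i : ℝ) + 1) (fun i => by positivity)).congr' ?_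
  filter_upwards [eventually_gt_atTop 0] with L hL
  unfold Lam
  congr 1
  refine tsum_congr fun ω => ?_
  rw [Tf_mono _ _ (fun i => div_nonneg (ell_nonneg ω i) hL.le), neg_div, Finset.sum_div]
  simp only [mul_div_assoc]

end CT

namespace CT

open MeasureTheory

lemma integral_exp_abs {w : ℝ} (hw : 0 < w) : ∫ x : ℝ, Real.exp (-(w * |x|)) = 2 * w⁻¹ := by
  have h := integral_comp_abs (f := fun x => Real.exp (-(w * x)))
  rw [h]
  congr 1
  have := integral_exp_mul_Ioi (a := -w) (by linarith) 0
  simp only [neg_mul] at this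
  rw [this]; simp [div_eq_mul_inv, inv_neg]

lemma integrable_exp_abs {w : ℝ} (hw : 0 < w) : Integrable fun x : ℝ => Real.exp (-(w * |x|)) :=
  Integrable.of_integral_ne_zero (by rw [integral_exp_abs hw]; positivity)

lemma exp_sum_eq (w : Fin 6 → ℝ) (u : Fin 6 → ℝ) :
    Real.exp (-∑ m, w m * |u m|) = ∏ m, Real.exp (-(w m * |u m|)) := by
  rw [← Real.exp_sum, Finset.sum_neg_distrib]

lemma integrable_exp_six {w : Fin 6 → ℝ} (hw : ∀ m, 0 < w m) :
    Integrable fun u : Fin 6 → ℝ => Real.exp (-∑ m, w m * |u m|) := by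
  simp only [exp_sum_eq]
  exact Integrable.fintype_prod (f := fun m (x : ℝ) => Real.exp (-(w m * |x|)))
    (fun m => integrable_exp_abs (hw m))

lemma integral_exp_six {w : Fin 6 → ℝ} (hw : ∀ m, 0 < w m) :
    ∫ u : Fin 6 → ℝ, Real.exp (-∑ m, w m * |u m|) = 64 * ∏ m, (w m)⁻¹ := by
  simp only [exp_sum_eq]
  rw [integral_fintype_prod_volume_eq_prod (f := fun m (x : ℝ) => Real.exp (-(w m * |x|)))]
  simp only [integral_exp_abs (hw _), Finset.prod_mul_distrib]
  norm_num

lemma volume_simplex {r : ℝ} (hr : 0 ≤ r) :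
    volume.real {u : Fin 6 → ℝ | ∑ m, |u m| ≤ r} = 64 * (r ^ 6 / 720) := by
  have h := volume_sum_rpow_le (ι := Fin 6) (p := 1) le_rfl r
  have e : {u : Fin 6 → ℝ | ∑ m, |u m| ≤ r} =
      {x : Fin 6 → ℝ | (∑ i, |x i| ^ (1 : ℝ)) ^ (1 / (1 : ℝ)) ≤ r} := by
    ext u; simp
  rw [e, measureReal_def, h]
  have g1 : Real.Gamma (1 / 1 + 1) = 1 := by norm_num
  have g2 : Real.Gamma ((Fintype.card (Fin 6) : ℕ) / (1 : ℝ) + 1) = 720 := by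
    have := Real.Gamma_nat_eq_factorial 6
    norm_num [Nat.factorial] at this ⊢
  rw [g1, g2]
  rw [ENNReal.toReal_mul, ENNReal.toReal_pow, ENNReal.toReal_ofReal hr,
    ENNReal.toReal_ofReal (by positivity)]
  simp only [Fintype.card_fin]
  ring

lemma measurable_simplex (r : ℝ) : MeasurableSet {u : Fin 6 → ℝ | ∑ m, |u m| ≤ r} :=
  measurableSet_le (by fun_prop) measurable_const

lemma simplex_finite {r : ℝ} (hr : 0 < r) : volume {u : Fin 6 → ℝ | ∑ m, |u m| ≤ r} ≠ ⊤ := by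
  intro h
  have := volume_simplex hr.le
  rw [measureReal_def, h] at this
  simp at this
  exact hr.ne this.symm

/-- coordinate permutations -/
def PT : Fin 6 → Fin 3 → Fin 3 :=
  ![![0,1,2], ![0,2,1], ![1,0,2], ![1,2,0], ![2,0,1], ![2,1,0]]

/-- generators of the cones, in quarters -/
def G4 : Fin 5 → Fin 6 → Fin 3 → ℕ :=
  ![![![4,4,4], ![4,4,4], ![4,4,4], ![4,4,4], ![4,4,1], ![0,4,2]],
    ![![4,4,4], ![4,4,4], ![4,4,4], ![4,4,4], ![4,4,1], ![4,2,0]],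
    ![![4,4,4], ![4,4,4], ![4,4,4], ![4,4,0], ![4,2,0], ![4,0,2]],
    ![![4,4,4], ![4,4,4], ![4,4,4], ![4,4,0], ![4,4,1], ![4,0,2]],
    ![![4,4,4], ![4,4,4], ![4,4,4], ![4,4,0], ![4,4,1], ![2,4,0]]]

noncomputable def qj : Fin 5 → ℝ := ![1/96, 1/192, 1/96, 1/96, 1/192]

lemma qj_nonneg (j : Fin 5) : 0 ≤ qj j := by fin_cases j <;> simp [qj]

lemma qj_sum : ∑ _π : Fin 6, ∑ j, qj j = 1 / 4 := by
  simp [qj, Fin.sum_univ_five]; norm_num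

lemma G4_le (j : Fin 5) (m : Fin 6) (i : Fin 3) : G4 j m i ≤ 4 := by
  revert j m i; decide

lemma G4_top (π : Fin 6) (j : Fin 5) : ∃ i, ∀ m, G4 j m (PT π i) = 4 := by
  revert π j; decide

/-- point of the cone -/
noncomputable def Gx (π : Fin 6) (j : Fin 5) (u : Fin 6 → ℝ) (i : Fin 3) : ℝ :=
  ∑ m, |u m| * ((G4 j m (PT π i) : ℝ) / 4)

lemma Gx_nonneg (π : Fin 6) (j : Fin 5) (u : Fin 6 → ℝ) (i : Fin 3) : 0 ≤ Gx π j u i :=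
  Finset.sum_nonneg fun m _ => by positivity

lemma Gx_continuous (π : Fin 6) (j : Fin 5) : Continuous (Gx π j) := by
  unfold Gx; fun_prop

lemma Gx_le_iff (π : Fin 6) (j : Fin 5) (u : Fin 6 → ℝ) (r : ℝ) :
    (∀ i, Gx π j u i ≤ r) ↔ ∑ m, |u m| ≤ r := by
  constructor
  · intro h
    obtain ⟨i, hi⟩ := G4_top π j
    refine le_trans (le_of_eq ?_) (h i)
    simp [Gx, hi]
  · intro h i
    refine le_trans (Finset.sum_le_sum fun m _ => ?_) h
    have : (G4 j m (PT π i) : ℝ) ≤ 4 := by exact_mod_cast G4_le j m _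
    have h2 := abs_nonneg (u m)
    nlinarith

noncomputable def wgt (π : Fin 6) (j : Fin 5) (k : Fin 3 → ℝ) (m : Fin 6) : ℝ :=
  ∑ i, k i * ((G4 j m (PT π i) : ℝ) / 4)

lemma wgt_pos (π : Fin 6) (j : Fin 5) (k : Fin 3 → ℝ) (hk : ∀ i, 0 < k i) (m : Fin 6) :
    0 < wgt π j k m := by
  obtain ⟨i, hi⟩ := G4_top π j
  refine Finset.sum_pos' (fun i _ => mul_nonneg (hk i).le (by positivity)) ⟨i, Finset.mem_univ _, ?_⟩
  rw [hi]
  have := hk i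
  positivity

lemma wgt_eq (π : Fin 6) (j : Fin 5) (k : Fin 3 → ℝ) (u : Fin 6 → ℝ) :
    ∑ i, k i * Gx π j u i = ∑ m, wgt π j k m * |u m| := by
  simp only [Gx, wgt, Finset.mul_sum, Finset.sum_mul]
  rw [Finset.sum_comm]
  exact Finset.sum_congr rfl fun m _ => Finset.sum_congr rfl fun i _ => by ring

lemma Tf_Gx_integrable (ψ : C(Cube, ℝ)) (π : Fin 6) (j : Fin 5) :
    Integrable fun u => Tf ψ (Gx π j u) := by
  refine ((integrable_exp_six (wgt_pos π j (fun _ => 1) (fun _ => one_pos))).mul_const ‖ψ‖).mono'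
    ((Tf_continuous ψ).comp (Gx_continuous π j)).aestronglyMeasurable ?_
  filter_upwards with u
  have := Tf_bound ψ (Gx π j u)
  have e := wgt_eq π j (fun _ => 1) u
  simp only [one_mul] at e
  rw [← e]
  exact this

/-- The limit functional. -/
noncomputable def Dl (ψ : C(Cube, ℝ)) : ℝ :=
  ∑ π, ∑ j, qj j / 64 * ∫ u, Tf ψ (Gx π j u)

lemma Dl_add (f g : C(Cube, ℝ)) : Dl (f + g) = Dl f + Dl g := by
  unfold Dl
  simp only [← Finset.sum_add_distrib]
  refine Finset.sum_congr rfl fun π _ => Finset.sum_congr rfl fun j _ => ?_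
  rw [← mul_add, ← integral_add (Tf_Gx_integrable f π j) (Tf_Gx_integrable g π j)]
  congr 1
  refine integral_congr_ae (Eventually.of_forall fun u => ?_)
  simp [Tf, mul_add]

lemma Dl_smul (a : ℝ) (f : C(Cube, ℝ)) : Dl (a • f) = a * Dl f := by
  unfold Dl
  simp only [Finset.mul_sum]
  refine Finset.sum_congr rfl fun π _ => Finset.sum_congr rfl fun j _ => ?_
  rw [mul_left_comm, ← integral_const_mul a]
  refine congrArg _ (integral_congr_ae (Eventually.of_forall fun u => ?_))
  simp [Tf]; ring

lemma Dl_bound : ∃ K, ∀ f : C(Cube, ℝ), |Dl f| ≤ K * ‖f‖ := by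
  refine ⟨∑ π, ∑ j, qj j / 64 *
    ∫ u : Fin 6 → ℝ, Real.exp (-∑ m, wgt π j (fun _ => 1) m * |u m|), fun f => ?_⟩
  unfold Dl
  rw [Finset.sum_mul]
  refine (Finset.abs_sum_le_sum_abs _ _).trans (Finset.sum_le_sum fun π _ => ?_)
  rw [Finset.sum_mul]
  refine (Finset.abs_sum_le_sum_abs _ _).trans (Finset.sum_le_sum fun j _ => ?_)
  have hq := qj_nonneg j
  rw [abs_mul, abs_of_nonneg (by positivity), mul_assoc]
  gcongr
  rw [← integral_mul_const]
  refine (abs_integral_le_integral_abs).trans (integral_mono (Tf_Gx_integrable f π j).abs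
    ((integrable_exp_six (wgt_pos π j (fun _ => 1) (fun _ => one_pos))).mul_const ‖f‖) fun u => ?_)
  have := Tf_bound f (Gx π j u)
  have e := wgt_eq π j (fun _ => 1) u
  simp only [one_mul] at e
  simp only [← e]
  exact this

lemma Dl_le {ψ : C(Cube, ℝ)} {r : ℝ} (hr : 0 < r)
    (h1 : ∀ x, (∀ i, 0 ≤ x i) → Tf ψ x ≤ 1)
    (h2 : ∀ x, (∀ i, 0 ≤ x i) → ¬ (∀ i, x i ≤ r) → Tf ψ x ≤ 0) : Dl ψ ≤ r ^ 6 / 2880 := by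
  have key : ∀ π j, ∫ u, Tf ψ (Gx π j u) ≤ 64 * (r ^ 6 / 720) := by
    intro π j
    rw [← volume_simplex hr.le, ← integral_indicator_one (measurable_simplex r)]
    refine integral_mono (Tf_Gx_integrable ψ π j)
      ((integrable_indicator_iff (measurable_simplex r)).2
        (integrableOn_const (simplex_finite hr))) fun u => ?_
    by_cases hu : ∑ m, |u m| ≤ r
    · rw [Set.indicator_of_mem (by exact hu)]
      exact h1 _ (Gx_nonneg π j u)
    · rw [Set.indicator_of_notMem (by exact hu)]
      exact h2 _ (Gx_nonneg π j u) (by rw [Gx_le_iff]; exact hu)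
  calc Dl ψ ≤ ∑ π : Fin 6, ∑ j, qj j / 64 * (64 * (r ^ 6 / 720)) := by
        refine Finset.sum_le_sum fun π _ => Finset.sum_le_sum fun j _ => ?_
        have := key π j
        have := qj_nonneg j
        gcongr
    _ = (∑ _π : Fin 6, ∑ j, qj j) * (r ^ 6 / 720) := by
        simp only [Finset.sum_mul]
        refine Finset.sum_congr rfl fun π _ => Finset.sum_congr rfl fun j _ => by ring
    _ = _ := by rw [qj_sum]; ring

lemma le_Dl {ψ : C(Cube, ℝ)} {r : ℝ} (hr : 0 < r)
    (h1 : ∀ x, (∀ i, 0 ≤ x i) → 0 ≤ Tf ψ x)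
    (h2 : ∀ x, (∀ i, 0 ≤ x i) → (∀ i, x i ≤ r) → 1 ≤ Tf ψ x) : r ^ 6 / 2880 ≤ Dl ψ := by
  have key : ∀ π j, 64 * (r ^ 6 / 720) ≤ ∫ u, Tf ψ (Gx π j u) := by
    intro π j
    rw [← volume_simplex hr.le, ← integral_indicator_one (measurable_simplex r)]
    refine integral_mono 
      ((integrable_indicator_iff (measurable_simplex r)).2
        (integrableOn_const (simplex_finite hr))) (Tf_Gx_integrable ψ π j) fun u => ?_
    by_cases hu : ∑ m, |u m| ≤ r
    · rw [Set.indicator_of_mem (by exact hu)]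
      exact h2 _ (Gx_nonneg π j u) (by rw [Gx_le_iff]; exact hu)
    · rw [Set.indicator_of_notMem (by exact hu)]
      exact h1 _ (Gx_nonneg π j u)
  calc Dl ψ ≥ ∑ π : Fin 6, ∑ j, qj j / 64 * (64 * (r ^ 6 / 720)) := by
        refine Finset.sum_le_sum fun π _ => Finset.sum_le_sum fun j _ => ?_
        have := key π j
        have := qj_nonneg j
        gcongr
    _ = (∑ _π : Fin 6, ∑ j, qj j) * (r ^ 6 / 720) := by
        simp only [Finset.sum_mul]
        refine Finset.sum_congr rfl fun π _ => Finset.sum_congr rfl fun j _ => by ring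
    _ = _ := by rw [qj_sum]; ring

noncomputable def R5 (a b c : ℝ) : ℝ :=
  1 / (24 * (a + b + c) ^ 4 * (2 * a + b) * (2 * b + c)) +
    1 / (8 * (a + b + c) ^ 3 * (a + 2 * b) * (2 * a + b) * (2 * a + c))

lemma R5_eq {a b c : ℝ} (ha : 0 < a) (hb : 0 < b) (hc : 0 < c) :
    1/96 * ((a+b+c)⁻¹ ^ 4 * (a+b+c/4)⁻¹ * (b+c/2)⁻¹) +
    1/192 * ((a+b+c)⁻¹ ^ 4 * (a+b+c/4)⁻¹ * (a+b/2)⁻¹) +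
    1/96 * ((a+b+c)⁻¹ ^ 3 * (a+b)⁻¹ * (a+b/2)⁻¹ * (a+c/2)⁻¹) +
    1/96 * ((a+b+c)⁻¹ ^ 3 * (a+b)⁻¹ * (a+b+c/4)⁻¹ * (a+c/2)⁻¹) +
    1/192 * ((a+b+c)⁻¹ ^ 3 * (a+b)⁻¹ * (a+b+c/4)⁻¹ * (a/2+b)⁻¹) = R5 a b c := by
  have e1 : a+b+c/4 = (4*a+4*b+c)/4 := by ring
  have e2 : b+c/2 = (2*b+c)/2 := by ring
  have e3 : a+b/2 = (2*a+b)/2 := by ring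
  have e4 : a+c/2 = (2*a+c)/2 := by ring
  have e5 : a/2+b = (a+2*b)/2 := by ring
  rw [e1, e2, e3, e4, e5, R5]
  field_simp
  ring

lemma R5_sum {a b c : ℝ} (ha : 0 < a) (hb : 0 < b) (hc : 0 < c) :
    R5 a b c + R5 a c b + R5 b a c + R5 b c a + R5 c a b + R5 c b a =
    (2 * a + b)⁻¹ * (2 * a + c)⁻¹ * (a + 2 * b)⁻¹ * (a + 2 * c)⁻¹ * (2 * b + c)⁻¹ *
      (b + 2 * c)⁻¹ := by
  have e1 : b + a + c = a + b + c := by ring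
  have e2 : a + c + b = a + b + c := by ring
  have e3 : b + c + a = a + b + c := by ring
  have e4 : c + a + b = a + b + c := by ring
  have e5 : c + b + a = a + b + c := by ring
  have f1 : 2 * b + a = a + 2 * b := by ring
  have f2 : 2 * c + a = a + 2 * c := by ring
  have f3 : 2 * c + b = b + 2 * c := by ring
  have f4 : c + 2 * a = 2 * a + c := by ring
  have f5 : b + 2 * a = 2 * a + b := by ring
  have f6 : c + 2 * b = 2 * b + c := by ring
  unfold R5
  simp only [e1, e2, e3, e4, e5, f1, f2, f3, f4, f5, f6]
  field_simp
  ring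

lemma Dl_mono (n : Fin 3 → ℕ) : Dl (mono n) = Rk (fun i => (n i : ℝ) + 1) := by
  set k : Fin 3 → ℝ := fun i => (n i : ℝ) + 1 with hk
  have hkp : ∀ i, 0 < k i := fun i => by simp only [hk]; positivity
  have h1 : ∀ π j, ∫ u, Tf (mono n) (Gx π j u) = 64 * ∏ m, (wgt π j k m)⁻¹ := by
    intro π j
    rw [← integral_exp_six (wgt_pos π j k hkp)]
    refine integral_congr_ae (Eventually.of_forall fun u => ?_)
    simp only
    rw [Tf_mono _ _ (Gx_nonneg π j u), ← wgt_eq]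
  have h2 : Dl (mono n) = ∑ π, ∑ j, qj j * ∏ m, (wgt π j k m)⁻¹ := by
    unfold Dl
    refine Finset.sum_congr rfl fun π _ => Finset.sum_congr rfl fun j _ => ?_
    rw [h1]; ring
  have ha := hkp 0
  have hb := hkp 1
  have hc := hkp 2
  have h3 : Rk k = (2 * k 0 + k 1)⁻¹ * (2 * k 0 + k 2)⁻¹ * (k 0 + 2 * k 1)⁻¹ *
      (k 0 + 2 * k 2)⁻¹ * (2 * k 1 + k 2)⁻¹ * (k 1 + 2 * k 2)⁻¹ := by
    simp [Rk, sdot, csv, Fin.prod_univ_six, Fin.sum_univ_three]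
    ring
  have h4 : ∀ π, ∑ j, qj j * ∏ m, (wgt π j k m)⁻¹ =
      ![R5 (k 0) (k 1) (k 2), R5 (k 0) (k 2) (k 1), R5 (k 1) (k 0) (k 2), R5 (k 2) (k 0) (k 1),
        R5 (k 1) (k 2) (k 0), R5 (k 2) (k 1) (k 0)] π := by
    have w0 : ∀ (g : Fin 3 → ℕ) (π : Fin 6), ∑ i, k i * ((g (PT π i) : ℝ) / 4) =
      (![k 0, k 0, k 1, k 2, k 1, k 2] π * g 0 + ![k 1, k 2, k 0, k 0, k 2, k 1] π * g 1
        + ![k 2, k 1, k 2, k 1, k 0, k 0] π * g 2) / 4 := by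
      intro g π
      fin_cases π <;> simp [PT, Fin.sum_univ_three] <;> ring
    have w1 : ∀ π, ∑ j, qj j * ∏ m, (wgt π j k m)⁻¹ =
        R5 (![k 0, k 0, k 1, k 2, k 1, k 2] π) (![k 1, k 2, k 0, k 0, k 2, k 1] π)
          (![k 2, k 1, k 2, k 1, k 0, k 0] π) := by
      intro π
      simp only [wgt, w0]
      have p0 : 0 < ![k 0, k 0, k 1, k 2, k 1, k 2] π := by fin_cases π <;> assumption
      have p1 : 0 < ![k 1, k 2, k 0, k 0, k 2, k 1] π := by fin_cases π <;> assumption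
      have p2 : 0 < ![k 2, k 1, k 2, k 1, k 0, k 0] π := by fin_cases π <;> assumption
      generalize ![k 0, k 0, k 1, k 2, k 1, k 2] π = a at *
      generalize ![k 1, k 2, k 0, k 0, k 2, k 1] π = b at *
      generalize ![k 2, k 1, k 2, k 1, k 0, k 0] π = c at *
      rw [← R5_eq p0 p1 p2]
      have e1 : (a * 4 + b * 4 + c * 4) / 4 = a + b + c := by ring
      have e2 : (a * 4 + b * 4 + c) / 4 = a + b + c / 4 := by ring
      have e3 : (b * 4 + c * 2) / 4 = b + c / 2 := by ring
      have e4 : (a * 4 + b * 2) / 4 = a + b / 2 := by ring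
      have e5 : (a * 4 + b * 4) / 4 = a + b := by ring
      have e6 : (a * 4 + c * 2) / 4 = a + c / 2 := by ring
      have e7 : (a * 2 + b * 4) / 4 = a / 2 + b := by ring
      simp only [Fin.sum_univ_five, Fin.prod_univ_six, G4, qj, Matrix.cons_val, Nat.cast_ofNat,
        Nat.cast_zero, Nat.cast_one, mul_zero, mul_one, add_zero, zero_add, e1, e2, e3, e4, e5,
        e6, e7]
      ring
    intro π
    rw [w1]
    fin_cases π <;> rfl
  rw [h2, h3, ← R5_sum ha hb hc]
  simp only [h4, Fin.sum_univ_six, Matrix.cons_val]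
  ring

lemma Lam_tendsto {ε : ℝ} (hε : |ε| = 1) (ψ : C(Cube, ℝ)) :
    Tendsto (fun L => Lam ε L ψ) atTop (𝓝 (Eul ε * Dl ψ)) := by
  obtain ⟨K, hK⟩ := Dl_bound
  have hK0 : 0 ≤ K := by
    have := (abs_nonneg _).trans (hK 1)
    simpa using this
  have h1 := Lam_mono_tendsto (ε := 1) (by simp) 0
  set M := Eul 1 * Rk (fun i => (((0 : Fin 3 → ℕ) i : ℕ) : ℝ) + 1) with hM
  have hb : ∀ᶠ L in atTop, ∀ f, |Lam ε L f| ≤ max (M + 1) (|Eul ε| * K) * ‖f‖ := by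
    filter_upwards [h1.eventually (gt_mem_nhds (lt_add_one M)), eventually_gt_atTop 0]
      with L h2 h3 f
    refine (Lam_bound hε h3 f).trans ?_
    gcongr
    exact h2.le.trans (le_max_left _ _)
  refine density (Lam ε) (fun f => Eul ε * Dl f) (max (M + 1) (|Eul ε| * K)) ?_ ?_ hb ?_ ?_ ?_ ?_ ψ
  · filter_upwards [eventually_gt_atTop 0] with L hL f g
    exact Lam_add hε hL f g
  · exact Eventually.of_forall fun L a f => Lam_smul ε L a f
  · intro f g; rw [Dl_add, mul_add]
  · intro a f; rw [Dl_smul]; ring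
  · intro f
    rw [abs_mul]
    calc |Eul ε| * |Dl f| ≤ |Eul ε| * (K * ‖f‖) := by gcongr; exact hK f
      _ = (|Eul ε| * K) * ‖f‖ := by ring
      _ ≤ _ := by gcongr; exact le_max_right _ _
  · intro n
    rw [Dl_mono]
    exact Lam_mono_tendsto hε n

end CT

namespace CT

open Classical in
/-- real indicator of a proposition -/
noncomputable def ind (P : Prop) : ℝ := if P then 1 else 0

lemma ind_true {P : Prop} (h : P) : ind P = 1 := by simp [ind, h]
lemma ind_false {P : Prop} (h : ¬ P) : ind P = 0 := by simp [ind, h]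
lemma ind_congr {P Q : Prop} (h : P ↔ Q) : ind P = ind Q := by rw [propext h]
lemma ind_nonneg (P : Prop) : 0 ≤ ind P := by unfold ind; split_ifs <;> norm_num

lemma ind_and (P Q : Prop) : ind (P ∧ Q) = ind P * ind Q := by
  by_cases hP : P <;> by_cases hQ : Q <;> simp [ind, hP, hQ]

lemma ind_ball {ι : Type*} (s : Finset ι) (P : ι → Prop) :
    ind (∀ i ∈ s, P i) = ∏ i ∈ s, ind (P i) := by
  by_cases h : ∀ i ∈ s, P i
  · rw [ind_true h, Finset.prod_eq_one fun i hi => ind_true (h i hi)]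
  · rw [ind_false h]
    push Not at h
    obtain ⟨i, hi, hP⟩ := h
    rw [Finset.prod_eq_zero hi (ind_false hP)]

lemma ind_all {ι : Type*} [Fintype ι] (P : ι → Prop) : ind (∀ i, P i) = ∏ i, ind (P i) := by
  rw [← ind_ball]; simp

lemma cube_iff {n : ℕ} (hn : n ≠ 0) :
    (∃ x, x ^ 3 = n) ↔ ∀ p : Nat.Primes, 3 ∣ n.factorization p := by
  constructor
  · rintro ⟨x, rfl⟩ p
    rw [Nat.factorization_pow]
    exact ⟨_, rfl⟩
  · intro h
    refine ⟨n.factorization.prod fun p k => p ^ (k / 3), ?_⟩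
    conv_rhs => rw [← Nat.prod_factorization_pow_eq_self hn]
    rw [Finsupp.prod, Finsupp.prod, ← Finset.prod_pow]
    refine Finset.prod_congr rfl fun p hp => ?_
    have hp' : p.Prime := Nat.prime_of_mem_primeFactors hp
    rw [← pow_mul, Nat.div_mul_cancel (h ⟨p, hp'⟩)]

lemma cube_mul_iff {m a : ℕ} (hm : m ≠ 0) (ha : a ≠ 0) :
    (∃ x, 0 < x ∧ x ^ 3 * m = a) ↔
      ∀ p : Nat.Primes, m.factorization p ≤ a.factorization p ∧
        3 ∣ a.factorization p - m.factorization p := by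
  constructor
  · rintro ⟨x, hx, rfl⟩ p
    rw [Nat.factorization_mul (by positivity) hm, Nat.factorization_pow]
    simp
  · intro h
    have hd : m ∣ a := by
      rw [← Nat.factorization_le_iff_dvd hm ha]
      intro p
      by_cases hp : p.Prime
      · exact (h ⟨p, hp⟩).1
      · simp [Nat.factorization_eq_zero_of_not_prime _ hp]
    obtain ⟨b, rfl⟩ := hd
    have hb : b ≠ 0 := by rintro rfl; simp at ha
    obtain ⟨x, rfl⟩ := (cube_iff hb).2 fun p => by
      have := (h p).2
      rw [Nat.factorization_mul hm hb] at this
      simpa using this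
    exact ⟨x, Nat.pos_of_ne_zero fun h => hb (by simp [h]), by ring⟩

lemma anum_fact (ω : Conf) (i : Fin 3) (p : Nat.Primes) :
    (anum ω i).factorization p = if h : p ∈ ω.1 then cvec (ω.2 ⟨p, h⟩) i else 0 := by
  unfold anum
  rw [Nat.factorization_prod fun q _ => pow_ne_zero _ q.1.2.ne_zero]
  have hf : ∀ q : ω.1, ((((q : Nat.Primes) : ℕ) ^ cvec (ω.2 q) i).factorization : ℕ →₀ ℕ) p =
      if ((q : Nat.Primes) : ℕ) = (p : ℕ) then cvec (ω.2 q) i else 0 := by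
    intro q
    rw [Nat.Prime.factorization_pow q.1.2, Finsupp.single_apply]
  rw [Finsupp.finsetSum_apply, Finset.sum_congr rfl fun q _ => hf q]
  split_ifs with h
  · rw [Finset.sum_eq_single ⟨p, h⟩]
    · simp
    · intro q _ hq
      rw [if_neg]
      intro h'
      exact hq (Subtype.ext (Nat.Primes.coe_nat_injective h'))
    · simp
  · refine Finset.sum_eq_zero fun q _ => ?_
    rw [if_neg]
    intro h'
    exact h (by rw [← show q.1 = p from Nat.Primes.coe_nat_injective h']; exact q.2)

/-- local match condition -/
def lm (v α : ℕ) : Prop := v ≤ α ∧ 3 ∣ α - v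

instance (v α : ℕ) : Decidable (lm v α) := by unfold lm; infer_instance

def red (α : ℕ) : Fin 6 := if h : α < 6 then ⟨α, h⟩ else ⟨3 + α % 3, by omega⟩

lemma lm_red (v α : ℕ) (hv : v ≤ 3) : lm v α ↔ lm v (red α) := by
  unfold lm red
  split_ifs with h
  · rfl
  · simp only; omega

def cepsZ : Col → ℤ := Sum.elim (fun _ => 1) (fun _ => -1)

lemma cvec_le (c : Col) (i : Fin 3) : cvec c i ≤ 3 := by revert c i; decide

lemma local_table : ∀ a b d : Fin 6,
    (∑ c : Col, cepsZ c * (if lm (cvec c 0) a ∧ lm (cvec c 1) b ∧ lm (cvec c 2) d then 1 else 0)) +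
      (if lm 0 a ∧ lm 0 b ∧ lm 0 d then 1 else 0) =
    if ((a : ℕ) = 0 ∨ (b : ℕ) = 0 ∨ (d : ℕ) = 0) ∧ 3 ∣ (a : ℕ) + b + d then 1 else 0 := by
  decide +kernel

lemma red_zero (α : ℕ) : ((red α : Fin 6) : ℕ) = 0 ↔ α = 0 := by
  unfold red; split_ifs with h
  · rfl
  · simp only; omega

lemma red_mod (α : ℕ) : ((red α : Fin 6) : ℕ) % 3 = α % 3 := by
  unfold red; split_ifs with h
  · rfl
  · simp only; omega

lemma local_identity (α : Fin 3 → ℕ) :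
    (∑ c : Col, ceps (-1) c * ∏ i, ind (lm (cvec c i) (α i))) + ∏ i, ind (lm 0 (α i)) =
    ind ((∃ i, α i = 0) ∧ 3 ∣ ∑ i, α i) := by
  have h := local_table (red (α 0)) (red (α 1)) (red (α 2))
  have e1 : ∀ c, (∏ i, ind (lm (cvec c i) (α i))) =
      ((if lm (cvec c 0) (red (α 0)) ∧ lm (cvec c 1) (red (α 1)) ∧ lm (cvec c 2) (red (α 2))
        then 1 else 0 : ℤ) : ℝ) := by
    intro c
    rw [← ind_all, Fin.forall_fin_succ, Fin.forall_fin_two, ind]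
    simp only [← lm_red _ _ (cvec_le c _)]
    push_cast
    congr
  have e0 : (∏ i, ind (lm 0 (α i))) =
      ((if lm 0 (red (α 0)) ∧ lm 0 (red (α 1)) ∧ lm 0 (red (α 2))
        then 1 else 0 : ℤ) : ℝ) := by
    rw [← ind_all, Fin.forall_fin_succ, Fin.forall_fin_two, ind]
    simp only [← lm_red _ _ (Nat.zero_le 3)]
    push_cast
    congr
  have e2 : ∀ c, ceps (-1) c = (cepsZ c : ℝ) := by
    intro c; rcases c with c | c <;> simp [ceps, cepsZ]
  have e3 : ind ((∃ i, α i = 0) ∧ 3 ∣ ∑ i, α i) =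
      ((if (((red (α 0) : Fin 6) : ℕ) = 0 ∨ ((red (α 1) : Fin 6) : ℕ) = 0 ∨
        ((red (α 2) : Fin 6) : ℕ) = 0) ∧
        3 ∣ ((red (α 0) : Fin 6) : ℕ) + (red (α 1) : Fin 6) + (red (α 2) : Fin 6)
        then 1 else 0 : ℤ) : ℝ) := by
    have : (3 ∣ ((red (α 0) : Fin 6) : ℕ) + (red (α 1) : Fin 6) + (red (α 2) : Fin 6)) ↔
        3 ∣ ∑ i, α i := by
      rw [Fin.sum_univ_three]
      have h0 := red_mod (α 0)
      have h1 := red_mod (α 1)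
      have h2 := red_mod (α 2)
      omega
    simp only [this, red_zero]
    rw [ind, Fin.exists_fin_succ, Fin.exists_fin_two]
    push_cast
    congr
  simp only [e1, e0, e2, e3]
  rw [← h]
  push_cast
  rfl

/-- primitive triples with cube product -/
def Good (a : Fin 3 → ℕ) : Prop := (∀ p : Nat.Primes, ∃ i, ¬ (p : ℕ) ∣ a i) ∧ ∃ u, u ^ 3 = ∏ i, a i

lemma Good_iff (a : Fin 3 → ℕ) (ha : ∀ i, 0 < a i) :
    Good a ↔ ∀ p : Nat.Primes, (∃ i, (a i).factorization p = 0) ∧ 3 ∣ ∑ i, (a i).factorization p := by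
  unfold Good
  rw [cube_iff (Finset.prod_ne_zero_iff.2 fun i _ => (ha i).ne'),
    Nat.factorization_prod fun i _ => (ha i).ne', forall_and]
  refine and_congr (forall_congr' fun p => exists_congr fun i => ?_) (by simp)
  rw [Nat.factorization_eq_zero_iff]
  have := p.2
  have := (ha i).ne'
  tauto

/-- primes dividing one of the entries -/
noncomputable def PP (a : Fin 3 → ℕ) : Finset Nat.Primes :=
  (∏ i, a i).primeFactors.subtype _

lemma PP_fact (a : Fin 3 → ℕ) (ha : ∀ i, 0 < a i) (p : Nat.Primes) (hp : p ∉ PP a) (i : Fin 3) :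
    (a i).factorization p = 0 := by
  rw [Nat.factorization_eq_zero_iff]
  right; left
  intro h
  apply hp
  refine Finset.mem_subtype.2 (Nat.mem_primeFactors.2 ?_)
  exact ⟨p.2, h.trans (Finset.dvd_prod_of_mem _ (Finset.mem_univ i)),
    Finset.prod_ne_zero_iff.2 fun i _ => (ha i).ne'⟩

lemma cvec_ne (c : Col) : ∃ i, cvec c i ≠ 0 := by revert c; decide

lemma match_eq (a : Fin 3 → ℕ) (ha : ∀ i, 0 < a i) (ω : Conf) :
    ∏ i, ind (∃ x, 0 < x ∧ x ^ 3 * anum ω i = a i) =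
      ind (∀ p : Nat.Primes, ∀ i, lm ((anum ω i).factorization p) ((a i).factorization p)) := by
  rw [← ind_all]
  refine ind_congr ?_
  rw [forall_comm]
  exact forall_congr' fun i => cube_mul_iff (anum_pos ω i).ne' (ha i).ne'

lemma match_zero (a : Fin 3 → ℕ) (ha : ∀ i, 0 < a i) (ω : Conf) (hω : ¬ ω.1 ⊆ PP a) :
    ∏ i, ind (∃ x, 0 < x ∧ x ^ 3 * anum ω i = a i) = 0 := by
  rw [match_eq a ha, ind_false]
  intro h
  apply hω
  intro p hp
  by_contra hP
  obtain ⟨i, hi⟩ := cvec_ne (ω.2 ⟨p, hp⟩)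
  have := (h p i).1
  rw [anum_fact, dif_pos hp, PP_fact a ha p hP] at this
  omega

lemma match_prod (a : Fin 3 → ℕ) (ha : ∀ i, 0 < a i) (ω : Conf) (hω : ω.1 ⊆ PP a) :
    ∏ i, ind (∃ x, 0 < x ∧ x ^ 3 * anum ω i = a i) =
      (∏ p : ω.1, ∏ i, ind (lm (cvec (ω.2 p) i) ((a i).factorization p))) *
        ∏ p ∈ PP a \ ω.1, ∏ i, ind (lm 0 ((a i).factorization p)) := by
  rw [match_eq a ha]
  simp only [← ind_all]
  rw [← ind_ball, ← ind_and]
  refine ind_congr ⟨fun h => ⟨fun p i => ?_, fun p hp i => ?_⟩, fun h p i => ?_⟩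
  · have := h p i
    rwa [anum_fact, dif_pos p.2] at this
  · have := h p i
    rwa [anum_fact, dif_neg (Finset.mem_sdiff.1 hp).2] at this
  · rw [anum_fact]
    split_ifs with hp
    · exact h.1 ⟨p, hp⟩ i
    · by_cases hP : p ∈ PP a
      · exact h.2 p (Finset.mem_sdiff.2 ⟨hP, hp⟩) i
      · rw [PP_fact a ha p hP]; simp [lm]

lemma good_hasSum (a : Fin 3 → ℕ) (ha : ∀ i, 0 < a i) :
    HasSum (fun ω : Conf => sg (-1) ω * ∏ i, ind (∃ x, 0 < x ∧ x ^ 3 * anum ω i = a i))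
      (ind (Good a)) := by
  classical
  have h1 : ind (Good a) = ∑ ω ∈ (PP a).powerset.sigma
      (fun s => (Finset.univ : Finset (s → Col))),
      sg (-1) ω * ∏ i, ind (∃ x, 0 < x ∧ x ^ 3 * anum ω i = a i) := by
    have e1 : ind (Good a) = ∏ p ∈ PP a, ((∑ c : Col, ceps (-1) c *
        ∏ i, ind (lm (cvec c i) ((a i).factorization p))) +
        ∏ i, ind (lm 0 ((a i).factorization p))) := by
      simp only [local_identity (fun i => (a i).factorization _)]
      rw [← ind_ball]
      refine ind_congr ((Good_iff a ha).trans ⟨fun h p _ => h p, fun h p => ?_⟩)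
      by_cases hP : p ∈ PP a
      · exact h p hP
      · simp [PP_fact a ha p hP]
    rw [e1, Finset.prod_add, Finset.sum_sigma]
    refine Finset.sum_congr rfl fun s hs => ?_
    rw [Finset.mem_powerset] at hs
    rw [← conf_fiber (fun p c => ceps (-1) c * ∏ i, ind (lm (cvec c i) ((a i).factorization p))),
      Finset.sum_mul]
    refine Finset.sum_congr rfl fun f _ => ?_
    rw [match_prod a ha ⟨s, f⟩ hs, sg, ← mul_assoc, ← Finset.prod_mul_distrib]
  rw [h1]
  refine hasSum_sum_of_ne_finset_zero fun ω hω => ?_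
  rw [match_zero a ha ω, mul_zero]
  intro h
  exact hω (Finset.mem_sigma.2 ⟨Finset.mem_powerset.2 h, Finset.mem_univ _⟩)

/-- Number of good triples. -/
noncomputable def Npl (B : ℝ) : ℝ :=
  ∑ a ∈ Fintype.piFinset (fun _ : Fin 3 => Finset.Icc 1 ⌊B⌋₊), ind (Good a)

noncomputable def XX (B : ℝ) (ω : Conf) (i : Fin 3) : ℝ := (B / anum ω i) ^ (1 / 3 : ℝ)

lemma count_cubes {B : ℝ} (hB : 0 ≤ B) {m : ℕ} (hm : 0 < m) :
    ∑ a ∈ Finset.Icc 1 ⌊B⌋₊, ind (∃ x, 0 < x ∧ x ^ 3 * m = a) =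
      (⌊(B / m) ^ (1 / 3 : ℝ)⌋₊ : ℝ) := by
  classical
  have hx : ∀ x : ℕ, x ≤ ⌊(B / m) ^ (1 / 3 : ℝ)⌋₊ ↔ x ^ 3 * m ≤ ⌊B⌋₊ := by
    intro x
    have hm' : (0 : ℝ) < m := by exact_mod_cast hm
    rw [Nat.le_floor_iff (by positivity), Nat.le_floor_iff hB, one_div,
      Real.le_rpow_inv_iff_of_pos (by positivity) (by positivity) (by norm_num), le_div_iff₀ hm']
    norm_cast
  simp only [ind]
  rw [Finset.sum_boole]
  congr 1
  have : (Finset.Icc 1 ⌊B⌋₊).filter (fun a => ∃ x, 0 < x ∧ x ^ 3 * m = a) =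
      (Finset.Icc 1 ⌊(B / m) ^ (1 / 3 : ℝ)⌋₊).image (fun x => x ^ 3 * m) := by
    ext a
    simp only [Finset.mem_filter, Finset.mem_Icc, Finset.mem_image, hx]
    constructor
    · rintro ⟨⟨h1, h2⟩, x, hx, rfl⟩
      exact ⟨x, ⟨hx, h2⟩, rfl⟩
    · rintro ⟨x, ⟨h1, h2⟩, rfl⟩
      exact ⟨⟨Nat.succ_le_of_lt (by positivity), h2⟩, x, h1, rfl⟩
  rw [this, Finset.card_image_of_injective, Nat.card_Icc]
  · simp
  · intro x y h
    simp only at h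
    exact Nat.pow_left_injective (n := 3) (by norm_num) (Nat.eq_of_mul_eq_mul_right hm h)

theorem Npl_hasSum {B : ℝ} (hB : 0 ≤ B) :
    HasSum (fun ω : Conf => sg (-1) ω * ∏ i, (⌊XX B ω i⌋₊ : ℝ)) (Npl B) := by
  have h0 : ∀ a ∈ Fintype.piFinset (fun _ : Fin 3 => Finset.Icc 1 ⌊B⌋₊),
      HasSum (fun ω : Conf => sg (-1) ω * ∏ i, ind (∃ x, 0 < x ∧ x ^ 3 * anum ω i = a i))
        (ind (Good a)) := by
    intro a ha
    refine good_hasSum a fun i => ?_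
    have h1 := Fintype.mem_piFinset.1 ha i
    exact (Finset.mem_Icc.1 h1).1
  have h := hasSum_sum h0
  unfold Npl
  refine Eq.mp (congrArg (fun f => HasSum f _) (funext fun ω => ?_)) h
  symm
  rw [← Finset.mul_sum]
  congr 1
  have e := Finset.prod_univ_sum (fun _ : Fin 3 => Finset.Icc 1 ⌊B⌋₊)
    (fun i (a : ℕ) => ind (∃ x, 0 < x ∧ x ^ 3 * anum ω i = a))
  refine Eq.trans ?_ e
  exact Finset.prod_congr rfl fun i _ => (count_cubes hB (anum_pos ω i)).symm

end CT

namespace CT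

lemma tprod_padic {u : ℕ} (hu : u ≠ 0) :
    ∏' p : Nat.Primes, (((padicNorm p (u : ℚ))⁻¹ : ℚ) : ℝ) = u := by
  have h1 : ∀ p : Nat.Primes, (((padicNorm p (u : ℚ))⁻¹ : ℚ) : ℝ) =
      ((p : ℕ) : ℝ) ^ (u.factorization p) := by
    intro p
    have : Fact (p : ℕ).Prime := ⟨p.2⟩
    rw [padicNorm.eq_zpow_of_nonzero (by exact_mod_cast hu), padicValRat.of_nat,
      Nat.factorization_def _ p.2]
    simp
  simp only [h1]
  let s : Finset Nat.Primes := u.primeFactors.subtype _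
  rw [tprod_eq_prod (s := s)]
  · have h2 := Nat.prod_factorization_pow_eq_self hu
    have h3 : ∏ p ∈ s, (p : ℕ) ^ (u.factorization p) = u := by
      conv_rhs => rw [← h2]
      rw [Finsupp.prod, Nat.support_factorization]
      refine Finset.prod_bij (fun p _ => (p : ℕ)) ?_ ?_ ?_ ?_
      · intro p hp; exact Finset.mem_subtype.1 hp
      · intro p _ q _ h; exact Nat.Primes.coe_nat_injective h
      · intro q hq
        exact ⟨⟨q, Nat.prime_of_mem_primeFactors hq⟩, Finset.mem_subtype.2 hq, rfl⟩
      · intro p hp; rfl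
    exact_mod_cast h3
  · intro p hp
    have : u.factorization p = 0 := by
      rw [Nat.factorization_eq_zero_iff]
      right; left
      intro h
      exact hp (Finset.mem_subtype.2 (Nat.mem_primeFactors.2 ⟨p.2, h, hu⟩))
    rw [this, pow_zero]

lemma int_unit_cases (s : ℤˣ) : (((s : ℤ) : ℚ)) = 1 ∨ (((s : ℤ) : ℚ)) = -1 := by
  rcases Int.units_eq_one_or s with rfl | rfl <;> simp

lemma height_eq (a : Fin 3 → ℕ) (ha : ∀ i, 0 < a i) (hg : ∀ p : Nat.Primes, ∃ i, ¬ (p : ℕ) ∣ a i)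
    (u : ℕ) (hu : u ^ 3 = ∏ i, a i) (s t : ℤˣ) :
    cubicTorusHeight (((s : ℤ) : ℚ) * (a 0 / u)) (((t : ℤ) : ℚ) * (a 1 / u)) =
      max (a 0 : ℝ) (max (a 1) (a 2)) := by
  have hu0 : u ≠ 0 := by
    rintro rfl
    have : 0 < ∏ i, a i := Finset.prod_pos fun i _ => ha i
    simp at hu; omega
  have huq : (u : ℚ) ≠ 0 := by exact_mod_cast hu0
  have h0 : (a 0 : ℚ) ≠ 0 := by exact_mod_cast (ha 0).ne'
  have h1 : (a 1 : ℚ) ≠ 0 := by exact_mod_cast (ha 1).ne'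
  have hu' : (u : ℚ) ^ 3 = a 0 * a 1 * a 2 := by
    rw [Fin.prod_univ_three] at hu; exact_mod_cast hu
  have hxy : ∃ w : ℤˣ, (((s : ℤ) : ℚ) * (a 0 / u)) * (((t : ℤ) : ℚ) * (a 1 / u)) =
      ((w : ℤ) : ℚ) * (u / a 2) := by
    have h2 : (a 2 : ℚ) ≠ 0 := by exact_mod_cast (ha 2).ne'
    refine ⟨s * t, ?_⟩
    push_cast
    field_simp
    rw [hu']
  obtain ⟨w, hw⟩ := hxy
  have hpn : ∀ (p : Nat.Primes) (s : ℤˣ) (r : ℚ), padicNorm p (((s : ℤ) : ℚ) * r) = padicNorm p r := by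
    intro p s r
    have : Fact (p : ℕ).Prime := ⟨p.2⟩
    rcases int_unit_cases s with h | h <;> rw [h] <;> simp
  have han : ∀ (s : ℤˣ) (r : ℚ), |((((s : ℤ) : ℚ) * r : ℚ) : ℝ)| = |(r : ℝ)| := by
    intro s r
    rcases int_unit_cases s with h | h <;> rw [h] <;> simp
  unfold cubicTorusHeight
  rw [hw]
  simp only [hpn, han]
  have hp : ∀ p : Nat.Primes, max (padicNorm p ((a 0 : ℚ) / u)) (max (padicNorm p ((a 1 : ℚ) / u))
      (padicNorm p ((u : ℚ) / a 2))⁻¹) = (padicNorm p (u : ℚ))⁻¹ := by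
    intro p
    have : Fact (p : ℕ).Prime := ⟨p.2⟩
    have hup : 0 < padicNorm p (u : ℚ) :=
      lt_of_le_of_ne (padicNorm.nonneg _) (padicNorm.nonzero huq).symm
    have hle : ∀ n : ℕ, padicNorm p (n : ℚ) ≤ 1 := fun n => padicNorm.of_nat n
    rw [padicNorm.div, padicNorm.div, padicNorm.div, inv_div, div_eq_mul_inv, div_eq_mul_inv,
      div_eq_mul_inv, ← max_mul_of_nonneg _ _ (inv_nonneg.2 hup.le),
      ← max_mul_of_nonneg _ _ (inv_nonneg.2 hup.le)]
    have : max (padicNorm p (a 0 : ℚ)) (max (padicNorm p (a 1 : ℚ)) (padicNorm p (a 2 : ℚ))) = 1 := by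
      apply le_antisymm
      · exact max_le (hle _) (max_le (hle _) (hle _))
      · obtain ⟨i, hi⟩ := hg p
        have hi' := (padicNorm.nat_eq_one_iff _).2 hi
        fin_cases i
        · exact le_max_of_le_left hi'.ge
        · exact le_max_of_le_right (le_max_of_le_left hi'.ge)
        · exact le_max_of_le_right (le_max_of_le_right hi'.ge)
    rw [this, one_mul]
  simp only [hp]
  rw [tprod_padic hu0]
  have hur : (0 : ℝ) < u := by exact_mod_cast Nat.pos_of_ne_zero hu0
  push_cast
  rw [abs_of_nonneg (by positivity), abs_of_nonneg (by positivity), abs_of_nonneg (by positivity),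
    inv_div, max_mul_of_nonneg _ _ hur.le, max_mul_of_nonneg _ _ hur.le]
  field_simp

open Classical in
noncomputable def cr (a : Fin 3 → ℕ) : ℕ := if h : ∃ u, u ^ 3 = ∏ i, a i then h.choose else 0

lemma cr_spec {a : Fin 3 → ℕ} (h : Good a) : cr a ^ 3 = ∏ i, a i := by
  rw [cr, dif_pos h.2]; exact h.2.choose_spec

lemma cr_eq {a : Fin 3 → ℕ} {u : ℕ} (h : Good a) (hu : u ^ 3 = ∏ i, a i) : cr a = u :=
  Nat.pow_left_injective (n := 3) (by norm_num) ((cr_spec h).trans hu.symm)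

lemma Good.gcd {a : Fin 3 → ℕ} (h : Good a) : Nat.gcd (a 0) (Nat.gcd (a 1) (a 2)) = 1 := by
  by_contra hne
  obtain ⟨p, hp, hd⟩ := Nat.exists_prime_and_dvd hne
  obtain ⟨i, hi⟩ := h.1 ⟨p, hp⟩
  have d0 := hd.trans (Nat.gcd_dvd_left _ _)
  have d1 := (hd.trans (Nat.gcd_dvd_right _ _)).trans (Nat.gcd_dvd_left _ _)
  have d2 := (hd.trans (Nat.gcd_dvd_right _ _)).trans (Nat.gcd_dvd_right _ _)
  fin_cases i
  · exact hi d0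
  · exact hi d1
  · exact hi d2

noncomputable def pmap (q : (Fin 3 → ℕ) × ℤˣ × ℤˣ) : ℚ × ℚ :=
  (((q.2.1 : ℤ) : ℚ) * (q.1 0 / cr q.1), ((q.2.2 : ℤ) : ℚ) * (q.1 1 / cr q.1))

lemma cr_pos {a : Fin 3 → ℕ} (h : Good a) (ha : ∀ i, 0 < a i) : 0 < cr a := by
  refine Nat.pos_of_ne_zero fun h0 => ?_
  have h1 := cr_spec h
  have : 0 < ∏ i, a i := Finset.prod_pos fun i _ => ha i
  rw [h0] at h1; simp at h1; omega

lemma sign_inj {s t : ℤˣ} {x y : ℚ} (hx : 0 < x) (hy : 0 < y)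
    (h : ((s : ℤ) : ℚ) * x = ((t : ℤ) : ℚ) * y) : s = t ∧ x = y := by
  rcases Int.units_eq_one_or s with rfl | rfl <;> rcases Int.units_eq_one_or t with rfl | rfl <;>
    simp at h ⊢ <;> linarith

lemma pmap_inj {q q' : (Fin 3 → ℕ) × ℤˣ × ℤˣ} (h : Good q.1) (ha : ∀ i, 0 < q.1 i)
    (h' : Good q'.1) (ha' : ∀ i, 0 < q'.1 i) (e : pmap q = pmap q') : q = q' := by
  obtain ⟨a, s, t⟩ := q
  obtain ⟨b, s', t'⟩ := q'
  simp only at h h' ha ha'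
  have hu := cr_pos h ha
  have hv := cr_pos h' ha'
  have hsu := cr_spec h
  have hsv := cr_spec h'
  set u := cr a with hudef
  set v := cr b with hvdef
  have hu' : (0 : ℚ) < u := by exact_mod_cast hu
  have hv' : (0 : ℚ) < v := by exact_mod_cast hv
  have haq : ∀ i, (0 : ℚ) < a i := fun i => by exact_mod_cast ha i
  have hbq : ∀ i, (0 : ℚ) < b i := fun i => by exact_mod_cast ha' i
  rw [pmap, pmap, Prod.mk.injEq] at e
  obtain ⟨e1, e2⟩ := e
  simp only [← hudef, ← hvdef] at e1 e2
  obtain ⟨rfl, f1⟩ := sign_inj (div_pos (haq 0) hu') (div_pos (hbq 0) hv') e1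
  obtain ⟨rfl, f2⟩ := sign_inj (div_pos (haq 1) hu') (div_pos (hbq 1) hv') e2
  rw [div_eq_div_iff hu'.ne' hv'.ne'] at f1 f2
  have g0 : a 0 * v = b 0 * u := by exact_mod_cast f1
  have g1 : a 1 * v = b 1 * u := by exact_mod_cast f2
  rw [Fin.prod_univ_three] at hsu hsv
  have g2 : a 2 * v = b 2 * u := by
    have hpos : 0 < (a 0 * v) * (a 1 * v) := by
      have := ha 0; have := ha 1; positivity
    apply Nat.eq_of_mul_eq_mul_left hpos
    calc (a 0 * v) * (a 1 * v) * (a 2 * v) = (a 0 * a 1 * a 2) * v ^ 3 := by ring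
      _ = u ^ 3 * (b 0 * b 1 * b 2) := by rw [← hsu, hsv]
      _ = (b 0 * u) * (b 1 * u) * (b 2 * u) := by ring
      _ = _ := by rw [g0, g1]
  have huv : v = u := by
    have h1 : Nat.gcd (a 0 * v) (Nat.gcd (a 1 * v) (a 2 * v)) = v := by
      rw [Nat.gcd_mul_right, Nat.gcd_mul_right, h.gcd, one_mul]
    have h2 : Nat.gcd (b 0 * u) (Nat.gcd (b 1 * u) (b 2 * u)) = u := by
      rw [Nat.gcd_mul_right, Nat.gcd_mul_right, h'.gcd, one_mul]
    rw [← h1, g0, g1, g2, h2]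
  rw [huv] at g0 g1 g2
  have : a = b := by
    funext i
    fin_cases i
    · exact Nat.eq_of_mul_eq_mul_right hu g0
    · exact Nat.eq_of_mul_eq_mul_right hu g1
    · exact Nat.eq_of_mul_eq_mul_right hu g2
  rw [this]

lemma exists_sign (x : ℚ) (hx : x ≠ 0) :
    ∃ (s : ℤˣ) (n d : ℕ), 0 < n ∧ 0 < d ∧ x = ((s : ℤ) : ℚ) * (n / d) := by
  have habs : |x| = (x.num.natAbs : ℚ) / x.den := by
    rw [Rat.abs_def, Rat.divInt_eq_div]
    simp
  have hn : 0 < x.num.natAbs := by simpa [Int.natAbs_pos] using hx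
  rcases lt_or_gt_of_ne hx with h | h
  · refine ⟨-1, _, _, hn, x.den_pos, ?_⟩
    rw [← habs, abs_of_neg h]; simp
  · refine ⟨1, _, _, hn, x.den_pos, ?_⟩
    rw [← habs, abs_of_pos h]; simp

lemma pmap_surj (x y : ℚ) (hx : x ≠ 0) (hy : y ≠ 0) :
    ∃ q : (Fin 3 → ℕ) × ℤˣ × ℤˣ, Good q.1 ∧ (∀ i, 0 < q.1 i) ∧ pmap q = (x, y) := by
  obtain ⟨s, n, d, hn, hd, rfl⟩ := exists_sign x hx
  obtain ⟨t, n', d', hn', hd', rfl⟩ := exists_sign y hy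
  set A := n ^ 2 * n' * d' with hA
  set B := n' ^ 2 * n * d with hB
  set C := d ^ 2 * d' ^ 2 with hC
  set M := n * n' * d * d' with hM
  have hM3 : M ^ 3 = A * B * C := by rw [hM, hA, hB, hC]; ring
  have hA0 : 0 < A := by positivity
  have hB0 : 0 < B := by positivity
  have hC0 : 0 < C := by positivity
  have hM0 : 0 < M := by positivity
  set g := Nat.gcd A (Nat.gcd B C) with hg
  have hg0 : 0 < g := Nat.gcd_pos_of_pos_left _ hA0
  obtain ⟨a, ha⟩ : g ∣ A := Nat.gcd_dvd_left _ _
  obtain ⟨b, hb⟩ : g ∣ B := (Nat.gcd_dvd_right _ _).trans (Nat.gcd_dvd_left _ _)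
  obtain ⟨c, hc⟩ : g ∣ C := (Nat.gcd_dvd_right _ _).trans (Nat.gcd_dvd_right _ _)
  obtain ⟨u, hu⟩ : g ∣ M := by
    rw [← Nat.pow_dvd_pow_iff (n := 3) (by norm_num), hM3, ha, hb, hc]
    exact ⟨a * b * c, by ring⟩
  have ha0 : 0 < a := Nat.pos_of_ne_zero (by rintro rfl; omega)
  have hb0 : 0 < b := Nat.pos_of_ne_zero (by rintro rfl; omega)
  have hc0 : 0 < c := Nat.pos_of_ne_zero (by rintro rfl; omega)
  have hu0 : 0 < u := Nat.pos_of_ne_zero (by rintro rfl; omega)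
  have hu3 : u ^ 3 = a * b * c := by
    have hgp : 0 < g ^ 3 := by positivity
    apply Nat.eq_of_mul_eq_mul_left hgp
    calc g ^ 3 * u ^ 3 = (g * u) ^ 3 := by ring
      _ = (g * a) * (g * b) * (g * c) := by rw [← hu, hM3, ← ha, ← hb, ← hc]
      _ = _ := by ring
  have hgcd : Nat.gcd a (Nat.gcd b c) = 1 := by
    apply Nat.eq_of_mul_eq_mul_left hg0
    rw [← Nat.gcd_mul_left, ← Nat.gcd_mul_left, ← ha, ← hb, ← hc, ← hg, mul_one]
  have hgood : Good ![a, b, c] := by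
    refine ⟨fun p => ?_, u, ?_⟩
    · by_contra hcon
      push Not at hcon
      have h0 := hcon 0
      have h1 := hcon 1
      have h2 := hcon 2
      simp at h0 h1 h2
      have := Nat.dvd_gcd h0 (Nat.dvd_gcd h1 h2)
      rw [hgcd] at this
      exact p.2.one_lt.ne' (Nat.dvd_one.1 this)
    · rw [Fin.prod_univ_three]; simpa using hu3
  have hcr : cr ![a, b, c] = u := cr_eq hgood (by rw [Fin.prod_univ_three]; simpa using hu3)
  refine ⟨(![a, b, c], s, t), hgood, ?_, ?_⟩
  · intro i
    fin_cases i <;> simp [ha0, hb0, hc0]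
  · have huq : (0 : ℚ) < u := by exact_mod_cast hu0
    have hgq : (0 : ℚ) < g := by exact_mod_cast hg0
    have hdq : (0 : ℚ) < d := by exact_mod_cast hd
    have hdq' : (0 : ℚ) < d' := by exact_mod_cast hd'
    have hnq : (0 : ℚ) < n := by exact_mod_cast hn
    have hnq' : (0 : ℚ) < n' := by exact_mod_cast hn'
    have e1 : (a : ℚ) / u = n / d := by
      rw [div_eq_div_iff huq.ne' hdq.ne']
      have : a * d = n * u := by
        apply Nat.eq_of_mul_eq_mul_left hg0
        calc g * (a * d) = (g * a) * d := by ring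
          _ = A * d := by rw [ha]
          _ = n * M := by rw [hA, hM]; ring
          _ = n * (g * u) := by rw [← hu]
          _ = _ := by ring
      exact_mod_cast this
    have e2 : (b : ℚ) / u = n' / d' := by
      rw [div_eq_div_iff huq.ne' hdq'.ne']
      have : b * d' = n' * u := by
        apply Nat.eq_of_mul_eq_mul_left hg0
        calc g * (b * d') = (g * b) * d' := by ring
          _ = B * d' := by rw [hb]
          _ = n' * M := by rw [hB, hM]; ring
          _ = n' * (g * u) := by rw [← hu]
          _ = _ := by ring
      exact_mod_cast this
    simp [pmap, hcr, e1, e2]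

theorem count_eq {B : ℝ} (hB : 0 ≤ B) : (cubicTorusCount B : ℝ) = 4 * Npl B := by
  classical
  set T : Finset (Fin 3 → ℕ) :=
    (Fintype.piFinset (fun _ : Fin 3 => Finset.Icc 1 ⌊B⌋₊)).filter Good with hT
  have hTm : ∀ a, a ∈ T ↔ Good a ∧ (∀ i, 0 < a i) ∧ max (a 0 : ℝ) (max (a 1) (a 2)) ≤ B := by
    intro a
    rw [hT, Finset.mem_filter, Fintype.mem_piFinset]
    simp only [Finset.mem_Icc, Nat.le_floor_iff hB, max_le_iff]
    rw [forall_and, Fin.forall_fin_succ (P := fun i => (a i : ℝ) ≤ B), Fin.forall_fin_two]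
    simp only [Nat.succ_le_iff]
    tauto
  have h1 : Npl B = T.card := by
    rw [Npl, hT]
    simp only [ind]
    rw [Finset.sum_boole]
  set F : Finset (ℚ × ℚ) := (T ×ˢ (Finset.univ : Finset (ℤˣ × ℤˣ))).image pmap with hF
  have hcard : F.card = T.card * 4 := by
    rw [hF, Finset.card_image_of_injOn, Finset.card_product]
    · congr 1
    · intro q hq q' hq' e
      have m1 := (hTm _).1 (Finset.mem_product.1 hq).1
      have m2 := (hTm _).1 (Finset.mem_product.1 hq').1
      exact pmap_inj m1.1 m1.2.1 m2.1 m2.2.1 e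
  have himg : Set.image (fun q : ℚˣ × ℚˣ => ((q.1 : ℚ), (q.2 : ℚ)))
      {q : ℚˣ × ℚˣ | cubicTorusHeight (q.1 : ℚ) (q.2 : ℚ) ≤ B} = (F : Set (ℚ × ℚ)) := by
    ext ⟨x, y⟩
    simp only [Set.mem_image, Set.mem_ofPred_eq, Finset.mem_coe]
    constructor
    · rintro ⟨q, hq, e⟩
      obtain ⟨rfl, rfl⟩ := Prod.mk.inj e
      obtain ⟨r, hr, hr0, hre⟩ := pmap_surj q.1 q.2 q.1.ne_zero q.2.ne_zero
      rw [hF, Finset.mem_image]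
      refine ⟨r, Finset.mem_product.2 ⟨(hTm _).2 ⟨hr, hr0, ?_⟩, Finset.mem_univ _⟩, hre⟩
      rw [← height_eq r.1 hr0 hr.1 _ (cr_spec hr) r.2.1 r.2.2]
      have e' := Prod.mk.inj hre
      rw [e'.1, e'.2]
      exact hq
    · intro h
      rw [hF, Finset.mem_image] at h
      obtain ⟨r, hr, hre⟩ := h
      obtain ⟨hg, hp, hm⟩ := (hTm _).1 (Finset.mem_product.1 hr).1
      rw [← height_eq r.1 hp hg.1 _ (cr_spec hg) r.2.1 r.2.2] at hm
      have e' := Prod.mk.inj hre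
      rw [e'.1, e'.2] at hm
      have hc := cr_pos hg hp
      have hnz : ∀ (s : ℤˣ) (i : Fin 3), ((s : ℤ) : ℚ) * (r.1 i / cr r.1) ≠ 0 := by
        intro s i
        have : (0 : ℚ) < r.1 i := by exact_mod_cast hp i
        have : (0 : ℚ) < cr r.1 := by exact_mod_cast hc
        refine mul_ne_zero ?_ (by positivity)
        rcases int_unit_cases s with h | h <;> rw [h] <;> norm_num
      have hx : x ≠ 0 := by rw [← e'.1]; exact hnz _ _
      have hy : y ≠ 0 := by rw [← e'.2]; exact hnz _ _
      exact ⟨(Units.mk0 x hx, Units.mk0 y hy), hm, rfl⟩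
  have hinj : Function.Injective (fun q : ℚˣ × ℚˣ => ((q.1 : ℚ), (q.2 : ℚ))) := by
    intro q q' e
    have e' := Prod.mk.inj e
    exact Prod.ext (Units.ext e'.1) (Units.ext e'.2)
  rw [cubicTorusCount, ← Set.ncard_image_of_injective _ hinj, himg, Set.ncard_coe_finset, hcard, h1]
  push_cast; ring

end CT

namespace CT

lemma loc_eq (p : Nat.Primes) : loc (-1) 0 p = cubicTorusEulerFactor p := by
  have hp : ((p : ℕ) : ℝ) ≠ 0 := by exact_mod_cast p.2.ne_zero
  have h1 : ∀ c, gterm (-1) 0 p c = ceps (-1) c * (((p : ℕ) : ℝ)⁻¹) ^ cdeg c := by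
    intro c
    have : cexpo 0 c = (cdeg c : ℝ) := by simp [cexpo]
    rw [gterm, this, Real.rpow_neg (by positivity), Real.rpow_natCast, inv_pow]
  have h2 : ∀ j, ((p : ℕ) : ℝ) ^ (-(1 + sdot j 0)) = ((p : ℕ) : ℝ)⁻¹ := by
    intro j
    have : sdot j 0 = 0 := by simp [sdot]
    rw [this, add_zero, Real.rpow_neg_one]
  rw [loc, cubicTorusEulerFactor]
  simp only [h1, h2, Fintype.sum_sum_type, Fin.sum_univ_seven]
  simp [ceps, cdeg]
  set t := ((p : ℕ) : ℝ)⁻¹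
  rw [div_eq_mul_inv, ← inv_pow]
  ring

lemma loc_pos (p : Nat.Primes) : 0 < cubicTorusEulerFactor p := by
  have h := prime_one_lt p
  have : 1 / ((p : ℕ) : ℝ) < 1 := by rw [div_lt_one (by linarith)]; exact h
  unfold cubicTorusEulerFactor
  have h2 : 0 < 1 - 1 / ((p : ℕ) : ℝ) := by linarith
  positivity

lemma Eul_eq : Eul (-1) = ∏' p, cubicTorusEulerFactor p := by
  unfold Eul; exact tprod_congr loc_eq

lemma Euler_multipliable : Multipliable cubicTorusEulerFactor := by
  have := loc_multipliable (-1) (by simp) 0 (fun _ => le_rfl)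
  exact this.congr loc_eq

lemma Euler_pos : 0 < ∏' p, cubicTorusEulerFactor p := by
  have hs : Summable fun p => cubicTorusEulerFactor p - 1 := by
    refine Summable.of_norm_bounded (summable_prime_sq.mul_left 43) fun p => ?_
    rw [← loc_eq]
    exact loc_sub_bound (-1) (by simp) 0 (fun _ => le_rfl) p
  have hl := Real.summable_log_one_add_of_summable hs
  simp only [add_sub_cancel] at hl
  rw [← Real.rexp_tsum_eq_tprod loc_pos hl]
  exact Real.exp_pos _

lemma exists_ramp {r R : ℝ} (hr : r < R) : ∃ ψ : C(Cube, ℝ), ∀ x : Fin 3 → ℝ, (∀ i, 0 ≤ x i) →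
    0 ≤ Tf ψ x ∧ Tf ψ x ≤ 1 ∧ ((∀ i, x i ≤ r) → Tf ψ x = 1) ∧ ((∃ i, R ≤ x i) → Tf ψ x = 0) := by
  set a := Real.exp (-R) with ha
  set b := Real.exp (-r) with hb
  have ha0 : 0 < a := Real.exp_pos _
  have hab : a < b := Real.exp_lt_exp.2 (by linarith)
  let ψ : C(Cube, ℝ) := ⟨fun y => (max 0 (min 1 ((min (y 0 : ℝ) (min (y 1) (y 2)) - a) / (b - a)))) /
    ∏ i, max (y i : ℝ) a, by
      refine Continuous.div (by fun_prop) (by fun_prop) fun y => ?_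
      exact Finset.prod_ne_zero_iff.2 fun i _ => (lt_max_of_lt_right ha0).ne'⟩
  have hψ : ∀ x : Fin 3 → ℝ, (∀ i, 0 ≤ x i) → Tf ψ x =
      max 0 (min 1 ((min (Real.exp (-x 0)) (min (Real.exp (-x 1)) (Real.exp (-x 2))) - a) / (b - a)))
      := by
    intro x hx
    have e : Tf ψ x = Real.exp (-∑ i, x i) * ((max 0 (min 1 ((min (Real.exp (-x 0))
      (min (Real.exp (-x 1)) (Real.exp (-x 2))) - a) / (b - a)))) /
      ∏ i, max (Real.exp (-x i)) a) := by
      simp only [Tf, ψ, ContinuousMap.coe_mk, ye_coe x hx]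
    rw [e]
    set m := min (Real.exp (-x 0)) (min (Real.exp (-x 1)) (Real.exp (-x 2))) with hm
    by_cases h : a ≤ m
    · have hi : ∀ i, max (Real.exp (-x i)) a = Real.exp (-x i) := by
        intro i
        apply max_eq_left
        refine h.trans ?_
        fin_cases i
        · exact min_le_left _ _
        · exact (min_le_right _ _).trans (min_le_left _ _)
        · exact (min_le_right _ _).trans (min_le_right _ _)
      simp only [hi]
      rw [← Real.exp_sum, Finset.sum_neg_distrib]
      field_simp
    · have : (m - a) / (b - a) ≤ 0 := div_nonpos_of_nonpos_of_nonneg (by linarith) (by linarith)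
      rw [max_eq_left ((min_le_right _ _).trans this)]
      simp
  refine ⟨ψ, fun x hx => ?_⟩
  rw [hψ x hx]
  refine ⟨le_max_left _ _, max_le zero_le_one (min_le_left _ _), fun h => ?_, fun ⟨i, h⟩ => ?_⟩
  · have hm : b ≤ min (Real.exp (-x 0)) (min (Real.exp (-x 1)) (Real.exp (-x 2))) :=
      le_min (Real.exp_le_exp.2 (by linarith [h 0]))
        (le_min (Real.exp_le_exp.2 (by linarith [h 1])) (Real.exp_le_exp.2 (by linarith [h 2])))
    rw [min_eq_left, max_eq_right zero_le_one]
    rw [le_div_iff₀ (by linarith)]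
    linarith
  · have hm : min (Real.exp (-x 0)) (min (Real.exp (-x 1)) (Real.exp (-x 2))) ≤ a := by
      have hi : Real.exp (-x i) ≤ a := Real.exp_le_exp.2 (by linarith)
      refine le_trans ?_ hi
      fin_cases i
      · exact min_le_left _ _
      · exact (min_le_right _ _).trans (min_le_left _ _)
      · exact (min_le_right _ _).trans (min_le_right _ _)
    have : (min (Real.exp (-x 0)) (min (Real.exp (-x 1)) (Real.exp (-x 2))) - a) / (b - a) ≤ 0 :=
      div_nonpos_of_nonpos_of_nonneg (by linarith) (by linarith)
    exact max_eq_left ((min_le_right _ _).trans this)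

lemma anum_prod (ω : Conf) : ((∏ i, anum ω i : ℕ) : ℝ)⁻¹ = wt ω ^ 3 := by
  have : ∏ i, anum ω i = (∏ p : ω.1, ((p : Nat.Primes) : ℕ) ^ cdeg (ω.2 p)) ^ 3 := by
    unfold anum
    rw [Finset.prod_comm, ← Finset.prod_pow]
    refine Finset.prod_congr rfl fun p _ => ?_
    rw [Finset.prod_pow_eq_pow_sum, cvec_sum, ← pow_mul, mul_comm]
  rw [this, wt]
  push_cast
  rw [← inv_pow, ← Finset.prod_inv_distrib]
  simp only [inv_pow]

lemma XX_eq {B : ℝ} (hB : 0 < B) (ω : Conf) (i : Fin 3) :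
    XX B ω i = Real.exp ((Real.log B - ell ω i) / 3) := by
  have h : (0 : ℝ) < anum ω i := by exact_mod_cast anum_pos ω i
  rw [XX, Real.rpow_def_of_pos (by positivity), Real.log_div hB.ne' h.ne', ell]
  congr 1; ring

lemma XX_prod {B : ℝ} (hB : 0 < B) (ω : Conf) : ∏ i, XX B ω i = B * wt ω := by
  have h3 : (∏ i, XX B ω i) ^ 3 = (B * wt ω) ^ 3 := by
    rw [mul_pow, ← anum_prod, ← Finset.prod_pow]
    have : ∀ i, XX B ω i ^ 3 = B / anum ω i := by
      intro i
      rw [XX, ← Real.rpow_natCast, ← Real.rpow_mul (by positivity)]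
      norm_num
    simp only [this, Fin.prod_univ_three]
    push_cast
    field_simp
  have h1 : 0 ≤ ∏ i, XX B ω i := Finset.prod_nonneg fun i _ => by rw [XX_eq hB]; positivity
  have h2 : 0 ≤ B * wt ω := mul_nonneg hB.le (wt_pos ω).le
  exact (pow_left_inj₀ h1 h2 (by norm_num)).1 h3

end CT

namespace CT

/-- the ratio of the true count to its approximation -/
noncomputable def Phi (B : ℝ) (ω : Conf) : ℝ := ∏ i, (⌊XX B ω i⌋₊ : ℝ) / XX B ω i

lemma XX_pos {B : ℝ} (hB : 0 < B) (ω : Conf) (i : Fin 3) : 0 < XX B ω i := by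
  rw [XX_eq hB]; positivity

lemma Phi_nonneg {B : ℝ} (hB : 0 < B) (ω : Conf) : 0 ≤ Phi B ω :=
  Finset.prod_nonneg fun i _ => div_nonneg (Nat.cast_nonneg _) (XX_pos hB ω i).le

lemma Phi_le {B : ℝ} (hB : 0 < B) (ω : Conf) : Phi B ω ≤ 1 := by
  refine Finset.prod_le_one (fun i _ => div_nonneg (Nat.cast_nonneg _) (XX_pos hB ω i).le)
    fun i _ => ?_
  rw [div_le_one (XX_pos hB ω i)]
  exact Nat.floor_le (XX_pos hB ω i).le

lemma term_Phi {B : ℝ} (hB : 0 < B) (ω : Conf) :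
    ∏ i, (⌊XX B ω i⌋₊ : ℝ) = B * wt ω * Phi B ω := by
  rw [← XX_prod hB, Phi, ← Finset.prod_mul_distrib]
  refine Finset.prod_congr rfl fun i _ => ?_
  have := (XX_pos hB ω i).ne'
  field_simp

lemma Phi_zero {B : ℝ} (hB : 0 < B) (ω : Conf) (i : Fin 3) (h : Real.log B < ell ω i) :
    Phi B ω = 0 := by
  refine Finset.prod_eq_zero (Finset.mem_univ i) ?_
  have : ⌊XX B ω i⌋₊ = 0 := by
    rw [Nat.floor_eq_zero, XX_eq hB, Real.exp_lt_one_iff]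
    linarith
  rw [this]; simp

lemma Phi_ge {B : ℝ} (hB : 0 < B) (ω : Conf) {y : ℝ} (hy : 0 ≤ y)
    (h : ∀ i, y ≤ (Real.log B - ell ω i) / 3) : 1 - 3 * Real.exp (-y) ≤ Phi B ω := by
  have hX : ∀ i, (XX B ω i)⁻¹ ≤ Real.exp (-y) := by
    intro i
    rw [XX_eq hB, ← Real.exp_neg]
    exact Real.exp_le_exp.2 (by linarith [h i])
  have he : Real.exp (-y) ≤ 1 := Real.exp_le_one_iff.2 (by linarith)
  have h1 := one_sub_sum_le (Finset.univ : Finset (Fin 3)) (fun i => (XX B ω i)⁻¹)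
    (fun i => (inv_pos.2 (XX_pos hB ω i)).le) (fun i => (hX i).trans he)
  have h2 : ∏ i, (1 - (XX B ω i)⁻¹) ≤ Phi B ω := by
    refine Finset.prod_le_prod (fun i _ => sub_nonneg.2 ((hX i).trans he)) fun i _ => ?_
    have hp := XX_pos hB ω i
    rw [le_div_iff₀ hp, sub_mul, inv_mul_cancel₀ hp.ne', one_mul]
    exact (Nat.sub_one_lt_floor _).le
  have h3 : ∑ i, (XX B ω i)⁻¹ ≤ 3 * Real.exp (-y) := by
    rw [Fin.sum_univ_three]; linarith [hX 0, hX 1, hX 2]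
  linarith

/-- Ramp function property -/
def IsRamp (r R : ℝ) (ψ : C(Cube, ℝ)) : Prop := ∀ x : Fin 3 → ℝ, (∀ i, 0 ≤ x i) →
    0 ≤ Tf ψ x ∧ Tf ψ x ≤ 1 ∧ ((∀ i, x i ≤ r) → Tf ψ x = 1) ∧ ((∃ i, R ≤ x i) → Tf ψ x = 0)

lemma Phi_sub {B δ : ℝ} (hB : 0 < B) (hL : 0 < Real.log B) (hδ : 0 < δ) {ψp ψm : C(Cube, ℝ)}
    (hp : IsRamp 1 (1 + δ) ψp) (hm : IsRamp (1 - 2 * δ) (1 - δ) ψm) (ω : Conf) :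
    |Phi B ω - Tf ψm (fun i => ell ω i / Real.log B)| ≤
      Tf ψp (fun i => ell ω i / Real.log B) - Tf ψm (fun i => ell ω i / Real.log B) +
      3 * Real.exp (-(Real.log B * δ / 3)) * Tf ψp (fun i => ell ω i / Real.log B) := by
  set L := Real.log B with hLd
  have hx : ∀ i, 0 ≤ ell ω i / L := fun i => div_nonneg (ell_nonneg ω i) hL.le
  obtain ⟨p0, p1, p2, p3⟩ := hp (fun i => ell ω i / L) hx
  obtain ⟨m0, m1, m2, m3⟩ := hm (fun i => ell ω i / L) hx
  set tp := Tf ψp (fun i => ell ω i / L)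
  set tm := Tf ψm (fun i => ell ω i / L)
  have hE := Real.exp_pos (-(L * δ / 3))
  have f0 := Phi_nonneg hB ω
  have f1 := Phi_le hB ω
  by_cases h1 : ∀ i, ell ω i / L ≤ 1
  · have e1 := p2 h1
    by_cases h2 : ∃ i, 1 - δ ≤ ell ω i / L
    · have e2 := m3 h2
      rw [e1, e2, sub_zero, abs_of_nonneg f0]
      nlinarith
    · push Not at h2
      have h3 := Phi_ge hB ω (y := L * δ / 3) (by positivity) (fun i => by
        have := h2 i
        rw [div_lt_iff₀ hL] at this
        nlinarith)
      rw [e1, abs_le]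
      constructor <;> linarith
  · push Not at h1
    obtain ⟨i, hi⟩ := h1
    have e2 := m3 ⟨i, by linarith⟩
    rw [lt_div_iff₀ hL, one_mul] at hi
    rw [Phi_zero hB ω i hi, e2]
    simp only [sub_zero, abs_zero]
    positivity

lemma main_bound {B δ : ℝ} (hB : 0 < B) (hL : 0 < Real.log B) (hδ : 0 < δ) {ψp ψm : C(Cube, ℝ)}
    (hp : IsRamp 1 (1 + δ) ψp) (hm : IsRamp (1 - 2 * δ) (1 - δ) ψm) :
    |Npl B / (B * Real.log B ^ 6) - Lam (-1) (Real.log B) ψm| ≤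
      Lam 1 (Real.log B) ψp - Lam 1 (Real.log B) ψm +
      3 * Real.exp (-(Real.log B * δ / 3)) * Lam 1 (Real.log B) ψp := by
  have hP := Phi_sub hB hL hδ hp hm
  have hN := Npl_hasSum hB.le
  set L := Real.log B with hLd
  have s1 := Lam_summable (ε := 1) (by simp) hL ψp
  have s2 := Lam_summable (ε := 1) (by simp) hL ψm
  have s3 := Lam_summable (ε := -1) (by simp) hL ψm
  simp only [sg_one, one_mul] at s1 s2
  have hN1 : HasSum (fun ω : Conf => sg (-1) ω * wt ω * Phi B ω) (Npl B / B) := by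
    refine Eq.mp (congrArg (fun f => HasSum f _) (funext fun ω => ?_)) (hN.div_const B)
    rw [term_Phi hB]
    field_simp
  have hN2 := hN1.sub s3.hasSum
  have sb := (s1.sub s2).add (s1.mul_left (3 * Real.exp (-(L * δ / 3))))
  have hb : ∀ ω : Conf, ‖sg (-1) ω * wt ω * Phi B ω -
      sg (-1) ω * wt ω * Tf ψm (fun i => ell ω i / L)‖ ≤
      (wt ω * Tf ψp (fun i => ell ω i / L) - wt ω * Tf ψm (fun i => ell ω i / L)) +
        3 * Real.exp (-(L * δ / 3)) * (wt ω * Tf ψp (fun i => ell ω i / L)) := by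
    intro ω
    rw [← mul_sub, Real.norm_eq_abs, abs_mul, abs_mul, sg_abs (by simp), abs_of_pos (wt_pos ω),
      one_mul]
    have := mul_le_mul_of_nonneg_left (hP ω) (wt_pos ω).le
    refine this.trans (le_of_eq ?_)
    ring
  have key := tsum_of_norm_bounded sb.hasSum hb
  rw [hN2.tsum_eq, (s1.sub s2).tsum_add (s1.mul_left _), s1.tsum_sub s2, tsum_mul_left] at key
  have hL6 : 0 < (L⁻¹) ^ 6 := by positivity
  have key2 := mul_le_mul_of_nonneg_left key hL6.le
  have e1 : Npl B / (B * L ^ 6) - Lam (-1) L ψm = (L⁻¹) ^ 6 * (Npl B / B -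
      ∑' ω : Conf, sg (-1) ω * wt ω * Tf ψm (fun i => ell ω i / L)) := by
    unfold Lam
    rw [mul_sub]
    congr 1
    field_simp
  rw [e1, abs_mul, abs_of_pos hL6]
  refine key2.trans (le_of_eq ?_)
  unfold Lam
  simp only [sg_one, one_mul]
  ring

theorem Npl_tendsto :
    Tendsto (fun B : ℝ => Npl B / (B * Real.log B ^ 6)) atTop (𝓝 (Eul (-1) / 2880)) := by
  rw [Metric.tendsto_nhds]
  intro η hη
  set K := |Eul (-1)| + |Eul 1| with hK
  have hcont : Tendsto (fun δ : ℝ => K * (((1 + δ) ^ 6 - (1 - 2 * δ) ^ 6) / 2880)) (𝓝[>] 0) (𝓝 0) := by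
    have : Continuous (fun δ : ℝ => K * (((1 + δ) ^ 6 - (1 - 2 * δ) ^ 6) / 2880)) := by fun_prop
    have h := this.tendsto 0
    simp only [mul_zero, add_zero, sub_zero, one_pow, sub_self, zero_div] at h
    exact h.mono_left nhdsWithin_le_nhds
  have hex : ∀ᶠ δ : ℝ in 𝓝[>] 0, 0 < δ ∧ δ < 1 / 4 ∧
      K * (((1 + δ) ^ 6 - (1 - 2 * δ) ^ 6) / 2880) < η := by
    filter_upwards [hcont.eventually (gt_mem_nhds hη), self_mem_nhdsWithin,
      nhdsWithin_le_nhds (gt_mem_nhds (show (0 : ℝ) < 1 / 4 by norm_num))] with δ h1 h2 h3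
    exact ⟨h2, h3, h1⟩
  obtain ⟨δ, hδ, hδ1, hδη⟩ := hex.exists
  obtain ⟨ψp, hp⟩ := exists_ramp (r := 1) (R := 1 + δ) (by linarith)
  obtain ⟨ψm, hm⟩ := exists_ramp (r := 1 - 2 * δ) (R := 1 - δ) (by linarith)
  have dp1 : Dl ψp ≤ (1 + δ) ^ 6 / 2880 := Dl_le (by linarith) (fun x hx => (hp x hx).2.1)
    (fun x hx h => by
      push Not at h
      obtain ⟨i, hi⟩ := h
      exact ((hp x hx).2.2.2 ⟨i, hi.le⟩).le)
  have dp2 : (1 : ℝ) ^ 6 / 2880 ≤ Dl ψp := le_Dl (by linarith) (fun x hx => (hp x hx).1)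
    (fun x hx h => ((hp x hx).2.2.1 h).ge)
  have dm1 : Dl ψm ≤ (1 - δ) ^ 6 / 2880 := Dl_le (by linarith) (fun x hx => (hm x hx).2.1)
    (fun x hx h => by
      push Not at h
      obtain ⟨i, hi⟩ := h
      exact ((hm x hx).2.2.2 ⟨i, hi.le⟩).le)
  have dm2 : (1 - 2 * δ) ^ 6 / 2880 ≤ Dl ψm := le_Dl (by linarith) (fun x hx => (hm x hx).1)
    (fun x hx h => ((hm x hx).2.2.1 h).ge)
  have t1 := Lam_tendsto (ε := 1) (by simp) ψp
  have t2 := Lam_tendsto (ε := 1) (by simp) ψm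
  have t3 := Lam_tendsto (ε := -1) (by simp) ψm
  have tE : Tendsto (fun L : ℝ => 3 * Real.exp (-(L * δ / 3))) atTop (𝓝 0) := by
    have h1 : Tendsto (fun L : ℝ => L * δ / 3) atTop atTop := by
      simp only [mul_div_assoc]
      exact tendsto_id.atTop_mul_const (by positivity)
    have := (Real.tendsto_exp_neg_atTop_nhds_zero.comp h1).const_mul 3
    simpa using this
  have tG := ((t1.sub t2).add (tE.mul t1)).add ((t3.sub_const (Eul (-1) / 2880)).abs)
  have hlt : Eul 1 * Dl ψp - Eul 1 * Dl ψm + 0 * (Eul 1 * Dl ψp) +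
      |Eul (-1) * Dl ψm - Eul (-1) / 2880| < η := by
    refine lt_of_le_of_lt ?_ hδη
    have a1 : (1 - δ) ^ 6 ≤ 1 := pow_le_one₀ (by linarith) (by linarith)
    have a2 : 1 ≤ (1 + δ) ^ 6 := one_le_pow₀ (by linarith)
    have b1 : Eul 1 * Dl ψp - Eul 1 * Dl ψm ≤
        |Eul 1| * (((1 + δ) ^ 6 - (1 - 2 * δ) ^ 6) / 2880) := by
      rw [← mul_sub]
      have : 0 ≤ Dl ψp - Dl ψm := by linarith
      calc Eul 1 * (Dl ψp - Dl ψm) ≤ |Eul 1| * (Dl ψp - Dl ψm) := by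
            gcongr; exact le_abs_self _
        _ ≤ _ := by gcongr; linarith
    have b2 : |Eul (-1) * Dl ψm - Eul (-1) / 2880| ≤
        |Eul (-1)| * (((1 + δ) ^ 6 - (1 - 2 * δ) ^ 6) / 2880) := by
      rw [div_eq_mul_inv, ← mul_sub, abs_mul]
      gcongr
      rw [abs_le]
      constructor <;> linarith
    rw [hK, add_mul, zero_mul, add_zero]
    linarith
  have ev := Real.tendsto_log_atTop.eventually (tG.eventually (gt_mem_nhds hlt))
  filter_upwards [ev, eventually_gt_atTop 1] with B hB1 hB2
  have hL : 0 < Real.log B := Real.log_pos hB2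
  have hmb := main_bound (by linarith) hL hδ hp hm
  rw [Real.dist_eq]
  refine lt_of_le_of_lt ?_ hB1
  calc |Npl B / (B * Real.log B ^ 6) - Eul (-1) / 2880|
      ≤ |Npl B / (B * Real.log B ^ 6) - Lam (-1) (Real.log B) ψm| +
        |Lam (-1) (Real.log B) ψm - Eul (-1) / 2880| := abs_sub_le _ _ _
    _ ≤ _ := by gcongr

end CT

/-- **Rational points of bounded height on the cubic surface `xyz = u³`.**
With `H(x,y) = ∏_v max(|x|_v, |y|_v, |xy|_v⁻¹)` and
`N(B) = #{(x,y) ∈ ℚ^× × ℚ^× : H(x,y) ≤ B}`, one has, as `B → ∞`,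
`N(B) = c · B (log B)⁶ (1 + o(1))` where
`c = (1/720) ∏_p (1 + 7/p + 1/p²)(1 - 1/p)⁷`, the product over all primes
converging to a positive real number. -/
theorem cubicTorus_counting_asymptotic :
    Multipliable cubicTorusEulerFactor ∧
    0 < ∏' p : Nat.Primes, cubicTorusEulerFactor p ∧
    Tendsto
      (fun B : ℝ => (cubicTorusCount B : ℝ) / (B * Real.log B ^ 6))
      atTop
      (𝓝 ((1 / 720) * ∏' p : Nat.Primes, cubicTorusEulerFactor p)) := by
  refine ⟨CT.Euler_multipliable, CT.Euler_pos, ?_⟩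
  have h := CT.Npl_tendsto.const_mul 4
  rw [CT.Eul_eq] at h
  have e : 4 * ((∏' p : Nat.Primes, cubicTorusEulerFactor p) / 2880) =
      (1 / 720) * ∏' p : Nat.Primes, cubicTorusEulerFactor p := by ring
  rw [e] at h
  refine h.congr' ?_
  filter_upwards [eventually_ge_atTop 0] with B hB
  rw [CT.count_eq hB, mul_div_assoc]
end
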